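/- Let K be a field and S = K[x_1,...,x_n] a polynomial ring. Let I ⊆ S be a monomial ideal generated in degree 2 with height g. Then there exists a monomial ideal J ⊆ S containing (x_1^2,...,x_g^2) such that the Hilbert function of S/J equals the Hilbert function of S/I and, moreover, the projective dimension of S/J equals the projective dimension of S/I. -/

import Mathlib

open MvPolynomial CategoryTheory

/-- The height of an ideal: the infimum of heights of primes containing it. -/
noncomputable def idealHeight {R : Type*} [CommRing R] (I : Ideal R) : ℕ∞ :=
  ⨅ P : {P : PrimeSpectrum R // I ≤ P.asIdeal}, Order.height P.val

/-- The Hilbert function of the graded quotient `S/I`. -/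
noncomputable def hilbertFunction (K : Type*) [Field K] {n : ℕ}
    (I : Ideal (MvPolynomial (Fin n) K)) (d : ℕ) : ℕ :=
  Module.finrank K ((MvPolynomial.homogeneousSubmodule (Fin n) K d).map
    (Ideal.Quotient.mkₐ K I).toLinearMap)

/-- An ideal is a monomial ideal if it is generated by monomials. -/
def IsMonomialIdeal {K : Type*} [Field K] {n : ℕ} (I : Ideal (MvPolynomial (Fin n) K)) : Prop :=
  ∃ M : Set (Fin n →₀ ℕ), I = Ideal.span ((fun m => MvPolynomial.monomial m (1 : K)) '' M)

/-- A monomial ideal generated in degree 2, i.e. generated by products of two variables. -/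
def IsQuadraticMonomialIdeal {K : Type*} [Field K] {n : ℕ}
    (I : Ideal (MvPolynomial (Fin n) K)) : Prop :=
  ∃ E : Set (Fin n × Fin n), I = Ideal.span ((fun e => X e.1 * X e.2) '' E)

/-- The projective dimension of a module: the infimum of the lengths of its projective
resolutions (`⊤` if there is no finite projective resolution). -/
noncomputable def projDim {R : Type*} [Ring R] (M : ModuleCat R) : ℕ∞ :=
  sInf {c : ℕ∞ | ∃ k : ℕ, c = (k : ℕ∞) ∧ ∃ P : ProjectiveResolution M,
    ∀ i : ℕ, k < i → Limits.IsZero (P.complex.X i)}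


namespace CLi
open Finset

def T {p : ℕ} (c : Fin p → ℕ) (d : ℕ) : Finset (Fin p → ℕ) :=
  (Finset.Iic c).filter (fun u => ∑ i, u i = d)

lemma mem_T {p : ℕ} {c : Fin p → ℕ} {d : ℕ} {u : Fin p → ℕ} :
    u ∈ T c d ↔ u ≤ c ∧ ∑ i, u i = d := by simp [T]

open Classical in
noncomputable def Up {p : ℕ} (c : Fin p → ℕ) (d : ℕ) (A : Finset (Fin p → ℕ)) :
    Finset (Fin p → ℕ) :=
  (T c (d+1)).filter (fun v => ∃ u ∈ A, u ≤ v)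

lemma mem_Up {p : ℕ} {c : Fin p → ℕ} {d : ℕ} {A : Finset (Fin p → ℕ)} {v : Fin p → ℕ} :
    v ∈ Up c d A ↔ v ∈ T c (d+1) ∧ ∃ u ∈ A, u ≤ v := by simp [Up]

def Seg {p : ℕ} (c : Fin p → ℕ) (d : ℕ) (L : Finset (Fin p → ℕ)) : Prop :=
  L ⊆ T c d ∧ ∀ u ∈ L, ∀ v ∈ T c d, toLex u ≤ toLex v → v ∈ L

def Low {p : ℕ} (c : Fin p → ℕ) (d : ℕ) (L : Finset (Fin p → ℕ)) : Prop :=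
  L ⊆ T c d ∧ ∀ u ∈ L, ∀ v ∈ T c d, toLex v ≤ toLex u → v ∈ L

lemma lex_lt {p : ℕ} {u v : Fin p → ℕ} :
    toLex u < toLex v ↔ ∃ i, (∀ j < i, u j = v j) ∧ u i < v i := Iff.rfl

lemma lex_lt_of {p : ℕ} {u v : Fin p → ℕ} (i : Fin p) (h : ∀ j < i, u j ≤ v j) (h' : u i < v i) :
    toLex u < toLex v := by
  rw [lex_lt]
  by_cases hh : ∀ j < i, u j = v j
  · exact ⟨i, hh, h'⟩
  · push Not at hh
    have hne : (Finset.univ.filter (fun j => j < i ∧ u j ≠ v j)).Nonempty := by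
      obtain ⟨j, hj⟩ := hh
      exact ⟨j, by simpa using hj⟩
    set m := Finset.min' _ hne with hm
    have hmem := Finset.min'_mem _ hne
    rw [← hm] at hmem
    simp only [Finset.mem_filter, Finset.mem_univ, true_and] at hmem
    refine ⟨m, fun j hj => ?_, lt_of_le_of_ne (h m hmem.1) hmem.2⟩
    by_contra hc
    have : m ≤ j := Finset.min'_le _ _ (by simpa using ⟨hj.trans hmem.1, hc⟩)
    exact absurd hj (not_lt.2 this)

lemma lex_lt_of_lt {p : ℕ} {u v : Fin p → ℕ} (h : u < v) : toLex u < toLex v := by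
  obtain ⟨h1, i, hi⟩ := Pi.lt_def.1 h
  exact lex_lt_of i (fun j _ => h1 j) hi

lemma Seg.total {p : ℕ} {c : Fin p → ℕ} {d : ℕ} {L M : Finset (Fin p → ℕ)} (hL : Seg c d L)
    (hM : Seg c d M) : L ⊆ M ∨ M ⊆ L := by
  by_contra h
  push Not at h
  obtain ⟨h1, h2⟩ := h
  rw [Finset.not_subset] at h1 h2
  obtain ⟨u, hu, hu'⟩ := h1
  obtain ⟨v, hv, hv'⟩ := h2
  rcases le_total (toLex u) (toLex v) with h | h
  · exact hv' (hL.2 u hu v (hM.1 hv) h)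
  · exact hu' (hM.2 v hv u (hL.1 hu) h)

lemma Seg.subset {p : ℕ} {c : Fin p → ℕ} {d : ℕ} {L M : Finset (Fin p → ℕ)} (hL : Seg c d L)
    (hM : Seg c d M) (h : L.card ≤ M.card) : L ⊆ M := by
  rcases hL.total hM with h1 | h1
  · exact h1
  · rw [Finset.eq_of_subset_of_card_le h1 h]

lemma seg_sdiff {p : ℕ} {c : Fin p → ℕ} {d : ℕ} {L : Finset (Fin p → ℕ)} :
    Low c d L → Seg c d (T c d \ L) := by
  rintro ⟨h1, h2⟩
  refine ⟨Finset.sdiff_subset, fun u hu v hv huv => ?_⟩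
  rw [Finset.mem_sdiff] at hu ⊢
  exact ⟨hv, fun hvL => hu.2 (h2 v hvL u hu.1 huv)⟩

lemma low_sdiff {p : ℕ} {c : Fin p → ℕ} {d : ℕ} {L : Finset (Fin p → ℕ)} :
    Seg c d L → Low c d (T c d \ L) := by
  rintro ⟨h1, h2⟩
  refine ⟨Finset.sdiff_subset, fun u hu v hv huv => ?_⟩
  rw [Finset.mem_sdiff] at hu ⊢
  exact ⟨hv, fun hvL => hu.2 (h2 v hvL u hu.1 huv)⟩

lemma Low.subset {p : ℕ} {c : Fin p → ℕ} {d : ℕ} {L M : Finset (Fin p → ℕ)} (hL : Low c d L)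
    (hM : Low c d M) (h : L.card ≤ M.card) : L ⊆ M := by
  have := (seg_sdiff hM).subset (seg_sdiff hL) (by
    rw [Finset.card_sdiff_of_subset hM.1, Finset.card_sdiff_of_subset hL.1]; omega)
  intro u hu
  by_contra hc
  have h3 := this (Finset.mem_sdiff.2 ⟨hL.1 hu, hc⟩)
  exact (Finset.mem_sdiff.1 h3).2 hu

lemma exists_low {p : ℕ} (c : Fin p → ℕ) (d : ℕ) (a : ℕ) (ha : a ≤ (T c d).card) :
    ∃ L, Low c d L ∧ L.card = a := by
  induction a with
  | zero => exact ⟨∅, ⟨by simp, by simp⟩, rfl⟩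
  | succ a ih =>
    obtain ⟨L, hL, hc⟩ := ih (by omega)
    have hne : (T c d \ L).Nonempty := by
      rw [← Finset.card_pos, Finset.card_sdiff_of_subset hL.1]; omega
    obtain ⟨m, hm, hmin⟩ := Finset.exists_min_image (T c d \ L) (fun u => toLex u) hne
    rw [Finset.mem_sdiff] at hm
    refine ⟨insert m L, ⟨Finset.insert_subset hm.1 hL.1, ?_⟩, by
      rw [Finset.card_insert_of_notMem hm.2, hc]⟩
    intro u hu v hv hvu
    rw [Finset.mem_insert] at hu ⊢
    by_contra hcon
    push Not at hcon
    have h1 := hmin v (Finset.mem_sdiff.2 ⟨hv, hcon.2⟩)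
    rcases hu with rfl | hu
    · exact hcon.1 (toLex.injective (le_antisymm hvu h1))
    · exact hcon.2 (hL.2 u hu v hv hvu)

lemma exists_seg {p : ℕ} (c : Fin p → ℕ) (d : ℕ) (a : ℕ) (ha : a ≤ (T c d).card) :
    ∃ L, Seg c d L ∧ L.card = a := by
  obtain ⟨L, hL, h⟩ := exists_low c d ((T c d).card - a) (by omega)
  exact ⟨_, seg_sdiff hL, by rw [Finset.card_sdiff_of_subset hL.1]; omega⟩

lemma seg_up {p : ℕ} {c : Fin p → ℕ} {d : ℕ} {L : Finset (Fin p → ℕ)} (hL : Seg c d L) :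
    Seg c (d+1) (Up c d L) := by
  refine ⟨fun v hv => (mem_Up.1 hv).1, ?_⟩
  intro v hv w hw hvw
  rw [mem_Up] at hv ⊢
  refine ⟨hw, ?_⟩
  obtain ⟨hvT, u, huL, huv⟩ := hv
  rcases hvw.eq_or_lt with h | h
  · have := toLex.injective h
    subst this
    exact ⟨u, huL, huv⟩
  obtain ⟨i, hi1, hi2⟩ := lex_lt.1 h
  have hne : (Finset.univ.filter (fun j => 0 < w j)).Nonempty := ⟨i, by simp; omega⟩
  obtain ⟨l, hl, hlmax⟩ := Finset.exists_max_image _ (fun j => j) hne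
  simp only [Finset.mem_filter, Finset.mem_univ, true_and] at hl hlmax
  have hil : i ≤ l := hlmax i (by omega)
  rw [mem_T] at hw hvT
  have huT := mem_T.1 (hL.1 huL)
  set w' : Fin p → ℕ := Function.update w l (w l - 1) with hw'
  have hw'w : w' ≤ w := by
    intro j
    by_cases hj : j = l
    · subst hj; simp [hw']
    · simp [hw', hj]
  have hsum : ∑ j, w' j = d := by
    have h1 := Finset.add_sum_erase Finset.univ w (Finset.mem_univ l)
    have h2 := Finset.add_sum_erase Finset.univ w' (Finset.mem_univ l)
    have h3 : ∑ j ∈ Finset.univ.erase l, w' j = ∑ j ∈ Finset.univ.erase l, w j := by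
      refine Finset.sum_congr rfl fun j hj => ?_
      simp [hw', (Finset.mem_erase.1 hj).1]
    have h4 : w' l = w l - 1 := by simp [hw']
    omega
  have hw'T : w' ∈ T c d := mem_T.2 ⟨hw'w.trans hw.1, hsum⟩
  refine ⟨w', ?_, hw'w⟩
  refine hL.2 u huL w' hw'T ?_
  have hlt : ∀ j < i, u j ≤ w' j := by
    intro j hj
    have : j ≠ l := ne_of_lt (hj.trans_le hil)
    simp only [hw', Function.update_of_ne this]
    rw [← hi1 j hj]
    exact huv j
  have hui : u i ≤ w' i := by
    by_cases hj : i = l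
    · subst hj
      simp only [hw', Function.update_self]
      have : u i ≤ v i := huv i
      omega
    · simp only [hw', Function.update_of_ne hj]
      have : u i ≤ v i := huv i
      omega
  rcases hui.lt_or_eq with h5 | h5
  · exact (lex_lt_of i hlt h5).le
  · have h6 : i = l := by
      by_contra hj
      simp only [hw', Function.update_of_ne hj] at h5
      have : u i ≤ v i := huv i
      omega
    -- all of u ≥ w'
    by_cases hex : ∃ j < i, u j < w' j
    · obtain ⟨j, hj, hj'⟩ := hex
      exact (lex_lt_of j (fun k hk => hlt k (hk.trans hj)) hj').le
    push Not at hex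
    have hge : w' ≤ u := by
      intro j
      rcases lt_trichotomy j i with hj | hj | hj
      · exact hex j hj
      · rw [hj, h5]
      · have : w j = 0 := by
          by_contra hc
          have := hlmax j (by omega)
          rw [← h6] at this
          exact absurd hj (not_lt.2 this)
        have : w' j ≤ w j := hw'w j
        show w' j ≤ u j; omega
    rcases hge.eq_or_lt with h7 | h7
    · rw [h7]
    · exfalso
      have := Finset.sum_lt_sum (s := Finset.univ) (fun j _ => hge j)
        (by obtain ⟨_, j, hj⟩ := Pi.lt_def.1 h7; exact ⟨j, Finset.mem_univ _, hj⟩)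
      omega

lemma up_mono {p : ℕ} {c : Fin p → ℕ} {d : ℕ} {A B : Finset (Fin p → ℕ)} (h : A ⊆ B) :
    Up c d A ⊆ Up c d B := by
  intro v hv
  rw [mem_Up] at *
  obtain ⟨h1, u, hu, h2⟩ := hv
  exact ⟨h1, u, h hu, h2⟩

/-- unit vector -/
def ee {p : ℕ} (l : Fin p) : Fin p → ℕ := Pi.single l 1

lemma ee_self {p : ℕ} (l : Fin p) : ee l l = 1 := by simp [ee]
lemma ee_ne {p : ℕ} {l j : Fin p} (h : j ≠ l) : ee l j = 0 := by simp [ee, h]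
lemma sum_ee {p : ℕ} (l : Fin p) : ∑ j, ee l j = 1 := by simp [ee]

lemma exists_ee {p : ℕ} {d : ℕ} {u v : Fin p → ℕ} (h : u ≤ v) (hu : ∑ i, u i = d)
    (hv : ∑ i, v i = d + 1) : ∃ l, v = u + ee l := by
  have hlt : u < v := lt_of_le_of_ne h (by rintro rfl; omega)
  obtain ⟨_, l, hl⟩ := Pi.lt_def.1 hlt
  refine ⟨l, ?_⟩
  have h1 : u + ee l ≤ v := by
    intro j
    by_cases hj : j = l
    · subst hj; simp [ee_self]; omega
    · simp [ee_ne hj, h j]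
  have h2 : ∑ j, (u + ee l) j = d + 1 := by
    simp [Finset.sum_add_distrib, sum_ee, hu]
  by_contra hc
  have h7 : u + ee l < v := lt_of_le_of_ne h1 (Ne.symm hc)
  have := Finset.sum_lt_sum (s := Finset.univ) (fun j _ => h1 j)
        (by obtain ⟨_, j, hj⟩ := Pi.lt_def.1 h7; exact ⟨j, Finset.mem_univ _, hj⟩)
  omega

end CLi

namespace CLi
open Finset

section comp
variable {p : ℕ}

def base (i q : Fin p) (u : Fin p → ℕ) : Fin p → ℕ := Function.update (Function.update u i 0) q 0

lemma base_self_q {i q : Fin p} {u : Fin p → ℕ} : base i q u q = 0 := by simp [base]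
lemma base_self_i {i q : Fin p} (h : i ≠ q) {u : Fin p → ℕ} : base i q u i = 0 := by simp [base, h]
lemma base_ne {i q l : Fin p} (h : l ≠ i) (h' : l ≠ q) {u : Fin p → ℕ} : base i q u l = u l := by
  simp [base, h, h']

lemma base_eq_iff {i q : Fin p} {u v : Fin p → ℕ} :
    base i q u = base i q v ↔ ∀ l, l ≠ i → l ≠ q → u l = v l := by
  constructor
  · intro h l h1 h2
    have := congrFun h l
    rwa [base_ne h1 h2, base_ne h1 h2] at this
  · intro h
    funext l
    by_cases h2 : l = q
    · subst h2; rw [base_self_q, base_self_q]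
    · by_cases h1 : l = i
      · subst h1; rw [base_self_i h2, base_self_i h2]
      · rw [base_ne h1 h2, base_ne h1 h2, h l h1 h2]

lemma sum_base {i q : Fin p} (h : i ≠ q) (u : Fin p → ℕ) :
    ∑ j, u j = ∑ j, base i q u j + (u i + u q) := by
  have h1 : ∑ j, u j = ∑ j, (base i q u j + (ee i j * u i + ee q j * u q)) := by
    refine Finset.sum_congr rfl fun j _ => ?_
    by_cases h2 : j = q
    · subst h2; rw [base_self_q, ee_ne h.symm, ee_self]; simp
    · by_cases h1 : j = i
      · subst h1; rw [base_self_i h2, ee_self, ee_ne h2]; simp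
      · rw [base_ne h1 h2, ee_ne h1, ee_ne h2]; simp
  rw [h1, sum_add_distrib, sum_add_distrib, ← Finset.sum_mul, ← Finset.sum_mul, sum_ee, sum_ee,
    one_mul, one_mul]

open Classical in
noncomputable def fib (i q : Fin p) (A : Finset (Fin p → ℕ)) (b : Fin p → ℕ) :
    Finset (Fin p → ℕ) := A.filter (fun u => base i q u = b)

open Classical in
noncomputable def comp (c : Fin p → ℕ) (d : ℕ) (i q : Fin p) (A : Finset (Fin p → ℕ)) :
    Finset (Fin p → ℕ) :=
  (T c d).filter (fun u => min (c i) (u i + u q) < u i + (fib i q A (base i q u)).card)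

lemma mem_fib {i q : Fin p} {A : Finset (Fin p → ℕ)} {b u : Fin p → ℕ} :
    u ∈ fib i q A b ↔ u ∈ A ∧ base i q u = b := by simp [fib]

lemma mem_comp {c : Fin p → ℕ} {d : ℕ} {i q : Fin p} {A : Finset (Fin p → ℕ)} {u : Fin p → ℕ} :
    u ∈ comp c d i q A ↔ u ∈ T c d ∧
      min (c i) (u i + u q) < u i + (fib i q A (base i q u)).card := by
  simp [comp]

lemma fib_eq {c : Fin p → ℕ} {d : ℕ} {i q : Fin p} (h : i ≠ q) {u v : Fin p → ℕ}
    (hu : u ∈ T c d) (hv : v ∈ T c d) (hb : base i q u = base i q v) :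
    u i + u q = v i + v q := by
  have h1 := sum_base h u
  have h2 := sum_base h v
  have h3 := (mem_T.1 hu).2
  have h4 := (mem_T.1 hv).2
  rw [hb] at h1
  omega

lemma fib_ext {c : Fin p → ℕ} {d : ℕ} {i q : Fin p} (h : i ≠ q) {u v : Fin p → ℕ}
    (hu : u ∈ T c d) (hv : v ∈ T c d) (hb : base i q u = base i q v) (hi : u i = v i) : u = v := by
  have h1 := fib_eq h hu hv hb
  funext l
  by_cases h2 : l = q
  · subst h2; omega
  · by_cases h1 : l = i
    · subst h1; exact hi
    · exact base_eq_iff.1 hb l h1 h2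

lemma card_filter_top (F : Finset (Fin p → ℕ)) (f : (Fin p → ℕ) → ℕ) (hf : Set.InjOn f F)
    (lo hi n : ℕ) (himg : F.image f = Finset.Icc lo hi) (hn : n ≤ F.card) :
    (F.filter (fun u => hi < f u + n)).card = n := by
  have h1 : (F.filter (fun u => hi < f u + n)).card
      = ((F.filter (fun u => hi < f u + n)).image f).card := by
    rw [Finset.card_image_of_injOn]
    exact hf.mono (by intro x hx; exact (Finset.mem_filter.1 hx).1)
  have h2 : (F.filter (fun u => hi < f u + n)).image f
      = (Finset.Icc lo hi).filter (fun k => hi < k + n) := by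
    rw [← himg, Finset.filter_image]
  have h3 : F.card = hi + 1 - lo := by
    rw [← Nat.card_Icc, ← himg, Finset.card_image_of_injOn hf]
  have h4 : (Finset.Icc lo hi).filter (fun k => hi < k + n) = Finset.Ico (hi + 1 - n) (hi + 1) := by
    ext k; simp only [mem_filter, mem_Icc, mem_Ico]; omega
  rw [h1, h2, h4, Nat.card_Ico]
  omega

lemma fib_comp_card {c : Fin p → ℕ} {d : ℕ} {i q : Fin p} (h : i ≠ q)
    {A : Finset (Fin p → ℕ)} (hA : A ⊆ T c d) (b : Fin p → ℕ) :
    (fib i q (comp c d i q A) b).card = (fib i q A b).card := by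
  classical
  by_cases hne : (fib i q (T c d) b).Nonempty
  · obtain ⟨u0, hu0⟩ := hne
    rw [mem_fib] at hu0
    obtain ⟨hu0, hb0⟩ := hu0
    set F := fib i q (T c d) b with hF
    have hFm : ∀ u, u ∈ F ↔ u ∈ T c d ∧ base i q u = b := fun u => mem_fib
    set s := u0 i + u0 q with hs
    have hFs : ∀ u ∈ F, u i + u q = s := fun u hu =>
      fib_eq h ((hFm u).1 hu).1 hu0 (((hFm u).1 hu).2.trans hb0.symm)
    have hinj : Set.InjOn (fun u : Fin p → ℕ => u i) F := by
      intro u hu v hv huv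
      have hu := (hFm u).1 hu
      have hv := (hFm v).1 hv
      exact fib_ext h hu.1 hv.1 (hu.2.trans hv.2.symm) huv
    have himg : F.image (fun u : Fin p → ℕ => u i) = Finset.Icc (s - c q) (min (c i) s) := by
      ext k
      simp only [mem_image, mem_Icc, le_min_iff]
      constructor
      · rintro ⟨u, hu, rfl⟩
        have h1 := hFs u hu
        have h2 := (mem_T.1 ((hFm u).1 hu).1).1
        have h3 : u i ≤ c i := h2 i
        have h4 : u q ≤ c q := h2 q
        omega
      · rintro ⟨h1, h2, h3⟩
        set w : Fin p → ℕ := Function.update (Function.update u0 i k) q (s - k) with hw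
        have hwi : w i = k := by simp [hw, h]
        have hwq : w q = s - k := by simp [hw]
        have hwn : ∀ l, l ≠ i → l ≠ q → w l = u0 l := by
          intro l h1 h2; simp [hw, h1, h2]
        have hbw : base i q w = base i q u0 := base_eq_iff.2 hwn
        refine ⟨w, (hFm w).2 ⟨mem_T.2 ⟨?_, ?_⟩, hbw.trans hb0⟩, hwi⟩
        · intro l
          by_cases h5 : l = q
          · show w l ≤ c l
            rw [h5, hwq]; omega
          · by_cases h6 : l = i
            · show w l ≤ c l
              rw [h6, hwi]; omega
            · rw [hwn l h6 h5]; exact (mem_T.1 hu0).1 l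
        · rw [sum_base h, hbw, hwi, hwq]
          have := sum_base h u0
          rw [(mem_T.1 hu0).2] at this
          omega
    have h1 := card_filter_top F (fun u => u i) hinj _ _ (fib i q A b).card himg
      (Finset.card_le_card (by
        intro u hu; rw [mem_fib] at hu; exact (hFm u).2 ⟨hA hu.1, hu.2⟩))
    rw [← h1]
    congr 1
    ext u
    rw [mem_fib, mem_comp, mem_filter, hFm]
    constructor
    · rintro ⟨⟨h1, h2⟩, h3⟩
      refine ⟨⟨h1, h3⟩, ?_⟩
      rw [h3, hFs u ((hFm u).2 ⟨h1, h3⟩)] at h2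
      exact h2
    · rintro ⟨⟨h1, h3⟩, h2⟩
      refine ⟨⟨h1, ?_⟩, h3⟩
      rw [h3, hFs u ((hFm u).2 ⟨h1, h3⟩)]
      exact h2
  · have e1 : fib i q (comp c d i q A) b = ∅ := by
      by_contra hc
      obtain ⟨u, hu⟩ := Finset.nonempty_iff_ne_empty.2 hc
      rw [mem_fib, mem_comp] at hu
      exact hne ⟨u, mem_fib.2 ⟨hu.1.1, hu.2⟩⟩
    have e2 : fib i q A b = ∅ := by
      by_contra hc
      obtain ⟨u, hu⟩ := Finset.nonempty_iff_ne_empty.2 hc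
      rw [mem_fib] at hu
      exact hne ⟨u, mem_fib.2 ⟨hA hu.1, hu.2⟩⟩
    rw [e1, e2]

lemma sum_base_comp {c : Fin p → ℕ} {d : ℕ} {i q : Fin p} (h : i ≠ q)
    {A : Finset (Fin p → ℕ)} (hA : A ⊆ T c d) (f : (Fin p → ℕ) → ℤ) :
    ∑ u ∈ comp c d i q A, f (base i q u) = ∑ u ∈ A, f (base i q u) := by
  classical
  set t := (A ∪ comp c d i q A).image (base i q) with ht
  rw [← Finset.sum_fiberwise_of_maps_to (s := A) (t := t) (g := base i q),
    ← Finset.sum_fiberwise_of_maps_to (s := comp c d i q A) (t := t) (g := base i q)]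
  · refine Finset.sum_congr rfl fun b _ => ?_
    have key : ∀ B : Finset (Fin p → ℕ), ∑ u ∈ B.filter (fun u => base i q u = b), f (base i q u)
        = (fib i q B b).card * f b := by
      intro B
      rw [Finset.sum_congr rfl (g := fun _ => f b)]
      · rw [Finset.sum_const, nsmul_eq_mul]; congr
      · intro u hu; rw [(Finset.mem_filter.1 hu).2]
    rw [key, key, fib_comp_card h hA]
  · intro u hu; exact Finset.mem_image_of_mem _ (Finset.mem_union_right _ hu)
  · intro u hu; exact Finset.mem_image_of_mem _ (Finset.mem_union_left _ hu)

lemma comp_card {c : Fin p → ℕ} {d : ℕ} {i q : Fin p} (h : i ≠ q)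
    {A : Finset (Fin p → ℕ)} (hA : A ⊆ T c d) : (comp c d i q A).card = A.card := by
  have := sum_base_comp h hA (fun _ => 1)
  simpa using this

lemma comp_subset {c : Fin p → ℕ} {d : ℕ} {i q : Fin p} {A : Finset (Fin p → ℕ)} :
    comp c d i q A ⊆ T c d := fun _ hu => (mem_comp.1 hu).1

lemma comp_weight {c : Fin p → ℕ} {d : ℕ} {i q : Fin p} (h : i ≠ q)
    {A : Finset (Fin p → ℕ)} (hA : A ⊆ T c d) (hne : comp c d i q A ≠ A) :
    ∑ u ∈ comp c d i q A, u q < ∑ u ∈ A, u q := by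
  classical
  set B := comp c d i q A with hB
  let s : (Fin p → ℕ) → ℤ := fun b => (d : ℤ) - ∑ j, (b j : ℤ)
  let τ : (Fin p → ℕ) → ℤ := fun b => s b - min (c i : ℤ) (s b) + (fib i q A b).card
  have hs : ∀ u ∈ T c d, s (base i q u) = u i + u q := by
    intro u hu
    have h1 := sum_base h u
    rw [(mem_T.1 hu).2] at h1
    have : (d : ℤ) = ∑ j, (base i q u j : ℤ) + (u i + u q) := by exact_mod_cast h1
    simp only [s]; omega
  have hmem : ∀ u ∈ T c d, u ∈ B ↔ (u q : ℤ) < τ (base i q u) := by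
    intro u hu
    rw [hB, mem_comp]
    simp only [τ]
    rw [hs u hu]
    constructor
    · rintro ⟨_, h2⟩
      have : (min (c i : ℤ) ((u i : ℤ) + u q)) < u i + (fib i q A (base i q u)).card := by
        exact_mod_cast h2
      omega
    · intro h2
      refine ⟨hu, ?_⟩
      have : (min (c i : ℤ) ((u i : ℤ) + u q)) < u i + (fib i q A (base i q u)).card := by omega
      exact_mod_cast this
  have hcard : B.card = A.card := comp_card h hA
  have hBA : (B \ A).Nonempty := by
    rw [Finset.sdiff_nonempty]
    intro hsub
    exact hne (Finset.eq_of_subset_of_card_le hsub hcard.ge)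
  have h1 := sum_base_comp h hA τ
  have e1 := Finset.sum_sdiff_sub_sum_sdiff (s₁ := B) (s₂ := A) (f := fun u => (u q : ℤ) - τ (base i q u))
  have h2 : ∑ u ∈ B \ A, ((u q : ℤ) - τ (base i q u)) < 0 := by
    refine Finset.sum_neg (fun u hu => ?_) hBA
    rw [mem_sdiff] at hu
    have := (hmem u (comp_subset hu.1)).1 hu.1
    omega
  have h3 : 0 ≤ ∑ u ∈ A \ B, ((u q : ℤ) - τ (base i q u)) := by
    refine Finset.sum_nonneg (fun u hu => ?_)
    rw [mem_sdiff] at hu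
    have := (hmem u (hA hu.1)).not.1 hu.2
    omega
  rw [← hB] at h1
  rw [Finset.sum_sub_distrib (s := A), Finset.sum_sub_distrib (s := B), h1] at e1
  have h4 : (∑ u ∈ B, (u q : ℤ)) < ∑ u ∈ A, (u q : ℤ) := by linarith
  exact_mod_cast h4

lemma T_add {c : Fin p → ℕ} {d : ℕ} {u : Fin p → ℕ} {l : Fin p} (hu : u ∈ T c d)
    (h : u l + 1 ≤ c l) : u + ee l ∈ T c (d+1) := by
  rw [mem_T] at hu ⊢
  refine ⟨?_, by simp [Finset.sum_add_distrib, sum_ee, hu.2]⟩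
  intro j
  by_cases hj : j = l
  · subst hj; simpa [ee_self] using h
  · simpa [ee_ne hj] using hu.1 j

lemma up_add {c : Fin p → ℕ} {d : ℕ} {A : Finset (Fin p → ℕ)} {u : Fin p → ℕ} {l : Fin p}
    (hA : A ⊆ T c d) (hu : u ∈ A) (h : u l + 1 ≤ c l) : u + ee l ∈ Up c d A :=
  mem_Up.2 ⟨T_add (hA hu) h, u, hu, by intro j; simp⟩

lemma add_ee_inj (l : Fin p) : Function.Injective (fun u : Fin p → ℕ => u + ee l) :=
  fun _ _ h => add_right_cancel h

lemma fib_up_le {c : Fin p → ℕ} {d : ℕ} {i q : Fin p} {A : Finset (Fin p → ℕ)}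
    (hA : A ⊆ T c d) (b b' : Fin p → ℕ) (l : Fin p)
    (hl : ∀ w ∈ fib i q A b, w l + 1 ≤ c l ∧ base i q (w + ee l) = b') :
    (fib i q A b).card ≤ (fib i q (Up c d A) b').card := by
  classical
  rw [← Finset.card_image_of_injective _ (add_ee_inj l)]
  refine Finset.card_le_card ?_
  intro v hv
  rw [mem_image] at hv
  obtain ⟨w, hw, rfl⟩ := hv
  exact mem_fib.2 ⟨up_add hA (mem_fib.1 hw).1 (hl w hw).1, (hl w hw).2⟩

lemma base_add_i {i q : Fin p} (u : Fin p → ℕ) : base i q (u + ee i) = base i q u :=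
  base_eq_iff.2 fun l h1 h2 => by simp [ee_ne h1]
lemma base_add_q {i q : Fin p} (u : Fin p → ℕ) : base i q (u + ee q) = base i q u :=
  base_eq_iff.2 fun l h1 h2 => by simp [ee_ne h2]

lemma fib_up_lt {c : Fin p → ℕ} {d : ℕ} {i q : Fin p} (h : i ≠ q) {A : Finset (Fin p → ℕ)}
    (hA : A ⊆ T c d) (b : Fin p → ℕ) (hne : (fib i q A b).Nonempty)
    (hl : ∀ w ∈ fib i q A b, w q + 1 ≤ c q ∧ w i + 1 ≤ c i) :
    (fib i q A b).card + 1 ≤ (fib i q (Up c d A) b).card := by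
  classical
  obtain ⟨m, hm, hmax⟩ := Finset.exists_max_image (fib i q A b) (fun w => w i) hne
  have hnot : m + ee i ∉ (fib i q A b).image (fun u => u + ee q) := by
    rw [mem_image]
    rintro ⟨w, hw, hwe⟩
    have h1 := congrFun hwe i
    simp only [Pi.add_apply, ee_self, ee_ne h] at h1
    have := hmax w hw
    omega
  rw [← Finset.card_image_of_injective _ (add_ee_inj q), ← Finset.card_insert_of_notMem hnot]
  refine Finset.card_le_card ?_
  intro v hv
  rw [mem_insert, mem_image] at hv
  rcases hv with rfl | ⟨w, hw, rfl⟩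
  · exact mem_fib.2 ⟨up_add hA (mem_fib.1 hm).1 (hl m hm).2, by
      rw [base_add_i]; exact (mem_fib.1 hm).2⟩
  · exact mem_fib.2 ⟨up_add hA (mem_fib.1 hw).1 (hl w hw).1, by
      rw [base_add_q]; exact (mem_fib.1 hw).2⟩

lemma comp_up {c : Fin p → ℕ} {d : ℕ} {i q : Fin p} (h : i ≠ q) (hiq : c i ≤ c q)
    (hc : ∀ j, c j = 1 ∨ d + 1 ≤ c j) {A : Finset (Fin p → ℕ)} (hA : A ⊆ T c d) :
    Up c d (comp c d i q A) ⊆ comp c (d+1) i q (Up c d A) := by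
  intro v hv
  rw [mem_Up] at hv
  obtain ⟨hvT, u, hu, huv⟩ := hv
  rw [mem_comp] at hu ⊢
  obtain ⟨huT, hu⟩ := hu
  refine ⟨hvT, ?_⟩
  obtain ⟨l, rfl⟩ := exists_ee huv (mem_T.1 huT).2 (mem_T.1 hvT).2
  have huc := (mem_T.1 huT).1
  have hui : u i ≤ c i := huc i
  have huq : u q ≤ c q := huc q
  have hvl : u l + 1 ≤ c l := by simpa [ee_self] using (mem_T.1 hvT).1 l
  have hws : ∀ w ∈ fib i q A (base i q u), w i + w q = u i + u q := fun w hw =>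
    fib_eq h (hA (mem_fib.1 hw).1) huT (mem_fib.1 hw).2
  by_cases hli : l ≠ i ∧ l ≠ q
  · obtain ⟨h1, h2⟩ := hli
    have hN := fib_up_le hA (base i q u) (base i q (u + ee l)) l (fun w hw => by
      have hwb := base_eq_iff.1 (mem_fib.1 hw).2
      refine ⟨by rw [hwb l h1 h2]; exact hvl, base_eq_iff.2 fun j h3 h4 => ?_⟩
      simp [hwb j h3 h4])
    simp only [Pi.add_apply, ee_ne h1.symm, ee_ne h2.symm, add_zero]
    omega
  · have hb : base i q (u + ee l) = base i q u := by
      by_cases h1 : l = i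
      · subst h1; exact base_add_i u
      · have : l = q := by tauto
        subst this; exact base_add_q u
    have hval : ((u + ee l) i = u i + 1 ∧ (u + ee l) q = u q) ∨
        ((u + ee l) i = u i ∧ (u + ee l) q = u q + 1) := by
      by_cases h1 : l = i
      · subst h1; left; simp [ee_self, ee_ne h.symm]
      · have : l = q := by tauto
        subst this; right; simp [ee_self, ee_ne h]
    have hlt : u i + u q + 1 ≤ c i + c q := by
      by_cases h1 : l = i
      · subst h1; omega
      · have : l = q := by tauto
        subst this; omega
    rw [hb]
    have hpos : 0 < (fib i q A (base i q u)).card := by omega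
    have hne := Finset.card_pos.1 hpos
    by_cases hs : u i + u q < c i
    · have hN := fib_up_lt h hA (base i q u) hne (fun w hw => by
        have := hws w hw; omega)
      rcases hval with ⟨e1, e2⟩ | ⟨e1, e2⟩ <;> rw [e1, e2] <;> omega
    · rcases hc q with hq | hq
      · have hi1 : c i = 1 := by
          rcases hc i with h1 | h1 <;> omega
        have hv1 : (u + ee l) i + (u + ee l) q = 2 := by
          rcases hval with ⟨e1, e2⟩ | ⟨e1, e2⟩ <;> rw [e1, e2] <;> omega
        have hvi : (u + ee l) i ≤ c i := (mem_T.1 hvT).1 i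
        have hvq : (u + ee l) q ≤ c q := (mem_T.1 hvT).1 q
        have hN : 0 < (fib i q (Up c d A) (base i q u)).card := by
          rw [Finset.card_pos]
          refine ⟨u + ee l, mem_fib.2 ⟨mem_Up.2 ⟨hvT, ?_⟩, hb⟩⟩
          obtain ⟨w, hw⟩ := hne
          refine ⟨w, (mem_fib.1 hw).1, fun j => ?_⟩
          have hwT := (mem_T.1 (hA (mem_fib.1 hw).1)).1
          by_cases h5 : j = q
          · subst h5
            have : w j ≤ c j := hwT j
            show w j ≤ (u + ee l) j
            omega
          · by_cases h6 : j = i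
            · subst h6
              have : w j ≤ c j := hwT j
              show w j ≤ (u + ee l) j
              omega
            · rw [base_eq_iff.1 (mem_fib.1 hw).2 j h6 h5]; simp
        omega
      · have hN := fib_up_le hA (i := i) (q := q) (base i q u) (base i q u) q (fun w hw => by
          refine ⟨?_, by rw [base_add_q]; exact (mem_fib.1 hw).2⟩
          have h1 := (mem_T.1 (hA (mem_fib.1 hw).1)).2
          have h2 := Finset.single_le_sum (f := w) (fun j _ => Nat.zero_le _) (Finset.mem_univ q)
          omega)
        rcases hval with ⟨e1, e2⟩ | ⟨e1, e2⟩ <;> rw [e1, e2] <;> omega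

lemma comp_up_card {c : Fin p → ℕ} {d : ℕ} {i q : Fin p} (h : i ≠ q) (hiq : c i ≤ c q)
    (hc : ∀ j, c j = 1 ∨ d + 1 ≤ c j) {A : Finset (Fin p → ℕ)} (hA : A ⊆ T c d) :
    (Up c d (comp c d i q A)).card ≤ (Up c d A).card := by
  rw [← comp_card (c := c) (d := d+1) h (A := Up c d A) (fun v hv => (mem_Up.1 hv).1)]
  exact Finset.card_le_card (comp_up h hiq hc hA)

/-- stability wrt the index q -/
def Stab (c : Fin p → ℕ) (q : Fin p) (A : Finset (Fin p → ℕ)) : Prop :=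
  ∀ u ∈ A, ∀ v : Fin p → ℕ, ∀ i, i ≠ q → v ≤ c → v + ee q = u + ee i → v ∈ A

lemma comp_stab {c : Fin p → ℕ} {d : ℕ} {q : Fin p} {A : Finset (Fin p → ℕ)}
    (h : ∀ i, i ≠ q → comp c d i q A = A) : Stab c q A := by
  intro u hu v i hi hv hvu
  rw [← h i hi, mem_comp]
  have hu' := hu
  rw [← h i hi, mem_comp] at hu'
  have hvT : v ∈ T c d := by
    refine mem_T.2 ⟨hv, ?_⟩
    have h1 := congrArg (fun w => ∑ j, w j) hvu
    simp only [Pi.add_apply, Finset.sum_add_distrib, sum_ee, (mem_T.1 hu'.1).2] at h1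
    omega
  have hb : base i q v = base i q u := by
    rw [← base_add_q v, hvu, base_add_i]
  have e1 := congrFun hvu i
  have e2 := congrFun hvu q
  simp only [Pi.add_apply, ee_self, ee_ne hi, ee_ne hi.symm] at e1 e2
  refine ⟨hvT, ?_⟩
  rw [hb]
  have := hu'.2
  omega

lemma exists_stab {c : Fin p → ℕ} {d : ℕ} {q : Fin p} (hiq : ∀ i, c i ≤ c q)
    (hc : ∀ j, c j = 1 ∨ d + 1 ≤ c j) {A : Finset (Fin p → ℕ)} (hA : A ⊆ T c d) :
    ∃ B ⊆ T c d, B.card = A.card ∧ (Up c d B).card ≤ (Up c d A).card ∧ Stab c q B := by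
  induction hw : ∑ u ∈ A, u q using Nat.strong_induction_on generalizing A with
  | _ w ih =>
    by_cases h : ∀ i, i ≠ q → comp c d i q A = A
    · exact ⟨A, hA, rfl, le_rfl, comp_stab h⟩
    · push Not at h
      obtain ⟨i, hi, hne⟩ := h
      obtain ⟨B, h1, h2, h3, h4⟩ := ih _ (by rw [← hw]; exact comp_weight hi hA hne)
        (A := comp c d i q A) comp_subset rfl
      exact ⟨B, h1, h2.trans (comp_card hi hA), h3.trans (comp_up_card hi (hiq i) hc hA), h4⟩

end comp
end CLi

namespace CLi
open Finset

section cl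
variable {p : ℕ}

def sn (w : Fin p → ℕ) (k : ℕ) : Fin (p+1) → ℕ := Fin.snoc (α := fun _ => ℕ) w k
def ini (u : Fin (p+1) → ℕ) : Fin p → ℕ := fun i => u i.castSucc

@[simp] lemma sn_last (w : Fin p → ℕ) (k : ℕ) : sn w k (Fin.last p) = k := by simp [sn]
@[simp] lemma sn_cast (w : Fin p → ℕ) (k : ℕ) (i : Fin p) : sn w k i.castSucc = w i := by simp [sn]
@[simp] lemma ini_sn (w : Fin p → ℕ) (k : ℕ) : ini (sn w k) = w := by funext i; simp [ini]
lemma sn_ini (u : Fin (p+1) → ℕ) : sn (ini u) (u (Fin.last p)) = u := by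
  funext i
  refine Fin.lastCases ?_ (fun j => ?_) i <;> simp [ini]
lemma sn_ini' (u : Fin (p+1) → ℕ) {k : ℕ} (h : u (Fin.last p) = k) : sn (ini u) k = u := by
  rw [← h, sn_ini]
lemma sn_inj {w w' : Fin p → ℕ} {k : ℕ} (h : sn w k = sn w' k) : w = w' := by
  rw [← ini_sn w k, h, ini_sn]

lemma sn_le {w : Fin p → ℕ} {k : ℕ} {c : Fin (p+1) → ℕ} :
    sn w k ≤ c ↔ w ≤ ini c ∧ k ≤ c (Fin.last p) := by
  constructor
  · intro h
    refine ⟨fun i => ?_, ?_⟩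
    · have := h i.castSucc; simpa [ini] using this
    · have := h (Fin.last p); simpa using this
  · rintro ⟨h1, h2⟩ i
    refine Fin.lastCases ?_ (fun j => ?_) i
    · simpa using h2
    · have h3 : w j ≤ c j.castSucc := h1 j
      simpa using h3

lemma sn_sum (w : Fin p → ℕ) (k : ℕ) : ∑ i, sn w k i = ∑ i, w i + k := by
  rw [Fin.sum_univ_castSucc]; simp

lemma sn_mem_T {w : Fin p → ℕ} {k d : ℕ} {c : Fin (p+1) → ℕ} :
    sn w k ∈ T c d ↔ w ∈ T (ini c) (d - k) ∧ k ≤ c (Fin.last p) ∧ k ≤ d := by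
  rw [mem_T, mem_T, sn_le, sn_sum]
  constructor
  · rintro ⟨⟨h1, h2⟩, h3⟩; exact ⟨⟨h1, by omega⟩, h2, by omega⟩
  · rintro ⟨⟨h1, h2⟩, h3, h4⟩; exact ⟨⟨h1, h3⟩, by omega⟩

lemma sn_lex {w w' : Fin p → ℕ} {k : ℕ} : toLex w ≤ toLex w' → toLex (sn w k) ≤ toLex (sn w' k) := by
  intro h
  rcases h.eq_or_lt with h | h
  · rw [toLex.injective h]
  · obtain ⟨i, h1, h2⟩ := lex_lt.1 h
    refine (lex_lt_of i.castSucc (fun j => ?_) (by simpa using h2)).le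
    refine Fin.lastCases ?_ (fun j => ?_) j
    · intro hj; exact absurd (Fin.le_last i.castSucc) (not_le.2 hj)
    · intro hj
      simp only [sn_cast]
      exact (h1 j (by simpa using hj)).le

lemma sn_lex' {w w' : Fin p → ℕ} {k : ℕ} : toLex (sn w k) ≤ toLex (sn w' k) → toLex w ≤ toLex w' := by
  intro h
  by_contra hc
  have h1 := sn_lex (k := k) (not_le.1 hc).le
  have h2 := toLex.injective (le_antisymm h h1)
  exact hc (by rw [sn_inj h2])

def lay (A : Finset (Fin (p+1) → ℕ)) (k : ℕ) : Finset (Fin p → ℕ) :=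
  (A.filter (fun u => u (Fin.last p) = k)).image ini

lemma mem_lay {A : Finset (Fin (p+1) → ℕ)} {k : ℕ} {w : Fin p → ℕ} :
    w ∈ lay A k ↔ sn w k ∈ A := by
  simp only [lay, mem_image, mem_filter]
  constructor
  · rintro ⟨u, ⟨h1, h2⟩, rfl⟩; rwa [sn_ini' u h2]
  · intro h; exact ⟨_, ⟨h, by simp⟩, by simp⟩

lemma card_lay (A : Finset (Fin (p+1) → ℕ)) (k : ℕ) :
    (lay A k).card = (A.filter (fun u => u (Fin.last p) = k)).card := by
  refine Finset.card_image_of_injOn ?_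
  intro u hu v hv huv
  simp only [coe_filter, Set.mem_ofPred_eq] at hu hv
  rw [← sn_ini' u hu.2, ← sn_ini' v hv.2, huv]

lemma card_eq_lay {c : Fin (p+1) → ℕ} {d : ℕ} {A : Finset (Fin (p+1) → ℕ)} (hA : A ⊆ T c d) :
    A.card = ∑ k ∈ range (d+1), (lay A k).card := by
  rw [Finset.card_eq_sum_card_fiberwise (f := fun u => u (Fin.last p)) (t := range (d+1))]
  · refine Finset.sum_congr rfl fun k _ => ?_
    rw [card_lay]
  · intro u hu
    have h1 := (mem_T.1 (hA hu)).2
    have h2 := Finset.single_le_sum (f := u) (fun j _ => Nat.zero_le _) (Finset.mem_univ (Fin.last p))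
    simp; omega

lemma lay_subset {c : Fin (p+1) → ℕ} {d : ℕ} {A : Finset (Fin (p+1) → ℕ)} (hA : A ⊆ T c d) (k : ℕ) :
    lay A k ⊆ T (ini c) (d - k) := by
  intro w hw
  exact (sn_mem_T.1 (hA (mem_lay.1 hw))).1

lemma lay_seg {c : Fin (p+1) → ℕ} {d : ℕ} {A : Finset (Fin (p+1) → ℕ)} (hA : Seg c d A) (k : ℕ) :
    Seg (ini c) (d - k) (lay A k) := by
  refine ⟨lay_subset hA.1 k, fun u hu v hv huv => ?_⟩
  rw [mem_lay] at hu ⊢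
  have h1 := sn_mem_T.1 (hA.1 hu)
  exact hA.2 _ hu _ (sn_mem_T.2 ⟨hv, h1.2⟩) (sn_lex huv)

lemma seg_stab {c : Fin p → ℕ} {d : ℕ} {q : Fin p} (hq : ∀ i, i ≤ q) {A : Finset (Fin p → ℕ)}
    (hA : Seg c d A) : Stab c q A := by
  intro u hu v i hi hv hvu
  have huT := mem_T.1 (hA.1 hu)
  have hvT : v ∈ T c d := by
    refine mem_T.2 ⟨hv, ?_⟩
    have h1 := congrArg (fun w => ∑ j, w j) hvu
    simp only [Pi.add_apply, Finset.sum_add_distrib, sum_ee, huT.2] at h1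
    omega
  refine hA.2 u hu v hvT (lex_lt_of i (fun j hj => ?_) ?_).le
  · have e1 := congrFun hvu j
    have : j ≠ q := ne_of_lt (hj.trans_le (hq i))
    simp only [Pi.add_apply, ee_ne this] at e1
    omega
  · have e1 := congrFun hvu i
    simp only [Pi.add_apply, ee_ne hi, ee_self] at e1
    omega

lemma ee_last_cast (i : Fin p) : (ee (Fin.last p) : Fin (p+1) → ℕ) i.castSucc = 0 :=
  ee_ne (Fin.castSucc_lt_last i).ne

lemma sn_add_cast (w : Fin p → ℕ) (k : ℕ) (i : Fin p) : sn w k + ee i.castSucc = sn (w + ee i) k := by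
  funext j
  refine Fin.lastCases ?_ (fun j => ?_) j
  · simp [ee_ne (Fin.castSucc_lt_last i).ne']
  · by_cases h : j = i
    · subst h; simp [ee_self]
    · simp [ee_ne h, ee_ne (show j.castSucc ≠ i.castSucc by simpa using h)]

lemma sn_add_last (w : Fin p → ℕ) (k : ℕ) : sn w k + ee (Fin.last p) = sn w (k+1) := by
  funext j
  refine Fin.lastCases ?_ (fun j => ?_) j
  · simp [ee_self]
  · simp [ee_last_cast]

/-- lower bound for Up -/
lemma up_lower {c : Fin (p+1) → ℕ} {d : ℕ} {A : Finset (Fin (p+1) → ℕ)} (hA : A ⊆ T c d) :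
    (Up (ini c) d (lay A 0)).card + (A.filter (fun u => u (Fin.last p) < c (Fin.last p))).card
      ≤ (Up c d A).card := by
  have h1 : (Up (ini c) d (lay A 0)).card = ((Up (ini c) d (lay A 0)).image (fun w => sn w 0)).card :=
    (Finset.card_image_of_injective _ (fun _ _ h => sn_inj h)).symm
  have h2 : (A.filter (fun u => u (Fin.last p) < c (Fin.last p))).card
      = ((A.filter (fun u => u (Fin.last p) < c (Fin.last p))).image
          (fun u => u + ee (Fin.last p))).card :=
    (Finset.card_image_of_injective _ (add_ee_inj _)).symm
  rw [h1, h2, ← Finset.card_union_of_disjoint]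
  · refine Finset.card_le_card (Finset.union_subset ?_ ?_)
    · intro v hv
      obtain ⟨w, hw, rfl⟩ := mem_image.1 hv
      rw [mem_Up] at hw
      obtain ⟨h3, u, hu, huw⟩ := hw
      refine mem_Up.2 ⟨sn_mem_T.2 ⟨h3, by omega, by omega⟩, sn u 0, mem_lay.1 hu, ?_⟩
      rw [sn_le]; simpa using huw
    · intro v hv
      obtain ⟨w, hw, rfl⟩ := mem_image.1 hv
      rw [mem_filter] at hw
      exact up_add hA hw.1 hw.2
  · rw [Finset.disjoint_left]
    intro v hv hv'
    obtain ⟨w, hw, rfl⟩ := mem_image.1 hv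
    obtain ⟨w', hw', h'⟩ := mem_image.1 hv'
    have := congrFun h' (Fin.last p)
    simp [ee_self] at this

lemma up_upper {c : Fin (p+1) → ℕ} {d : ℕ} {A : Finset (Fin (p+1) → ℕ)} (hA : A ⊆ T c d)
    (hs : Stab c (Fin.last p) A) :
    (Up c d A).card ≤ (Up (ini c) d (lay A 0)).card
      + (A.filter (fun u => u (Fin.last p) < c (Fin.last p))).card := by
  have h1 : (Up (ini c) d (lay A 0)).card = ((Up (ini c) d (lay A 0)).image (fun w => sn w 0)).card :=
    (Finset.card_image_of_injective _ (fun _ _ h => sn_inj h)).symm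
  have h2 : (A.filter (fun u => u (Fin.last p) < c (Fin.last p))).card
      = ((A.filter (fun u => u (Fin.last p) < c (Fin.last p))).image
          (fun u => u + ee (Fin.last p))).card :=
    (Finset.card_image_of_injective _ (add_ee_inj _)).symm
  rw [h1, h2]
  refine le_trans (Finset.card_le_card ?_) (Finset.card_union_le _ _)
  intro v hv
  obtain ⟨hvT, u, hu, huv⟩ := mem_Up.1 hv
  obtain ⟨l, rfl⟩ := exists_ee huv (mem_T.1 (hA hu)).2 (mem_T.1 hvT).2
  rw [mem_union]
  have hvc := (mem_T.1 hvT).1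
  by_cases hl : l = Fin.last p
  · subst hl
    right
    refine mem_image_of_mem _ (mem_filter.2 ⟨hu, ?_⟩)
    have := hvc (Fin.last p)
    simpa [ee_self] using this
  · obtain ⟨i, rfl⟩ := Fin.exists_castSucc_eq.2 hl
    have huc : u (Fin.last p) ≤ c (Fin.last p) := (mem_T.1 (hA hu)).1 _
    rcases Nat.eq_zero_or_pos (u (Fin.last p)) with h0 | h0
    · left
      rw [← sn_ini' u h0, sn_add_cast] at hvT ⊢
      refine mem_image_of_mem _ (mem_Up.2 ⟨?_, ini u, ?_, ?_⟩)
      · exact (sn_mem_T.1 hvT).1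
      · rw [mem_lay, sn_ini' u h0]; exact hu
      · intro j; simp
    · right
      set k := u (Fin.last p) - 1 with hk
      have hue : sn (ini u) (k + 1) = u := sn_ini' u (by omega)
      refine mem_image.2 ⟨sn (ini u + ee i) k, mem_filter.2 ⟨?_, ?_⟩, ?_⟩
      · refine hs u hu _ i.castSucc hl ?_ ?_
        · rw [sn_le]
          refine ⟨?_, by omega⟩
          rw [← hue, sn_add_cast, sn_le] at hvc
          exact hvc.1
        · rw [sn_add_last, ← sn_add_cast, hue]
      · simp; omega
      · rw [sn_add_last, ← sn_add_cast, hue]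

lemma push {c : Fin (p+1) → ℕ} {d : ℕ} {A : Finset (Fin (p+1) → ℕ)} (hA : A ⊆ T c d)
    (hs : Stab c (Fin.last p) A) (u : Fin p → ℕ) (hu : sn u 0 ∈ T c d) :
    ∀ (k : ℕ) (a : Fin (p+1) → ℕ), a ∈ A → a (Fin.last p) = k → toLex a ≤ toLex (sn u 0) →
      ∃ a' ∈ lay A 0, toLex a' ≤ toLex u := by
  intro k
  induction k with
  | zero =>
    intro a ha hk hle
    refine ⟨ini a, ?_, ?_⟩
    · rw [mem_lay, sn_ini' a hk]; exact ha
    · rw [← sn_ini' a hk] at hle; exact sn_lex' hle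
  | succ k ih =>
    intro a ha hk hle
    have hlt : toLex a < toLex (sn u 0) := by
      refine lt_of_le_of_ne hle fun h => ?_
      have := congrFun (toLex.injective h) (Fin.last p)
      simp at this; omega
    obtain ⟨i, hi1, hi2⟩ := lex_lt.1 hlt
    have hiq : i ≠ Fin.last p := by
      rintro rfl; simp at hi2
    have hac := (mem_T.1 (hA ha)).1
    have huc := (mem_T.1 hu).1
    have hic : a i < c i := lt_of_lt_of_le hi2 (huc i)
    obtain ⟨j, hj, hjmax⟩ := Finset.exists_max_image
      (Finset.univ.filter (fun j => j ≠ Fin.last p ∧ a j < c j)) (fun j => j)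
      ⟨i, by simp [hiq, hic]⟩
    simp only [mem_filter, mem_univ, true_and] at hj hjmax
    have hij : i ≤ j := hjmax i ⟨hiq, hic⟩
    obtain ⟨j', rfl⟩ := Fin.exists_castSucc_eq.2 hj.1
    have hae : sn (ini a) (k+1) = a := sn_ini' a hk
    set a' := sn (ini a + ee j') k with ha'
    have hrel : a' + ee (Fin.last p) = a + ee j'.castSucc := by
      rw [ha', sn_add_last, ← sn_add_cast, hae]
    have hv : ∀ l, l ≠ j'.castSucc → l ≠ Fin.last p → a' l = a l := by
      intro l h1 h2
      have := congrFun hrel l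
      simpa [ee_ne h1, ee_ne h2] using this
    have hvj : a' j'.castSucc = a j'.castSucc + 1 := by
      have := congrFun hrel j'.castSucc
      simpa [ee_self, ee_ne hj.1] using this
    have hvq : a' (Fin.last p) = k := by simp [ha']
    have ha'c : a' ≤ c := by
      intro l
      by_cases h1 : l = j'.castSucc
      · rw [h1, hvj]; exact hj.2
      · by_cases h2 : l = Fin.last p
        · have h3 : a (Fin.last p) ≤ c (Fin.last p) := hac _
          show a' l ≤ c l
          rw [h2, hvq]; omega
        · rw [hv l h1 h2]; exact hac l
    have ha'A : a' ∈ A := hs a ha a' _ hj.1 ha'c hrel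
    refine ih a' ha'A hvq ?_
    have hbelow : ∀ l < i, a' l ≤ sn u 0 l := by
      intro l hl
      rw [hv l (ne_of_lt (hl.trans_le hij)) (ne_of_lt (hl.trans_le (Fin.le_last i))), hi1 l hl]
    rcases hij.lt_or_eq with hlt' | heq
    · refine (lex_lt_of i hbelow ?_).le
      rw [hv i (ne_of_lt hlt') hiq]; exact hi2
    · have h5 : a' i ≤ sn u 0 i := by rw [heq, hvj, ← heq]; exact hi2
      rcases h5.lt_or_eq with h6 | h6
      · exact (lex_lt_of i hbelow h6).le
      · have hge : sn u 0 ≤ a' := by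
          intro l
          rcases lt_trichotomy l i with h7 | h7 | h7
          · rw [hv l (ne_of_lt (h7.trans_le hij)) (ne_of_lt (h7.trans_le (Fin.le_last i))), hi1 l h7]
          · rw [h7, h6]
          · by_cases h8 : l = Fin.last p
            · rw [h8]; simp
            · rw [hv l (by rw [← heq]; exact h7.ne') h8]
              by_contra hc
              have h9 : a l < c l := lt_of_lt_of_le (not_le.1 hc) (huc l)
              have := hjmax l ⟨h8, h9⟩
              rw [← heq] at this
              exact absurd h7 (not_lt.2 this)
        rcases hge.eq_or_lt with h7 | h7
        · rw [h7]
        · exfalso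
          have := Finset.sum_lt_sum (s := Finset.univ) (fun j _ => hge j)
            (by obtain ⟨_, j, hj⟩ := Pi.lt_def.1 h7; exact ⟨j, Finset.mem_univ _, hj⟩)
          rw [(mem_T.1 hu).2, (mem_T.1 (hA ha'A)).2] at this
          omega

end cl

theorem CL : ∀ (p : ℕ) (c : Fin p → ℕ) (_ : Monotone c) (d : ℕ) (_ : ∀ i, c i = 1 ∨ d + 1 ≤ c i)
    (A L : Finset (Fin p → ℕ)) (_ : A ⊆ T c d) (_ : Seg c d L) (_ : L.card ≤ A.card),
    (Up c d L).card ≤ (Up c d A).card := by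
  intro p
  induction p with
  | zero =>
    intro c _ d _ A L _ _ _
    have : Up c d L = ∅ := by
      ext v
      simp only [mem_Up, mem_T]
      simp
    rw [this]; simp
  | succ p ih =>
    intro c hcm d hc A0 L hA0 hL hcard
    classical
    obtain ⟨A, hA, hAc, hAu, hst⟩ := exists_stab (q := Fin.last p)
      (fun i => hcm (Fin.le_last i)) hc hA0
    refine le_trans ?_ hAu
    rw [← hAc] at hcard
    clear hAu hAc hA0 A0
    have hcm' : Monotone (ini c) := fun i j h => hcm (by simpa using h)
    have hc' : ∀ k i, ini c i = 1 ∨ d - k + 1 ≤ ini c i := fun k i => by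
      rcases hc i.castSucc with h | h
      · exact Or.inl h
      · right; have : d + 1 ≤ ini c i := h
        omega
    choose s hs hsc using fun k => exists_seg (ini c) (d - k) (lay A k).card
      (Finset.card_le_card (lay_subset hA k))
    set B := (T c d).filter (fun u => ini u ∈ s (u (Fin.last p))) with hB
    have hBT : B ⊆ T c d := Finset.filter_subset _ _
    have hlay : ∀ k, lay B k = s k := by
      intro k
      ext w
      rw [mem_lay, hB, mem_filter, ini_sn, sn_last]
      refine ⟨fun h => h.2, fun h => ⟨?_, h⟩⟩
      rw [sn_mem_T]
      refine ⟨(hs k).1 h, ?_⟩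
      have hpos : 0 < (lay A k).card := by rw [← hsc]; exact Finset.card_pos.2 ⟨w, h⟩
      obtain ⟨w', hw'⟩ := Finset.card_pos.1 hpos
      exact (sn_mem_T.1 (hA (mem_lay.1 hw'))).2
    have hBc : B.card = A.card := by
      rw [card_eq_lay hBT, card_eq_lay hA]
      refine Finset.sum_congr rfl fun k _ => ?_
      rw [hlay, hsc]
    have hBst : Stab c (Fin.last p) B := by
      intro u hu v i hi hv hvu
      obtain ⟨i, rfl⟩ := Fin.exists_castSucc_eq.2 hi
      have huT := mem_T.1 (hBT hu)
      have hvT : v ∈ T c d := by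
        refine mem_T.2 ⟨hv, ?_⟩
        have h1 := congrArg (fun w => ∑ j, w j) hvu
        simp only [Pi.add_apply, Finset.sum_add_distrib, sum_ee, huT.2] at h1
        omega
      rw [hB, mem_filter] at hu ⊢
      refine ⟨hvT, ?_⟩
      set k := v (Fin.last p) with hk
      have hq := congrFun hvu (Fin.last p)
      simp only [Pi.add_apply, ee_self, ee_ne hi.symm, add_zero] at hq
      have hini : ini v = ini u + ee i := by
        have h1 : sn (ini v) k = v := sn_ini' v rfl
        have h2 : sn (ini u) (k+1) = u := sn_ini' u (by omega)
        rw [← h1, ← h2, sn_add_last, sn_add_cast] at hvu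
        exact sn_inj hvu
      have hu2 : ini u ∈ s (k+1) := by have := hu.2; rw [← hq] at this; exact this
      have hvT' : sn (ini v) k ∈ T c d := by rw [sn_ini' v rfl]; exact hvT
      have huT' : sn (ini u) (k+1) ∈ T c d := by rw [sn_ini' u hq.symm]; exact hu.1
      have hkd : k + 1 ≤ d := (sn_mem_T.1 huT').2.2
      have hdk : d - (k+1) + 1 = d - k := by omega
      have hmem : ini v ∈ Up (ini c) (d - (k+1)) (s (k+1)) := by
        refine mem_Up.2 ⟨?_, ini u, hu2, ?_⟩
        · rw [hdk]; exact (sn_mem_T.1 hvT').1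
        · rw [hini]; intro j; simp
      have hseg : Seg (ini c) (d - k) (Up (ini c) (d - (k+1)) (s (k+1))) := by
        have := seg_up (hs (k+1)); rwa [hdk] at this
      refine hseg.subset (hs k) ?_ hmem
      rw [hsc]
      refine (ih (ini c) hcm' (d - (k+1)) (hc' (k+1)) (lay A (k+1)) (s (k+1)) (lay_subset hA _)
        (hs (k+1)) (hsc _).le).trans (Finset.card_le_card ?_)
      intro w hw
      obtain ⟨hwT, x, hx, hxw⟩ := mem_Up.1 hw
      obtain ⟨l, rfl⟩ := exists_ee hxw (mem_T.1 (lay_subset hA _ hx)).2 (mem_T.1 hwT).2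
      rw [mem_lay] at hx ⊢
      refine hst _ hx _ l.castSucc (Fin.castSucc_lt_last l).ne ?_ ?_
      · rw [sn_le]
        refine ⟨(mem_T.1 hwT).1, ?_⟩
        have := (sn_mem_T.1 (hA hx)).2.1
        omega
      · rw [sn_add_last, sn_add_cast]
    have hclaim : (lay L 0).card ≤ (lay A 0).card := by
      by_contra hcon
      push Not at hcon
      have h1 : ¬ lay L 0 ⊆ lay B 0 := by
        intro h
        have := Finset.card_le_card h
        rw [hlay, hsc] at this
        omega
      obtain ⟨u, hu, hu'⟩ := Finset.not_subset.1 h1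
      have huL := mem_lay.1 hu
      have hsub : B ⊆ L.erase (sn u 0) := by
        intro a ha
        have hlt : ¬ toLex a ≤ toLex (sn u 0) := by
          intro hle
          obtain ⟨a', ha', hle'⟩ := push hBT hBst u (hL.1 huL) _ a ha rfl hle
          rw [hlay] at ha' hu'
          exact hu' ((hs 0).2 a' ha' u (lay_subset hL.1 0 hu) hle')
        rw [mem_erase]
        refine ⟨fun h => hlt (by rw [h]), hL.2 _ huL a (hBT ha) (not_le.1 hlt).le⟩
      have h2 := Finset.card_le_card hsub
      rw [Finset.card_erase_of_mem huL] at h2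
      have h3 := Finset.card_pos.2 ⟨_, huL⟩
      omega
    have hlow := up_lower (c := c) hA
    have hupp := up_upper hL.1 (seg_stab (fun i => Fin.le_last i) hL)
    have h0 := ih (ini c) hcm' d (hc' 0) (lay A 0) (lay L 0) (lay_subset hA 0) (lay_seg hL 0) hclaim
    have hfil : (L.filter (fun u => u (Fin.last p) < c (Fin.last p))).card
        ≤ (A.filter (fun u => u (Fin.last p) < c (Fin.last p))).card := by
      rcases hc (Fin.last p) with h | h
      · rw [card_lay, card_lay] at hclaim
        simpa [h] using hclaim
      · have key : ∀ X ⊆ T c d, X.filter (fun u => u (Fin.last p) < c (Fin.last p)) = X := by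
          intro X hX
          refine Finset.filter_true_of_mem fun u hu => ?_
          have h1 := (mem_T.1 (hX hu)).2
          have h2 := Finset.single_le_sum (f := u) (fun j _ => Nat.zero_le _)
            (Finset.mem_univ (Fin.last p))
          omega
        rw [key L hL.1, key A hA]; exact hcard
    exact (hupp.trans (add_le_add h0 hfil)).trans hlow

end CLi

namespace CLi
open Finset

def Adm {p : ℕ} (c : Fin p → ℕ) (d a b : ℕ) : Prop :=
  ∃ X ⊆ T c d, ∃ Y ⊆ T c (d+1), X.card = a ∧ Y.card = b ∧ ∀ v ∈ Y, ∀ u ∈ T c d, u ≤ v → u ∈ X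

lemma Adm.le {p : ℕ} {c : Fin p → ℕ} {d a b : ℕ} (h : Adm c d a b) :
    a ≤ (T c d).card ∧ b ≤ (T c (d+1)).card := by
  obtain ⟨X, hX, Y, hY, rfl, rfl, _⟩ := h
  exact ⟨Finset.card_le_card hX, Finset.card_le_card hY⟩

lemma adm_low {p : ℕ} {c : Fin p → ℕ} (hcm : Monotone c) {d : ℕ} (hc : ∀ i, c i = 1 ∨ d + 1 ≤ c i)
    {a b : ℕ} (h : Adm c d a b) {X Y : Finset (Fin p → ℕ)} (hX : Low c d X) (hY : Low c (d+1) Y)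
    (hXa : X.card = a) (hYb : Y.card = b) : ∀ v ∈ Y, ∀ u ∈ T c d, u ≤ v → u ∈ X := by
  intro v hv u hu huv
  by_contra hcon
  obtain ⟨X0, hX0, Y0, hY0, hXc, hYc, hcl⟩ := h
  have h1 := CL p c hcm d hc (T c d \ X0) (T c d \ X) Finset.sdiff_subset (seg_sdiff hX) (by
    rw [Finset.card_sdiff_of_subset hX0, Finset.card_sdiff_of_subset hX.1]; omega)
  have h2 : Up c d (T c d \ X0) ⊆ T c (d+1) \ Y0 := by
    intro w hw
    obtain ⟨hwT, x, hx, hxw⟩ := mem_Up.1 hw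
    rw [mem_sdiff] at hx ⊢
    exact ⟨hwT, fun hwY => hx.2 (hcl w hwY x hx.1 hxw)⟩
  have h3 := (seg_up (seg_sdiff hX)).subset (seg_sdiff hY) (by
    have := Finset.card_le_card h2
    rw [Finset.card_sdiff_of_subset hY0] at this
    rw [Finset.card_sdiff_of_subset hY.1]; omega)
  have h4 := h3 (mem_Up.2 ⟨hY.1 hv, u, mem_sdiff.2 ⟨hu, hcon⟩, huv⟩)
  exact (mem_sdiff.1 h4).2 hv

section
variable {p : ℕ}
def cn (k : ℕ) (w : Fin p → ℕ) : Fin (p+1) → ℕ := Fin.cons (α := fun _ => ℕ) k w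
def tl (u : Fin (p+1) → ℕ) : Fin p → ℕ := fun i => u i.succ

@[simp] lemma cn_zero (k : ℕ) (w : Fin p → ℕ) : cn k w 0 = k := by simp [cn]
@[simp] lemma cn_succ (k : ℕ) (w : Fin p → ℕ) (i : Fin p) : cn k w i.succ = w i := by simp [cn]
@[simp] lemma tl_cn (k : ℕ) (w : Fin p → ℕ) : tl (cn k w) = w := by funext i; simp [tl]
lemma cn_tl (u : Fin (p+1) → ℕ) : cn (u 0) (tl u) = u := by
  funext i
  refine Fin.cases ?_ (fun j => ?_) i <;> simp [tl]

lemma mem_T_cn {c0 : ℕ} {c : Fin p → ℕ} {d : ℕ} {u : Fin (p+1) → ℕ} :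
    u ∈ T (cn c0 c) d ↔ tl u ∈ T c (d - u 0) ∧ u 0 ≤ c0 ∧ u 0 ≤ d := by
  rw [mem_T, mem_T, Fin.sum_univ_succ]
  have h1 : u ≤ cn c0 c ↔ tl u ≤ c ∧ u 0 ≤ c0 := by
    constructor
    · intro h
      refine ⟨fun i => ?_, by simpa using h 0⟩
      have h2 := h i.succ
      rw [cn_succ] at h2; exact h2
    · rintro ⟨h1, h2⟩ i
      refine Fin.cases ?_ (fun j => ?_) i
      · simpa using h2
      · rw [cn_succ]; exact h1 j
  rw [h1]
  have h2 : ∑ i : Fin p, u i.succ = ∑ i, tl u i := rfl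
  rw [h2]
  constructor
  · rintro ⟨⟨h3, h4⟩, h5⟩; exact ⟨⟨h3, by omega⟩, h4, by omega⟩
  · rintro ⟨⟨h3, h4⟩, h5, h6⟩; exact ⟨⟨h3, h5⟩, by omega⟩

open Classical in
noncomputable def glue (c0 : ℕ) (c : Fin p → ℕ) (d : ℕ) (x : ℕ → Finset (Fin p → ℕ)) :
    Finset (Fin (p+1) → ℕ) := (T (cn c0 c) d).filter (fun u => tl u ∈ x (u 0))

lemma mem_glue {c0 : ℕ} {c : Fin p → ℕ} {d : ℕ} {x : ℕ → Finset (Fin p → ℕ)} {u : Fin (p+1) → ℕ} :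
    u ∈ glue c0 c d x ↔ u ∈ T (cn c0 c) d ∧ tl u ∈ x (u 0) := by simp [glue]

lemma card_glue (c0 : ℕ) (c : Fin p → ℕ) (d : ℕ) (x : ℕ → Finset (Fin p → ℕ))
    (hx : ∀ k, k ≤ c0 → k ≤ d → x k ⊆ T c (d - k)) :
    (glue c0 c d x).card = ∑ k ∈ range (min c0 d + 1), (x k).card := by
  classical
  rw [Finset.card_eq_sum_card_fiberwise (f := fun u => u 0) (t := range (min c0 d + 1))]
  · refine Finset.sum_congr rfl fun k hk => ?_
    rw [mem_range] at hk
    symm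
    refine Finset.card_bij (fun w _ => cn k w) ?_ ?_ ?_
    · intro w hw
      rw [mem_filter, mem_glue, mem_T_cn]
      simp only [tl_cn, cn_zero]
      exact ⟨⟨⟨hx k (by omega) (by omega) hw, by omega, by omega⟩, hw⟩, trivial⟩
    · intro w _ w' _ h
      rw [← tl_cn k w, h, tl_cn]
    · intro u hu
      rw [mem_filter, mem_glue] at hu
      refine ⟨tl u, ?_, ?_⟩
      · rw [← hu.2]; exact hu.1.2
      · rw [← hu.2]; exact cn_tl u
  · intro u hu
    have := mem_T_cn.1 (mem_glue.1 hu).1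
    simp; omega

lemma layer {c : Fin p → ℕ} (hcm : Monotone c) {d : ℕ} (hc : ∀ i, c i = 1 ∨ d + 1 ≤ c i)
    (c0 : ℕ) (a b : ℕ → ℕ) (hab : ∀ k, k ≤ c0 → k ≤ d → Adm c (d - k) (a k) (b k))
    (hba : ∀ k, k + 1 ≤ c0 → k ≤ d → b (k+1) ≤ a k) :
    Adm (cn c0 c) d (∑ k ∈ range (min c0 d + 1), a k) (∑ k ∈ range (min c0 (d+1) + 1), b k) := by
  classical
  have hx : ∀ k, ∃ x, (k ≤ c0 → k ≤ d → Low c (d - k) x ∧ x.card = a k) := by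
    intro k
    by_cases h : k ≤ c0 ∧ k ≤ d
    · obtain ⟨L, h1, h2⟩ := exists_low c (d-k) (a k) (hab k h.1 h.2).le.1
      exact ⟨L, fun _ _ => ⟨h1, h2⟩⟩
    · exact ⟨∅, fun h1 h2 => absurd ⟨h1, h2⟩ h⟩
  choose x hx using hx
  have hy : ∀ k, ∃ y, (k ≤ c0 → k ≤ d + 1 → Low c (d + 1 - k) y ∧ y.card = b k) := by
    intro k
    by_cases h : k ≤ c0 ∧ k ≤ d + 1
    · have hb : b k ≤ (T c (d + 1 - k)).card := by
        by_cases hk : k ≤ d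
        · have := (hab k h.1 hk).le.2
          rwa [show d - k + 1 = d + 1 - k by omega] at this
        · obtain rfl : k = d + 1 := by omega
          refine (hba d h.1 le_rfl).trans ?_
          have := (hab d (by omega) le_rfl).le.1
          rwa [show d + 1 - (d+1) = d - d by omega]
      obtain ⟨L, h1, h2⟩ := exists_low c (d+1-k) (b k) hb
      exact ⟨L, fun _ _ => ⟨h1, h2⟩⟩
    · exact ⟨∅, fun h1 h2 => absurd ⟨h1, h2⟩ h⟩
  choose y hy using hy
  refine ⟨glue c0 c d x, Finset.filter_subset _ _, glue c0 c (d+1) y, Finset.filter_subset _ _,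
    ?_, ?_, ?_⟩
  · rw [card_glue _ _ _ _ (fun k h1 h2 => (hx k h1 h2).1.1)]
    refine Finset.sum_congr rfl fun k hk => ?_
    rw [mem_range] at hk
    exact (hx k (by omega) (by omega)).2
  · rw [card_glue _ _ _ _ (fun k h1 h2 => (hy k h1 h2).1.1)]
    refine Finset.sum_congr rfl fun k hk => ?_
    rw [mem_range] at hk
    exact (hy k (by omega) (by omega)).2
  · intro v hv u hu huv
    rw [mem_glue] at hv ⊢
    refine ⟨hu, ?_⟩
    obtain ⟨l, rfl⟩ := exists_ee huv (mem_T.1 hu).2 (mem_T.1 hv.1).2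
    have hu' := mem_T_cn.1 hu
    have hv' := mem_T_cn.1 hv.1
    refine Fin.cases ?_ (fun j => ?_) l hv hv' <;> intro hv hv'
    · have e1 : tl (u + ee 0) = tl u := by
        funext i; simp [tl, ee_ne (Fin.succ_ne_zero i)]
      have e2 : (u + (ee 0 : Fin (p+1) → ℕ)) 0 = u 0 + 1 := by simp [ee_self]
      rw [e1, e2] at hv hv'
      have h1 := hy (u 0 + 1) hv'.2.1 hv'.2.2
      have h2 := hx (u 0) hu'.2.1 hu'.2.2
      rw [show d + 1 - (u 0 + 1) = d - u 0 by omega] at h1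
      exact h1.1.subset h2.1 (by rw [h1.2, h2.2]; exact hba _ hv'.2.1 hu'.2.2) hv.2
    · have e2 : (u + ee j.succ) 0 = u 0 := by simp [ee_ne (Fin.succ_ne_zero j).symm]
      rw [e2] at hv hv'
      have h1 := hy (u 0) hv'.2.1 hv'.2.2
      have h2 := hx (u 0) hu'.2.1 hu'.2.2
      rw [show d + 1 - u 0 = d - u 0 + 1 by omega] at h1
      refine adm_low hcm (fun i => ?_) (hab _ hu'.2.1 hu'.2.2) h2.1 h1.1 h2.2 h1.2 _ hv.2 _ hu'.1 ?_
      · rcases hc i with h | h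
        · exact Or.inl h
        · right; omega
      · intro i; simp [tl]

/-- caps: first g equal to 1, others D -/
def caps (p g D : ℕ) : Fin p → ℕ := fun i => if (i : ℕ) < g then 1 else D

lemma caps_mono (p g D : ℕ) (hD : 1 ≤ D) : Monotone (caps p g D) := by
  intro i j h
  have : (i : ℕ) ≤ j := h
  simp only [caps]
  split_ifs <;> omega

lemma caps_cons_one (p g D : ℕ) : caps (p+1) (g+1) D = cn 1 (caps p g D) := by
  funext i
  refine Fin.cases ?_ (fun j => ?_) i
  · simp [caps]
  · simp [caps]

lemma caps_cons_zero (p D : ℕ) : caps (p+1) 0 D = cn D (caps p 0 D) := by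
  funext i
  refine Fin.cases ?_ (fun j => ?_) i
  · simp [caps]
  · simp [caps]

lemma caps_or (p g D d : ℕ) (h : d + 1 ≤ D) (i : Fin p) : caps p g D i = 1 ∨ d + 1 ≤ caps p g D i := by
  simp only [caps]; split_ifs
  · exact Or.inl rfl
  · exact Or.inr h

end
end CLi

namespace CLi
open Finset

section gi
variable {n : ℕ} {L : Type*} [Field L]

local notation "SS" => homogeneousSubmodule (Fin n) L

instance fin_hom (d : ℕ) : Module.Finite L (homogeneousSubmodule (Fin n) L d) :=
  Module.Finite.iff_fg.2 (homogeneousSubmodule_fg _ _ d)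

lemma finrank_map_inj {V V' : Type*} [AddCommGroup V] [Module L V] [AddCommGroup V'] [Module L V']
    (f : V →ₗ[L] V') (hf : Function.Injective f) (p : Submodule L V) :
    Module.finrank L (p.map f) = Module.finrank L p :=
  (LinearEquiv.finrank_eq (Submodule.equivMapOfInjective f hf p)).symm

/-- graded ideal given by its pieces -/
structure GI (n : ℕ) (L : Type*) [Field L] where
  U : ℕ → Submodule L (MvPolynomial (Fin n) L)
  le : ∀ d, U d ≤ homogeneousSubmodule (Fin n) L d
  mul : ∀ d k f g, f ∈ U d → g ∈ homogeneousSubmodule (Fin n) L k → g * f ∈ U (d + k)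

instance GI.fin (U : GI n L) (d : ℕ) : Module.Finite L (U.U d) :=
  Submodule.finiteDimensional_of_le (U.le d)

noncomputable def GI.hf (U : GI n L) (d : ℕ) : ℕ :=
  Module.finrank L (homogeneousSubmodule (Fin n) L d) - Module.finrank L (U.U d)

lemma GI.finrank_le (U : GI n L) (d : ℕ) :
    Module.finrank L (U.U d) ≤ Module.finrank L (homogeneousSubmodule (Fin n) L d) :=
  Submodule.finrank_mono (U.le d)

lemma GI.hf_mono (U V : GI n L) (d : ℕ) (h : U.U d ≤ V.U d) : V.hf d ≤ U.hf d := by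
  have := Submodule.finrank_mono h
  simp only [GI.hf]; omega

lemma hom_mul {a b : ℕ} {f g : MvPolynomial (Fin n) L} (hf : f ∈ SS a) (hg : g ∈ SS b) :
    f * g ∈ SS (a + b) := by
  rw [mem_homogeneousSubmodule] at *
  exact hf.mul hg

noncomputable def mulL (l : MvPolynomial (Fin n) L) :
    MvPolynomial (Fin n) L →ₗ[L] MvPolynomial (Fin n) L := LinearMap.mulLeft L l

@[simp] lemma mulL_apply (l f : MvPolynomial (Fin n) L) : mulL l f = l * f := rfl

noncomputable def GI.add (U : GI n L) (l : MvPolynomial (Fin n) L)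
    (hl : l ∈ homogeneousSubmodule (Fin n) L 1) : GI n L where
  U d := U.U d ⊔ (match d with
    | 0 => ⊥
    | d+1 => (homogeneousSubmodule (Fin n) L d).map (mulL l))
  le d := by
    refine sup_le (U.le d) ?_
    rcases d with _ | d
    · exact bot_le
    · rintro _ ⟨f, hf, rfl⟩
      rw [add_comm]; exact hom_mul hl hf
  mul d k f g hf hg := by
    obtain ⟨a, ha, b, hb, rfl⟩ := Submodule.mem_sup.1 hf
    rw [mul_add]
    refine Submodule.add_mem_sup (U.mul _ _ _ _ ha hg) ?_
    rcases d with _ | d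
    · rw [(Submodule.mem_bot L).1 hb, mul_zero]; exact Submodule.zero_mem _
    · rw [show d + 1 + k = (d + k) + 1 by omega]
      obtain ⟨f', hf', rfl⟩ := hb
      refine ⟨f' * g, hom_mul hf' hg, ?_⟩
      simp only [mulL_apply]; ring

noncomputable def GI.colon (U : GI n L) (l : MvPolynomial (Fin n) L) : GI n L where
  U d := homogeneousSubmodule (Fin n) L d ⊓ (U.U (d+1)).comap (mulL l)
  le d := inf_le_left
  mul d k f g hf hg := by
    refine ⟨by rw [add_comm]; exact hom_mul hg hf.1, ?_⟩
    have h1 : l * f ∈ U.U (d+1) := hf.2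
    have := U.mul _ _ _ _ h1 hg
    rw [show d + k + 1 = d + 1 + k by omega]
    show l * (g * f) ∈ U.U (d + 1 + k)
    convert this using 1; ring

lemma GI.hf_split (U : GI n L) (l : MvPolynomial (Fin n) L) (hl : l ∈ SS 1) (h0 : l ≠ 0) (d : ℕ) :
    U.hf (d+1) = (U.add l hl).hf (d+1) + (U.colon l).hf d := by
  have hinj : Function.Injective (mulL l : MvPolynomial (Fin n) L →ₗ[L] _) := by
    intro a b hab
    simp only [mulL_apply] at hab
    exact mul_left_cancel₀ h0 hab
  have h1 := Submodule.finrank_sup_add_finrank_inf_eq (U.U (d+1)) ((SS d).map (mulL l))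
  have h2 : U.U (d+1) ⊓ (SS d).map (mulL l) = ((U.colon l).U d).map (mulL l) := by
    ext f
    constructor
    · rintro ⟨h3, g, hg, rfl⟩
      exact ⟨g, ⟨hg, h3⟩, rfl⟩
    · rintro ⟨g, hg, rfl⟩
      exact ⟨hg.2, g, hg.1, rfl⟩
  rw [h2, finrank_map_inj _ hinj, finrank_map_inj _ hinj] at h1
  have h3 := (U.add l hl).finrank_le (d+1)
  have h4 := (U.colon l).finrank_le d
  have h5 := U.finrank_le (d+1)
  have h6 : (U.add l hl).U (d+1) = U.U (d+1) ⊔ (SS d).map (mulL l) := rfl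
  rw [← h6] at h1
  simp only [GI.hf]
  omega

lemma GI.hf_add_zero (U : GI n L) (l : MvPolynomial (Fin n) L) (hl : l ∈ SS 1) :
    (U.add l hl).hf 0 = U.hf 0 := by
  have : (U.add l hl).U 0 = U.U 0 := sup_bot_eq _
  simp only [GI.hf]; rw [this]

lemma X_mem (i : Fin n) : (X i : MvPolynomial (Fin n) L) ∈ SS 1 := by
  rw [mem_homogeneousSubmodule]; exact isHomogeneous_X _ _

lemma le_add (U : GI n L) (l : MvPolynomial (Fin n) L) (hl : l ∈ SS 1) (d : ℕ) :
    U.U d ≤ (U.add l hl).U d := le_sup_left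

lemma mem_add (U : GI n L) (l : MvPolynomial (Fin n) L) (hl : l ∈ SS 1) : l ∈ (U.add l hl).U 1 := by
  refine Submodule.mem_sup_right ⟨1, ?_, by simp⟩
  rw [SetLike.mem_coe, mem_homogeneousSubmodule]; exact isHomogeneous_one _ _

lemma le_colon (U : GI n L) (l : MvPolynomial (Fin n) L) (hl : l ∈ SS 1) (d : ℕ) :
    U.U d ≤ (U.colon l).U d := by
  intro f hf
  exact ⟨U.le d hf, U.mul d 1 f l hf hl⟩

lemma add_le_colon (U : GI n L) (l l' : MvPolynomial (Fin n) L) (hl : l ∈ SS 1) (hl' : l' ∈ SS 1)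
    (h : l * l' ∈ U.U 2) (d : ℕ) : (U.add l' hl').U d ≤ (U.colon l).U d := by
  refine sup_le (le_colon U l hl d) ?_
  rcases d with _ | d
  · exact bot_le
  · rintro _ ⟨g, hg, rfl⟩
    refine ⟨?_, ?_⟩
    · rw [add_comm]; exact hom_mul hl' hg
    · have := U.mul _ _ _ _ h hg
      rw [show d + 1 + 1 = 2 + d by omega]
      show l * (l' * g) ∈ U.U (2 + d)
      convert this using 1; ring

lemma finrank_SS_one : Module.finrank L (SS 1) ≤ n := by
  rw [homogeneousSubmodule_one_eq_span_X]
  have := finrank_range_le_card (R := L) (fun i : Fin n => (X i : MvPolynomial (Fin n) L))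
  simpa [Set.finrank] using this

lemma finrank_SS_zero : Module.finrank L (SS 0) ≤ 1 := by
  have h : SS 0 ≤ Submodule.span L {(1 : MvPolynomial (Fin n) L)} := by
    intro f hf
    rw [mem_homogeneousSubmodule] at hf
    have := totalDegree_eq_zero_iff_eq_C.1 ((totalDegree_zero_iff_isHomogeneous _).2 hf)
    rw [this, Submodule.mem_span_singleton]
    exact ⟨coeff 0 f, by rw [smul_eq_C_mul, mul_one]⟩
  exact (Submodule.finrank_mono h).trans (by rw [finrank_span_singleton one_ne_zero])

lemma GI.top_of_one (U : GI n L) (h : U.U 1 = SS 1) (d : ℕ) : U.U (d+1) = SS (d+1) := by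
  refine le_antisymm (U.le _) ?_
  have hm : ∀ d, SS (d+1) ≤ SS 1 * SS d := by
    intro d
    have h1 : (SS 1) ^ (d+1) = SS (d+1) := by simp only [homogeneousSubmodule_one_pow]
    have h2 : (SS 1) ^ d = SS d := by simp only [homogeneousSubmodule_one_pow]
    rw [← h1, pow_succ', h2]
  refine (hm d).trans (Submodule.mul_le.2 fun f hf g hg => ?_)
  rw [← h] at hf
  have := U.mul _ _ _ _ hf hg
  rwa [mul_comm, add_comm] at this

lemma adm_zero (U : GI n L) (W : Submodule L (MvPolynomial (Fin n) L)) (hW : W ≤ U.U 1)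
    (hr : Module.finrank L W = n) (c : Fin 0 → ℕ) (d : ℕ) : Adm c d (U.hf d) (U.hf (d+1)) := by
  have h1 : U.U 1 = SS 1 := by
    refine le_antisymm (U.le _) ?_
    have : W = SS 1 := Submodule.eq_of_le_of_finrank_le (hW.trans (U.le 1)) (by
      rw [hr]; exact finrank_SS_one)
    rw [← this]; exact hW
  have hz : ∀ d, U.hf (d+1) = 0 := by
    intro d
    simp only [GI.hf]; rw [U.top_of_one h1]; omega
  have h0 : U.hf 0 ≤ 1 := (Nat.sub_le _ _).trans finrank_SS_zero
  rw [hz]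
  rcases d with _ | d
  · have hT : (T c 0).card = 1 := by
      rw [Finset.card_eq_one]
      refine ⟨0, ?_⟩
      ext u
      rw [mem_T, mem_singleton]
      constructor
      · intro _; exact Subsingleton.elim _ _
      · rintro rfl; exact ⟨fun i => i.elim0, by simp⟩
    obtain ⟨X, hX, hXc⟩ := Finset.exists_subset_card_eq (s := T c 0) (n := U.hf 0) (by omega)
    exact ⟨X, hX, ∅, by simp, hXc, rfl, by simp⟩
  · rw [hz]
    exact ⟨∅, by simp, ∅, by simp, rfl, rfl, by simp⟩

lemma finrank_W_add (W : Submodule L (MvPolynomial (Fin n) L)) [FiniteDimensional L W]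
    (x : MvPolynomial (Fin n) L) (hx : x ∉ W) :
    Module.finrank L (W ⊔ Submodule.span L {x} : Submodule L _) = Module.finrank L W + 1 := by
  have h := Submodule.finrank_sup_add_finrank_inf_eq W (Submodule.span L {x})
  have h0 : x ≠ 0 := by rintro rfl; exact hx W.zero_mem
  have h1 : W ⊓ Submodule.span L {x} = ⊥ := by
    rw [← disjoint_iff, disjoint_comm]
    exact (Submodule.disjoint_span_singleton' h0).2 hx |>.symm
  rw [h1, finrank_bot, finrank_span_singleton h0] at h
  omega

noncomputable def cIter (U : GI n L) (l : MvPolynomial (Fin n) L) : ℕ → GI n L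
  | 0 => U
  | k+1 => (cIter U l k).colon l

lemma hf_cIter (U : GI n L) (l : MvPolynomial (Fin n) L) (hl : l ∈ SS 1) (h0 : l ≠ 0) (d : ℕ) :
    ∀ j, (cIter U l j).hf d = ∑ k ∈ range (d+1), ((cIter U l (j+k)).add l hl).hf (d - k) := by
  induction d with
  | zero => intro j; simp [GI.hf_add_zero]
  | succ d ih =>
    intro j
    rw [GI.hf_split _ l hl h0, Finset.sum_range_succ']
    have : (cIter U l j).colon l = cIter U l (j+1) := rfl
    rw [this, ih, add_comm]
    congr 1
    refine Finset.sum_congr rfl fun k _ => ?_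
    rw [show j + 1 + k = j + (k+1) by omega, show d + 1 - (k+1) = d - k by omega]

lemma le_cIter (U : GI n L) (l : MvPolynomial (Fin n) L) (hl : l ∈ SS 1) (k d : ℕ) :
    U.U d ≤ (cIter U l k).U d := by
  induction k with
  | zero => exact le_rfl
  | succ k ih => exact ih.trans (le_colon _ l hl d)

theorem thmA (E : Set (Fin n × Fin n)) : ∀ (p g : ℕ) (U : GI n L)
    (W : Submodule L (MvPolynomial (Fin n) L)) (_ : W ≤ U.U 1) (_ : Module.finrank L W + p = n)
    (_ : ∀ e ∈ E, X e.1 * X e.2 ∈ U.U 2)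
    (_ : ∀ C : Set (Fin n), (∀ e ∈ E, e.1 ∈ C ∨ e.2 ∈ C) → g + Module.finrank L W ≤
      Module.finrank L (W ⊔ Submodule.span L (X '' C) : Submodule L (MvPolynomial (Fin n) L)))
    (d D : ℕ) (_ : d + 1 ≤ D), Adm (caps p g D) d (U.hf d) (U.hf (d+1)) := by
  intro p
  induction p with
  | zero =>
    intro g U W hW hr _ _ d D hD
    exact adm_zero U W hW (by omega) _ d
  | succ p ih =>
    intro g U W hW hr hE hC d D hD
    have : FiniteDimensional L W := Submodule.finiteDimensional_of_le (hW.trans (U.le 1))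
    -- general step
    have hfin : ∀ (x : MvPolynomial (Fin n) L) (C : Set (Fin n)), x ∈ SS 1 → FiniteDimensional L
        (W ⊔ Submodule.span L {x} ⊔ Submodule.span L (X '' C) : Submodule L _) := by
      intro x C hx
      refine Submodule.finiteDimensional_of_le (S₂ := SS 1) ?_
      refine sup_le (sup_le (hW.trans (U.le 1)) ?_) ?_
      · rw [Submodule.span_le]; simpa using hx
      · rw [Submodule.span_le]; rintro _ ⟨i, _, rfl⟩; exact X_mem i
    have step : ∀ (g' : ℕ) (V : GI n L) (i : Fin n), g ≤ g' + 1 → (g' = 0 ∨ g = g' + 1) →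
        X i ∉ W → W ≤ V.U 1 → X i ∈ V.U 1 → U.U 2 ≤ V.U 2 → ∀ d, d + 1 ≤ D →
        Adm (caps p g' D) d (V.hf d) (V.hf (d+1)) := by
      intro g' V i hg hg' hi hWV hiV h2 d hD
      refine ih g' V (W ⊔ Submodule.span L {X i}) (sup_le hWV ?_) ?_ (fun e he => h2 (hE e he)) ?_ d D hD
      · rw [Submodule.span_le]; simpa using hiV
      · rw [finrank_W_add W _ hi]; omega
      · intro C hCE
        have := hfin (X i) C (X_mem i)
        rcases hg' with rfl | hg'
        · rw [zero_add]; exact Submodule.finrank_mono le_sup_left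
        · rw [finrank_W_add W _ hi]
          have h3 := hC C hCE
          have h4 : Module.finrank L (W ⊔ Submodule.span L (X '' C) : Submodule L (MvPolynomial (Fin n) L)) ≤
            Module.finrank L (W ⊔ Submodule.span L {X i} ⊔ Submodule.span L (X '' C) :
              Submodule L (MvPolynomial (Fin n) L)) :=
            Submodule.finrank_mono (sup_le_sup_right le_sup_left _)
          omega
    rcases g with _ | g
    · -- g = 0
      obtain ⟨i, hi⟩ : ∃ i, (X i : MvPolynomial (Fin n) L) ∉ W := by
        by_contra hcon
        push Not at hcon
        have h1 : SS 1 ≤ W := by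
          rw [homogeneousSubmodule_one_eq_span_X, Submodule.span_le]
          rintro _ ⟨i, rfl⟩; exact hcon i
        have h2 := Submodule.finrank_mono h1
        -- finrank of SS 1 is n
        have h3 : Module.finrank L (SS 1) = n := by
          rw [homogeneousSubmodule_one_eq_span_X, finrank_span_eq_card
            (by simpa using (MvPolynomial.linearIndependent_X (Fin n) L)), Fintype.card_fin]
        omega
      have h0 : (X i : MvPolynomial (Fin n) L) ≠ 0 := X_ne_zero i
      have hsum := hf_cIter U (X i) (X_mem i) h0
      have hl := layer (caps_mono p 0 D (by omega)) (caps_or p 0 D d hD) D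
        (fun k => ((cIter U (X i) k).add (X i) (X_mem i)).hf (d - k))
        (fun k => ((cIter U (X i) k).add (X i) (X_mem i)).hf (d + 1 - k)) ?_ ?_
      · rw [caps_cons_zero]
        rw [min_eq_right (by omega), min_eq_right (by omega)] at hl
        have e1 := hsum d 0
        have e2 := hsum (d+1) 0
        simp only [zero_add] at e1 e2
        rw [← e1, ← e2] at hl
        exact hl
      · intro k hk hkd
        have := step 0 ((cIter U (X i) k).add (X i) (X_mem i)) i (by omega) (Or.inl rfl) hi
          ((hW.trans (le_cIter U _ (X_mem i) k 1)).trans (le_add _ _ _ _)) (mem_add _ _ _)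
          ((le_cIter U _ (X_mem i) k 2).trans (le_add _ _ _ _)) (d - k) (by omega)
        rwa [show d - k + 1 = d + 1 - k by omega] at this
      · intro k hk hkd
        rw [show d + 1 - (k+1) = d - k by omega]
        refine GI.hf_mono _ _ _ ?_
        refine sup_le_sup_right ?_ _
        exact le_colon _ _ (X_mem i) _
    · -- g + 1
      obtain ⟨e, he, hi, hj⟩ : ∃ e ∈ E, (X e.1 : MvPolynomial (Fin n) L) ∉ W ∧
          (X e.2 : MvPolynomial (Fin n) L) ∉ W := by
        by_contra hcon
        push Not at hcon
        have h1 := hC {i | X i ∈ W} (fun e he => by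
          by_cases h : (X e.1 : MvPolynomial (Fin n) L) ∈ W
          · exact Or.inl h
          · exact Or.inr (hcon e he h))
        have h2 : W ⊔ Submodule.span L (X '' {i | X i ∈ W}) = W := by
          refine sup_eq_left.2 ?_
          rw [Submodule.span_le]; rintro _ ⟨i, hi, rfl⟩; exact hi
        rw [h2] at h1
        omega
      have main : ∀ i j : Fin n, (X i : MvPolynomial (Fin n) L) ∉ W →
          (X j : MvPolynomial (Fin n) L) ∉ W → X i * X j ∈ U.U 2 →
          (U.colon (X i)).hf d ≤ (U.add (X i) (X_mem i)).hf d →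
          Adm (caps (p+1) (g+1) D) d (U.hf d) (U.hf (d+1)) := by
        intro i j hi hj hij hle
        have h0 : (X i : MvPolynomial (Fin n) L) ≠ 0 := X_ne_zero i
        have hl := layer (caps_mono p g D (by omega)) (caps_or p g D d hD) 1
          (fun k => if k = 0 then (U.add (X i) (X_mem i)).hf d else (U.colon (X i)).hf (d - k))
          (fun k => if k = 0 then (U.add (X i) (X_mem i)).hf (d+1)
            else (U.colon (X i)).hf (d + 1 - k)) ?_ ?_
        · rw [caps_cons_one]
          have e2 : min 1 (d+1) = 1 := by omega
          rw [e2] at hl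
          have s2 := GI.hf_split U (X i) (X_mem i) h0 d
          have s1 : U.hf d = ∑ k ∈ range (min 1 d + 1), (if k = 0 then (U.add (X i) (X_mem i)).hf d
              else (U.colon (X i)).hf (d - k)) := by
            rcases d with _ | d
            · simp [GI.hf_add_zero]
            · have s3 := GI.hf_split U (X i) (X_mem i) h0 d
              rw [show min 1 (d+1) = 1 by omega]
              simp [Finset.sum_range_succ, s3]
          rw [← s1] at hl
          have s4 : U.hf (d+1) = ∑ k ∈ range (1 + 1), (if k = 0 then (U.add (X i) (X_mem i)).hf (d+1)
            else (U.colon (X i)).hf (d + 1 - k)) := by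
            simp [Finset.sum_range_succ, s2]
          rw [← s4] at hl
          exact hl
        · intro k hk hkd
          rcases k with _ | k
          · simp only [if_true, Nat.sub_zero]
            exact step g (U.add (X i) (X_mem i)) i (by omega) (Or.inr rfl) hi
              (hW.trans (le_add _ _ _ _)) (mem_add _ _ _) (le_add _ _ _ _) d hD
          · obtain rfl : k = 0 := by omega
            have := step g (U.colon (X i)) j (by omega) (Or.inr rfl) hj
              (hW.trans (le_colon _ _ (X_mem i) _)) ⟨X_mem j, hij⟩ (le_colon _ _ (X_mem i) _)
              (d - 1) (by omega)
            rw [show d - 1 + 1 = d by omega] at this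
            simpa using this
        · intro k hk hkd
          obtain rfl : k = 0 := by omega
          simpa using hle
      have hij := hE e he
      have hji : (X e.2 * X e.1 : MvPolynomial (Fin n) L) ∈ U.U 2 := by rw [mul_comm]; exact hij
      have c1 := GI.hf_mono _ _ d (add_le_colon U (X e.1) (X e.2) (X_mem _) (X_mem _) hij d)
      have c2 := GI.hf_mono _ _ d (add_le_colon U (X e.2) (X e.1) (X_mem _) (X_mem _) hji d)
      by_cases hle : (U.colon (X e.1)).hf d ≤ (U.add (X e.1) (X_mem e.1)).hf d
      · exact main e.1 e.2 hi hj hij hle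
      · exact main e.2 e.1 hj hi hji (by omega)

end gi
end CLi


namespace CLi
section resol
universe u
variable {R : Type u} [Ring R]

lemma res_step (S : ShortComplex (ModuleCat.{u} R)) (hS : S.ShortExact) [Projective S.X₂]
    (k : ℕ) (h : ∃ P : ProjectiveResolution S.X₁, ∀ i : ℕ, k < i → Limits.IsZero (P.complex.X i)) :
    ∃ P : ProjectiveResolution S.X₃, ∀ i : ℕ, k + 1 < i → Limits.IsZero (P.complex.X i) := by
  obtain ⟨Q, hQ⟩ := h
  have := hS.mono_f
  have := hS.epi_g
  let π0 : Q.complex.X 0 ⟶ S.X₁ := Q.π.f 0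
  have hπ : Q.complex.d 1 0 ≫ π0 = 0 := Q.complex_d_comp_π_f_zero
  have hepi : Epi π0 := inferInstanceAs (Epi (Q.π.f 0))
  have hex0 : (ShortComplex.mk _ _ hπ).Exact := Q.exact₀
  have w : Q.complex.d 1 0 ≫ (π0 ≫ S.f) = 0 := by
    rw [← Category.assoc, hπ, Limits.zero_comp]
  let C := ChainComplex.augment Q.complex (π0 ≫ S.f) w
  have e1 : (ShortComplex.mk _ _ w).Exact := by
    let φ : ShortComplex.mk _ _ hπ ⟶ ShortComplex.mk _ _ w :=
      { τ₁ := 𝟙 _, τ₂ := 𝟙 _, τ₃ := S.f, comm₁₂ := by simp, comm₂₃ := by simp }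
    have : Epi φ.τ₁ := inferInstanceAs (Epi (𝟙 _))
    have : IsIso φ.τ₂ := inferInstanceAs (IsIso (𝟙 _))
    have : Mono φ.τ₃ := inferInstanceAs (Mono S.f)
    exact (ShortComplex.exact_iff_of_epi_of_isIso_of_mono φ).1 hex0
  have w2 : (π0 ≫ S.f) ≫ S.g = 0 := by simp
  have e0 : (ShortComplex.mk _ _ w2).Exact := by
    let φ : ShortComplex.mk _ _ w2 ⟶ S :=
      { τ₁ := π0, τ₂ := 𝟙 _, τ₃ := 𝟙 _, comm₁₂ := by simp, comm₂₃ := by simp }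
    have : Epi φ.τ₁ := hepi
    have : IsIso φ.τ₂ := inferInstanceAs (IsIso (𝟙 _))
    have : Mono φ.τ₃ := inferInstanceAs (Mono (𝟙 _))
    exact (ShortComplex.exact_iff_of_epi_of_isIso_of_mono φ).2 hS.exact
  refine ⟨{ complex := C, projective := ?_, π := (ChainComplex.toSingle₀Equiv _ _).symm ⟨S.g, w2⟩, quasiIso := ⟨fun n => ?_⟩ }, ?_⟩
  · rintro (_ | n)
    · exact inferInstanceAs (Projective S.X₂)
    · exact inferInstanceAs (Projective (Q.complex.X n))
  · rcases n with _ | n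
    · rw [ChainComplex.quasiIsoAt₀_iff, ShortComplex.quasiIso_iff_of_zeros']
      · refine (ShortComplex.exact_and_epi_g_iff_of_iso ?_).2 ⟨e0, hS.epi_g⟩
        exact ShortComplex.isoMk (Iso.refl _) (Iso.refl _) (Iso.refl _)
          (by erw [Category.id_comp])
          (by erw [Category.id_comp])
      all_goals rfl
    · rw [quasiIsoAt_iff_exactAt' _ _ (ChainComplex.exactAt_succ_single_obj _ _)]
      rw [HomologicalComplex.exactAt_iff' _ (n + 1 + 1) (n + 1) n (by simp) (by simp)]
      rcases n with _ | n
      · exact e1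
      · exact Q.exact_succ n
  · rintro (_ | i) hi
    · omega
    · exact hQ i (by omega)

lemma pdle_of_res (M : ModuleCat.{u} R) (k : ℕ)
    (h : ∃ P : ProjectiveResolution M, ∀ i : ℕ, k < i → Limits.IsZero (P.complex.X i)) :
    HasProjectiveDimensionLE M k := by
  obtain ⟨P, hP⟩ := h
  refine HasProjectiveDimensionLT.mk fun i hi Y e => ?_
  obtain ⟨f, hf, rfl⟩ := P.extMk_surjective e (i + 1) rfl
  obtain rfl : f = 0 := (hP i (by omega)).eq_of_src _ _
  exact P.extMk_zero _ _

variable (R) in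
def PD (M : Type u) [AddCommGroup M] [Module R M] (k : ℕ) : Prop :=
  HasProjectiveDimensionLE (ModuleCat.of R M) k

variable {M N P : Type u} [AddCommGroup M] [Module R M] [AddCommGroup N] [Module R N]
  [AddCommGroup P] [Module R P]

lemma pd_zero : PD R M 0 ↔ Module.Projective R M := by
  rw [PD, ← projective_iff_hasProjectiveDimensionLE_zero, ← IsProjective.iff_projective]

lemma pd_mono {k l : ℕ} (hkl : k ≤ l) (h : PD R M k) : PD R M l := by
  have : HasProjectiveDimensionLT (ModuleCat.of R M) (k+1) := h
  exact hasProjectiveDimensionLT_of_ge _ (k+1) (l+1) (by omega)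

lemma shex (f : N →ₗ[R] P) (g : P →ₗ[R] M) (hf : Function.Injective f)
    (hg : Function.Surjective g) (h : Function.Exact f g) :
    (ShortComplex.mk (ModuleCat.ofHom f) (ModuleCat.ofHom g) (by
      ext x; simpa using h.apply_apply_eq_zero x)).ShortExact := by
  apply ModuleCat.shortComplex_shortExact
  · exact h
  · exact hf
  · exact hg

lemma pd_step (f : N →ₗ[R] P) (g : P →ₗ[R] M) (hf : Function.Injective f)
    (hg : Function.Surjective g) (h : Function.Exact f g) [hP : Module.Projective R P] (k : ℕ) :
    PD R M (k+1) ↔ PD R N k := by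
  exact (shex f g hf hg h).hasProjectiveDimensionLT_X₃_iff k (IsProjective.iff_projective _ |>.1 hP)

lemma pd_equiv (e : M ≃ₗ[R] N) {k : ℕ} (h : PD R M k) : PD R N k := by
  have : HasProjectiveDimensionLE (ModuleCat.of R M) k := h
  exact hasProjectiveDimensionLT_of_iso e.toModuleIso _

lemma pd_retract (i : M →ₗ[R] N) (r : N →ₗ[R] M) (hr : ∀ x, r (i x) = x) {k : ℕ}
    (h : PD R N k) : PD R M k := by
  have : HasProjectiveDimensionLE (ModuleCat.of R N) k := h
  let t : Retract (ModuleCat.of R M) (ModuleCat.of R N) :=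
    { i := ModuleCat.ofHom i, r := ModuleCat.ofHom r, retract := by ext x; exact hr x }
  exact t.hasProjectiveDimensionLT _

variable (R M) in
noncomputable abbrev cov : (M →₀ R) →ₗ[R] M := Finsupp.linearCombination R (id : M → M)

lemma cov_surj : Function.Surjective (cov R M) :=
  Finsupp.linearCombination_surjective R Function.surjective_id

lemma ker_exact (g : P →ₗ[R] M) : Function.Exact (LinearMap.ker g).subtype g := by
  intro x; simp

lemma pd_cov (k : ℕ) : PD R M (k+1) ↔ PD R (LinearMap.ker (cov R M)) k :=
  pd_step _ (cov R M) (Submodule.subtype_injective _) cov_surj (ker_exact _) k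

lemma res_of_pd (k : ℕ) : ∀ (M : Type u) [AddCommGroup M] [Module R M], PD R M k →
    ∃ P : ProjectiveResolution (ModuleCat.of R M), ∀ i : ℕ, k < i → Limits.IsZero (P.complex.X i) := by
  induction k with
  | zero =>
    intro M _ _ h
    have : Projective (ModuleCat.of R M) := IsProjective.iff_projective _ |>.1 (pd_zero.1 h)
    refine ⟨ProjectiveResolution.self _, fun i hi => ?_⟩
    exact HomologicalComplex.isZero_single_obj_X _ _ _ _ (by omega)
  | succ k ih =>
    intro M _ _ h
    have h1 := ih _ ((pd_cov k).1 h)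
    have hs := shex _ (cov R M) (Submodule.subtype_injective _) cov_surj (ker_exact _)
    have hp : Projective (ModuleCat.of R (M →₀ R)) :=
      IsProjective.iff_projective _ |>.1 inferInstance
    exact @res_step _ _ _ hs hp k h1

end resol

end CLi


namespace CLi
universe u

lemma projDim_eq {R : Type u} [Ring R] (M : Type u) [AddCommGroup M] [Module R M] (p : ℕ)
    (h : ∀ k, PD R M k ↔ p ≤ k) : projDim (ModuleCat.of R M) = p := by
  apply le_antisymm
  · exact sInf_le ⟨p, rfl, res_of_pd p M ((h p).2 le_rfl)⟩
  · refine le_sInf ?_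
    rintro c ⟨k, rfl, hk⟩
    exact_mod_cast (h k).1 (pdle_of_res _ k hk)

section change
variable {S B : Type u} [CommRing S] [CommRing B] [Algebra S B]

lemma proj_finsupp [Module.Projective S B] (M : Type u) : Module.Projective S (M →₀ B) := by
  classical
  exact Module.Projective.of_equiv' (finsuppLequivDFinsupp (ι := M) (M := B) S).symm

lemma proj_trans [Module.Projective S B] (M : Type u) [AddCommGroup M] [Module B M] [Module S M]
    [IsScalarTower S B M] [h : Module.Projective B M] : Module.Projective S M := by
  obtain ⟨s, hs⟩ := h
  have := proj_finsupp (S := S) (B := B) M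
  refine Module.Projective.of_split (s.restrictScalars S)
    ((Finsupp.linearCombination B (id : M → M)).restrictScalars S) ?_
  ext x
  exact hs x

lemma pd_restrict [Module.Projective S B] (k : ℕ) : ∀ (M : Type u) [AddCommGroup M] [Module B M]
    [Module S M] [IsScalarTower S B M], PD B M k → PD S M k := by
  induction k with
  | zero =>
    intro M _ _ _ _ h
    have := pd_zero.1 h
    exact pd_zero.2 (proj_trans (B := B) M)
  | succ k ih =>
    intro M _ _ _ _ h
    have h1 := ih _ ((pd_cov k).1 h)
    have := proj_finsupp (S := S) (B := B) M
    exact (pd_step ((LinearMap.ker (cov B M)).subtype.restrictScalars S)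
      ((cov B M).restrictScalars S) (Submodule.subtype_injective _) cov_surj
      (ker_exact (cov B M)) k).2 h1

open TensorProduct in
lemma pd_tensor [Module.Flat S B] (k : ℕ) : ∀ (M : Type u) [AddCommGroup M] [Module S M],
    PD S M k → PD B (B ⊗[S] M) k := by
  induction k with
  | zero =>
    intro M _ _ h
    have := pd_zero.1 h
    exact pd_zero.2 inferInstance
  | succ k ih =>
    intro M _ _ h
    have h1 := ih _ ((pd_cov k).1 h)
    exact (pd_step ((LinearMap.ker (cov S M)).subtype.baseChange B)
      ((cov S M).baseChange B) 
      (Module.Flat.lTensor_preserves_injective_linearMap _ (Submodule.subtype_injective _))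
      (LinearMap.lTensor_surjective B cov_surj) 
      (lTensor_exact B (ker_exact _) cov_surj) k).2 h1

end change

section poly
open Polynomial TensorProduct
variable {R : Type u} [CommRing R]

lemma pd_poly_zero (M : Type u) [AddCommGroup M] [Module R M] [Module R[X] M]
    [IsScalarTower R R[X] M] [Module.Projective R M] : PD R[X] M 1 := by
  let φ : M →ₗ[R] M := Algebra.lsmul R R M (Polynomial.X : R[X])
  let g : R[X] ⊗[R] M →ₗ[R[X]] M :=
    AlgebraTensorModule.lift (((LinearMap.lsmul R[X] M).flip.restrictScalars R).flip)
  have hg : ∀ p m, g (p ⊗ₜ m) = p • m := fun p m => rfl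
  let f : R[X] ⊗[R] M →ₗ[R[X]] R[X] ⊗[R] M :=
    (Polynomial.X : R[X]) • LinearMap.id - φ.baseChange R[X]
  have hf : ∀ p m, f (p ⊗ₜ m) = ((Polynomial.X : R[X]) * p) ⊗ₜ m - p ⊗ₜ (φ m) := fun p m => by
    simp [f, TensorProduct.smul_tmul']
  have hgf : ∀ t, g (f t) = 0 := by
    intro t
    induction t with
    | zero => simp
    | add x y hx hy => rw [map_add, map_add, hx, hy, add_zero]
    | tmul p m => 
      rw [hf, map_sub, hg, hg]
      simp [φ, mul_smul, smul_comm p]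
  have hr : ∀ t, t - 1 ⊗ₜ g t ∈ LinearMap.range f := by
    intro t
    induction t with
    | zero => simp
    | add x y hx hy =>
      have := Submodule.add_mem _ hx hy
      rw [map_add, tmul_add]
      convert this using 1
      abel
    | tmul p m =>
      induction p using Polynomial.induction_on' with
      | add p q hp hq => 
        have := Submodule.add_mem _ hp hq
        rw [add_tmul, map_add, tmul_add]
        convert this using 1
        abel
      | monomial i a =>
        induction i generalizing m with
        | zero =>
          convert Submodule.zero_mem _
          rw [hg, monomial_zero_left, ← Polynomial.algebraMap_eq, algebraMap_smul,
            Algebra.algebraMap_eq_smul_one, smul_tmul, sub_self]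
        | succ i ih =>
          have h1 := Submodule.add_mem _ (ih (φ m)) (LinearMap.mem_range_self f (monomial i a ⊗ₜ m))
          convert h1 using 1
          rw [hf, X_mul_monomial, hg, hg]
          have : (Polynomial.monomial (i+1) a) • m = (Polynomial.monomial i a) • φ m := by
            rw [← X_mul_monomial, mul_comm, mul_smul]; rfl
          rw [this]; abel
  have hinj : Function.Injective f := by
    rw [injective_iff_map_eq_zero]
    intro t ht
    let e := PolynomialModule.polynomialTensorProductLEquivPolynomialModule (R := R) (M := M)
    have he : ∀ p m, e (p ⊗ₜ m) = p • PolynomialModule.single R 0 m := fun p m => rfl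
    have key : ∀ n, ∀ t, (e (f t)).coeff (n+1) = (e t).coeff n - φ ((e t).coeff (n+1)) := by
      intro n t
      induction t with
      | zero => simp
      | add x y hx hy => simp only [map_add, PolynomialModule.coeff_add, Finsupp.add_apply, hx, hy]; abel
      | tmul p m => 
        rw [hf, map_sub, he, he, he]
        have hsub : ∀ a b : PolynomialModule R M, (a - b).coeff = a.coeff - b.coeff :=
          fun a b => rfl
        rw [hsub, Finsupp.sub_apply]
        simp
    have z : ∀ n, (e t).coeff n = φ ((e t).coeff (n+1)) := by
      intro n
      have := key n t
      rw [ht] at this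
      simp at this
      exact (sub_eq_zero.1 this.symm)
    have z2 : ∀ k n, (e t).coeff (n + k) = 0 → (e t).coeff n = 0 := by
      intro k
      induction k with
      | zero => intro n h; exact h
      | succ k ih => intro n h; apply ih; rw [z, add_assoc, h, map_zero]
    have : e t = 0 := by
      apply PolynomialModule.coeff_injective
      ext n
      obtain ⟨N, hN⟩ : ∃ N, ∀ m ≥ N, (e t).coeff m = 0 := by
        refine ⟨(e t).coeff.support.sup id + 1, fun m hm => ?_⟩
        by_contra hne
        have := Finset.le_sup (f := id) (Finsupp.mem_support_iff.2 hne)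
        simp at this
        omega
      exact z2 N n (hN _ (by omega))
    exact e.map_eq_zero_iff.1 this
  refine (pd_step f g hinj (fun m => ⟨1 ⊗ₜ m, by simp [hg]⟩) ?_ 0).2 (pd_zero.2 inferInstance)
  intro t
  constructor
  · intro h
    have := hr t
    rw [h, tmul_zero, sub_zero] at this
    exact this
  · rintro ⟨s, rfl⟩
    exact hgf s

lemma pd_poly (k : ℕ) : ∀ (M : Type u) [AddCommGroup M] [Module R M] [Module R[X] M]
    [IsScalarTower R R[X] M], PD R M k → PD R[X] M (k+1) := by
  induction k with
  | zero =>
    intro M _ _ _ _ h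
    have := pd_zero.1 h
    exact pd_poly_zero M
  | succ k ih =>
    intro M _ _ _ _ h
    refine (pd_cov (k+1)).2 (ih _ ?_)
    have := proj_finsupp (S := R) (B := R[X]) M
    exact (pd_step ((LinearMap.ker (cov R[X] M)).subtype.restrictScalars R)
      ((cov R[X] M).restrictScalars R) (Submodule.subtype_injective _) cov_surj
      (ker_exact (cov R[X] M)) k).1 h

end poly
end CLi


namespace CLi
universe u

lemma pd_transfer {R R' : Type u} [CommRing R] [CommRing R'] (e : R ≃+* R') (M : Type u)
    [AddCommGroup M] [Module R M] [Module R' M] (he : ∀ (r : R) (m : M), e r • m = r • m) {k : ℕ}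
    (h : PD R M k) : PD R' M k := by
  letI : Algebra R' R := e.symm.toRingHom.toAlgebra
  have h1 : ∀ (r : R') (x : R), r • x = e.symm r * x := fun r x => rfl
  have : Module.Projective R' R := by
    refine Module.Projective.of_equiv' (M := R') 
      ({ e.symm.toAddEquiv with map_smul' := fun r x => ?_ } : R' ≃ₗ[R'] R)
    simp [h1]
  have : IsScalarTower R' R M := ⟨fun r x m => by 
    rw [h1, mul_smul, ← he (e.symm r), e.apply_symm_apply]⟩
  exact pd_restrict (B := R) k M h

lemma pd_mv (A : Type u) [CommRing A] : ∀ (p : ℕ) (M : Type u) [AddCommGroup M] [Module A M]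
    [Module (MvPolynomial (Fin p) A) M] [IsScalarTower A (MvPolynomial (Fin p) A) M]
    [Module.Projective A M], PD (MvPolynomial (Fin p) A) M p := by
  intro p
  induction p with
  | zero =>
    intro M _ _ _ _ _
    refine pd_transfer (isEmptyAlgEquiv A (Fin 0)).symm.toRingEquiv M ?_ (pd_zero.2 ‹_›)
    intro r m
    have : (isEmptyAlgEquiv A (Fin 0)).symm.toRingEquiv r = algebraMap A _ r := rfl
    rw [this, algebraMap_smul]
  | succ p ih =>
    intro M _ _ _ _ _
    let e := finSuccEquiv A p
    letI : Module (Polynomial (MvPolynomial (Fin p) A)) M := Module.compHom M e.symm.toRingEquiv.toRingHom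
    have h1 : ∀ (q : Polynomial (MvPolynomial (Fin p) A)) (m : M), q • m = e.symm q • m := fun _ _ => rfl
    letI : Module (MvPolynomial (Fin p) A) M := Module.compHom M 
      (Polynomial.C : MvPolynomial (Fin p) A →+* _)
    have h2 : ∀ (q : MvPolynomial (Fin p) A) (m : M), q • m = Polynomial.C q • m := fun _ _ => rfl
    have : IsScalarTower (MvPolynomial (Fin p) A) (Polynomial (MvPolynomial (Fin p) A)) M :=
      ⟨fun a b m => by rw [h2, Polynomial.smul_eq_C_mul, mul_smul]⟩
    have : IsScalarTower A (MvPolynomial (Fin p) A) M :=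
      ⟨fun a b m => by
        rw [h2, h2, h1, h1, ← Polynomial.smul_C, map_smul, smul_assoc]⟩
    refine pd_transfer e.symm.toRingEquiv M (fun r m => rfl) (pd_poly p M (ih M))

end CLi


namespace CLi
universe u
section low
open RingTheory.Sequence TensorProduct
variable {R : Type u} [CommRing R]

lemma wr_flat {rs : List R} (h : IsWeaklyRegular R rs) (P : Type u) [AddCommGroup P] [Module R P]
    [Module.Flat R P] : IsWeaklyRegular P rs := by
  rw [isWeaklyRegular_iff] at h ⊢
  intro i hi
  have h1 := h i hi
  rw [smul_eq_mul, Ideal.mul_top] at h1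
  have h2 : IsSMulRegular ((R ⧸ Ideal.ofList (rs.take i)) ⊗[R] P) rs[i] := h1.rTensor _
  exact ((TensorProduct.quotTensorEquivQuotSMul P (Ideal.ofList (rs.take i))).isSMulRegular_congr _).1 h2

lemma wr_mem {M : Type u} [AddCommGroup M] [Module R M] {rs : List R} (h : IsWeaklyRegular M rs)
    (i : ℕ) (hi : i < rs.length) (m : M) (hm : rs[i] • m ∈ (Ideal.ofList (rs.take i) • ⊤ : Submodule R M)) :
    m ∈ (Ideal.ofList (rs.take i) • ⊤ : Submodule R M) := by
  have h1 := (isWeaklyRegular_iff _ _).1 h i hi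
  rw [← Submodule.Quotient.mk_eq_zero] at hm ⊢
  apply h1
  simpa using hm

lemma wr_inj {M N P : Type u} [AddCommGroup M] [Module R M] [AddCommGroup N] [Module R N]
    [AddCommGroup P] [Module R P] (f : N →ₗ[R] P) (g : P →ₗ[R] M) (hf : Function.Injective f)
    (hg : Function.Surjective g) (h : Function.Exact f g) {rs : List R} (hM : IsWeaklyRegular M rs)
    (n : N) (hn : f n ∈ (Ideal.ofList rs • ⊤ : Submodule R P)) :
    n ∈ (Ideal.ofList rs • ⊤ : Submodule R N) := by
  have h0 : Function.Exact (0 : PUnit.{u+1} →ₗ[R] N) f := by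
    intro x
    constructor
    · intro hx
      exact ⟨0, by rw [hf (hx.trans f.map_zero.symm)]; rfl⟩
    · rintro ⟨y, rfl⟩; simp
  have := map_first_exact_on_four_term_right_exact_of_isSMulRegular_last h0 h hg hM
  have h2 := (this (Submodule.Quotient.mk n)).1 (by
    rw [Submodule.mapQ_apply, Submodule.Quotient.mk_eq_zero]; exact hn)
  obtain ⟨y, hy⟩ := h2
  obtain ⟨y, rfl⟩ := Submodule.Quotient.mk_surjective _ y
  rw [Submodule.mapQ_apply, LinearMap.zero_apply] at hy
  rw [← Submodule.Quotient.mk_eq_zero, ← hy]; rfl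

lemma map_smul_top_mem {N P : Type u} [AddCommGroup N] [Module R N]
    [AddCommGroup P] [Module R P] (f : N →ₗ[R] P) (I : Ideal R) (n : N)
    (hn : n ∈ (I • ⊤ : Submodule R N)) : f n ∈ (I • ⊤ : Submodule R P) :=
  Submodule.smul_top_le_comap_smul_top I f hn

lemma lift_smul_top_mem {P M : Type u} [AddCommGroup M] [Module R M]
    [AddCommGroup P] [Module R P] (g : P →ₗ[R] M) (hg : Function.Surjective g) (I : Ideal R) (m : M)
    (hn : m ∈ (I • ⊤ : Submodule R M)) : ∃ q ∈ (I • ⊤ : Submodule R P), g q = m := by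
  have : (I • ⊤ : Submodule R M) = (I • ⊤ : Submodule R P).map g := by
    rw [Submodule.map_smul'', Submodule.map_top, LinearMap.range_eq_top.2 hg]
  rw [this] at hn
  exact hn

lemma low_step (k : ℕ) {M N F : Type u} [AddCommGroup M] [Module R M] [AddCommGroup N] [Module R N]
    [AddCommGroup F] [Module R F] (f : N →ₗ[R] F) (g : F →ₗ[R] M) (fi : Function.Injective f)
    (gs : Function.Surjective g) (fg : Function.Exact f g)
    (ih : ∀ (ys zs : List R), IsWeaklyRegular R (ys ++ zs) → IsWeaklyRegular N ys →
    ∀ m : N, m ∉ (Ideal.ofList ys • ⊤ : Submodule R N) →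
      (∀ z ∈ zs, z • m ∈ (Ideal.ofList ys • ⊤ : Submodule R N)) → zs.length ≤ k)
    (ys : List R) (z : R) (zs : List R) (hR : IsWeaklyRegular R (ys ++ z :: zs))
    (hF : IsWeaklyRegular F (ys ++ z :: zs)) (hM : IsWeaklyRegular M ys) (q : F)
    (hm : g q ∉ (Ideal.ofList ys • ⊤ : Submodule R M))
    (hz : ∀ z' ∈ z :: zs, z' • g q ∈ (Ideal.ofList ys • ⊤ : Submodule R M)) : zs.length ≤ k := by
  have lift : ∀ z' ∈ z :: zs, ∃ n : N, z' • q - f n ∈ (Ideal.ofList ys • ⊤ : Submodule R F) := by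
    intro z' hz'
    have h1 := hz z' hz'
    obtain ⟨a, ha, hga⟩ := lift_smul_top_mem g gs _ _ h1
    obtain ⟨n, hn⟩ := (fg (z' • q - a)).1 (by rw [map_sub, map_smul, hga, sub_self])
    refine ⟨n, ?_⟩
    rw [hn]; simpa using ha
  obtain ⟨x, hx⟩ := lift z (by simp)
  have hle : Ideal.ofList ys ≤ Ideal.ofList (ys ++ [z]) := by
    rw [Ideal.ofList_append]; exact le_sup_left
  have hadd : ∀ (w : N), w ∈ (Ideal.ofList (ys ++ [z]) • ⊤ : Submodule R (N)) →
      ∃ n, w - z • n ∈ (Ideal.ofList ys • ⊤ : Submodule R (N)) := by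
    intro w hw
    rw [Ideal.ofList_append, Submodule.sup_smul, Ideal.ofList_singleton] at hw
    obtain ⟨a, ha, b, hb, rfl⟩ := Submodule.mem_sup.1 hw
    rw [Submodule.ideal_span_singleton_smul] at hb
    obtain ⟨n, -, rfl⟩ := Submodule.mem_smul_pointwise_iff_exists _ _ _ |>.1 hb
    exact ⟨n, by rwa [add_sub_cancel_right]⟩
  have zF : ∀ a : F, z • a ∈ (Ideal.ofList ys • ⊤ : Submodule R F) → a ∈ (Ideal.ofList ys • ⊤ : Submodule R F) := by
    intro a ha
    have h1 := wr_mem hF ys.length (by simp) a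
    simp at h1
    exact h1 ha
  have key := ih (ys ++ [z]) zs (by simpa using hR) ?_ x ?_ ?_
  · exact key
  · rw [isWeaklyRegular_iff]
    intro i hi
    have hi' : i ≤ ys.length := by simp at hi; omega
    have e1 : (ys ++ [z]).take i = ys.take i := by
      rw [List.take_append_of_le_length hi']
    have e2 : (ys ++ z :: zs).take i = ys.take i := by
      rw [List.take_append_of_le_length hi']
    have e3 : (ys ++ [z])[i] = (ys ++ z :: zs)[i]'(by simp; omega) := by
      rcases hi'.lt_or_eq with h | h
      · rw [List.getElem_append_left h, List.getElem_append_left h]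
      · subst h; simp
    have hMi : IsWeaklyRegular M (ys.take i) := by
      have := hM
      rw [← List.take_append_drop i ys, isWeaklyRegular_append_iff] at this
      exact this.1
    rw [isSMulRegular_iff_right_eq_zero_of_smul]
    intro w hw
    obtain ⟨w, rfl⟩ := Submodule.Quotient.mk_surjective _ w
    rw [← Submodule.Quotient.mk_smul, Submodule.Quotient.mk_eq_zero] at hw
    rw [Submodule.Quotient.mk_eq_zero]
    rw [e1] at hw ⊢
    apply wr_inj f g fi gs fg hMi
    have h5 := map_smul_top_mem f _ _ hw
    have h6 := wr_mem hF i (by simp; omega) (f w)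
    rw [e2] at h6
    apply h6
    rw [← e3, ← map_smul]
    exact h5
  · intro hx2
    obtain ⟨n, hn⟩ := hadd x hx2
    apply hm
    have h1 := Submodule.add_mem _ hx (map_smul_top_mem f _ _ hn)
    have h2 : z • (q - f n) ∈ (Ideal.ofList ys • ⊤ : Submodule R F) := by
      convert h1 using 1
      rw [map_sub, map_smul, smul_sub]; abel
    have h3 := map_smul_top_mem g _ _ (zF _ h2)
    rw [map_sub] at h3
    rwa [fg.apply_apply_eq_zero, sub_zero] at h3
  · intro z' hz'
    obtain ⟨n, hn⟩ := lift z' (by simp [hz'])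
    have h1 : z' • x - z • n ∈ (Ideal.ofList ys • ⊤ : Submodule R (N)) := by
      apply wr_inj f g fi gs fg hM
      have := Submodule.sub_mem _ (Submodule.smul_mem _ z hn) (Submodule.smul_mem _ z' hx)
      convert this using 1
      rw [map_sub, map_smul, map_smul, smul_sub, smul_sub, smul_comm z z' q]; abel
    have h2 : z • n ∈ (Ideal.ofList (ys ++ [z]) • ⊤ : Submodule R (N)) := by
      refine Submodule.smul_mem_smul ?_ Submodule.mem_top
      rw [Ideal.ofList_append, Ideal.ofList_singleton]
      exact Ideal.mem_sup_right (Ideal.mem_span_singleton_self z)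
    have h3 := Submodule.add_mem _ (Submodule.smul_mono_left hle h1) h2
    simpa using h3

lemma low_bound (k : ℕ) : ∀ (M : Type u) [AddCommGroup M] [Module R M] (ys zs : List R),
    PD R M k → IsWeaklyRegular R (ys ++ zs) → IsWeaklyRegular M ys →
    ∀ m : M, m ∉ (Ideal.ofList ys • ⊤ : Submodule R M) →
      (∀ z ∈ zs, z • m ∈ (Ideal.ofList ys • ⊤ : Submodule R M)) → zs.length ≤ k := by
  induction k with
  | zero =>
    intro M _ _ ys zs hpd hR hM m hm hz
    rcases zs with _ | ⟨z, zs⟩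
    · simp
    exfalso
    have := pd_zero.1 hpd
    have h1 := wr_mem (wr_flat hR M) ys.length (by simp) m
    simp at h1
    exact hm (h1 (hz z (by simp)))
  | succ k ih =>
    intro M _ _ ys zs hpd hR hM m hm hz
    rcases zs with _ | ⟨z, zs⟩
    · simp
    have hN := (pd_cov k).1 hpd
    have hF : IsWeaklyRegular (M →₀ R) (ys ++ z :: zs) := wr_flat hR _
    obtain ⟨q, rfl⟩ := cov_surj (R := R) m
    have := low_step k (LinearMap.ker (cov R M)).subtype (cov R M) (Submodule.subtype_injective _)
      cov_surj (ker_exact _) (fun ys zs => ih _ ys zs hN) ys z zs hR hF hM q hm hz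
    simpa using this

end low
end CLi


namespace CLi
universe u
section reg
open RingTheory.Sequence
variable {R : Type u} [CommRing R]

def RegL : Ideal R → List R → Prop
  | _, [] => True
  | Q, y :: l => (∀ f, y * f ∈ Q → f ∈ Q) ∧ RegL (Q ⊔ Ideal.span {y}) l

lemma RegL.get {l : List R} : ∀ {Q : Ideal R}, RegL Q l → ∀ i (hi : i < l.length) f,
    l[i] * f ∈ Q ⊔ Ideal.ofList (l.take i) → f ∈ Q ⊔ Ideal.ofList (l.take i) := by
  induction l with
  | nil => intro Q _ i hi; simp at hi
  | cons y l ih =>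
    intro Q h i hi f hf
    rcases i with _ | i
    · simp only [List.take_zero, Ideal.ofList_nil, sup_bot_eq] at hf ⊢
      exact h.1 f (by simpa using hf)
    · simp only [List.take_succ_cons, Ideal.ofList_cons, ← sup_assoc] at hf ⊢
      exact ih h.2 i (by simpa using hi) f (by simpa using hf)

lemma mk_mem_smul (Q I : Ideal R) (x : R) :
    (Ideal.Quotient.mk Q x : R ⧸ Q) ∈ (I • ⊤ : Submodule R (R ⧸ Q)) ↔ x ∈ Q ⊔ I := by
  have h1 : (I • ⊤ : Submodule R (R ⧸ Q)) = Submodule.map (Submodule.mkQ Q) I := by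
    have : (⊤ : Submodule R (R ⧸ Q)) = Submodule.map (Submodule.mkQ Q) ⊤ := by
      rw [Submodule.map_top, Submodule.range_mkQ]
    rw [this, ← Submodule.map_smul'', smul_eq_mul, Ideal.mul_top]
  rw [h1, sup_comm]
  have h2 : x ∈ Submodule.comap (Submodule.mkQ Q) (Submodule.map (Submodule.mkQ Q) I) ↔ x ∈ I ⊔ Q := by
    rw [Submodule.comap_map_eq, Submodule.ker_mkQ]
  exact h2

lemma RegL.wr {Q : Ideal R} {l : List R} (h : RegL Q l) : IsWeaklyRegular (R ⧸ Q) l := by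
  rw [isWeaklyRegular_iff]
  intro i hi
  rw [isSMulRegular_iff_right_eq_zero_of_smul]
  intro m hm
  obtain ⟨m, rfl⟩ := Submodule.mkQ_surjective _ m
  obtain ⟨x, rfl⟩ := Ideal.Quotient.mk_surjective m
  rw [← map_smul] at hm
  simp only [Submodule.mkQ_apply, Submodule.Quotient.mk_eq_zero] at hm ⊢
  rw [mk_mem_smul]
  apply h.get i hi
  rw [← mk_mem_smul]
  simpa [Algebra.smul_def] using hm

lemma RegL.wr_bot {l : List R} (h : RegL (⊥ : Ideal R) l) : IsWeaklyRegular R l := by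
  have h1 := h.wr
  exact ((Submodule.quotEquivOfEqBot (⊥ : Submodule R R) rfl).isWeaklyRegular_congr l).1 h1

lemma RegL.map {R' : Type*} [CommRing R'] (e : R ≃+* R') {l : List R} : ∀ {Q : Ideal R}, RegL Q l →
    RegL (Q.map (e : R →+* R')) (l.map e) := by
  induction l with
  | nil => intros; trivial
  | cons y l ih =>
    intro Q h
    refine ⟨?_, ?_⟩
    · intro f hf
      obtain ⟨f, rfl⟩ := e.surjective f
      have : e y * e f = (e : R →+* R') (y * f) := by simp
      rw [this] at hf
      have h2 : y * f ∈ Q := by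
        obtain ⟨q, hq, h3⟩ := (Ideal.mem_map_iff_of_surjective (e : R →+* R') e.surjective).1 hf
        have := e.injective h3
        rwa [← this]
      exact Ideal.mem_map_of_mem (e : R →+* R') (h.1 f h2)
    · have := ih h.2
      rw [Ideal.map_sup, Ideal.map_span, Set.image_singleton] at this
      exact this

lemma RegL_X {σ : Type*} {L : Type*} [Field L] (l : List σ) : ∀ (s : Set σ), l.Nodup →
    (∀ j ∈ l, j ∉ s) → RegL (Ideal.span ((X : σ → MvPolynomial σ L) '' s)) (l.map X) := by
  classical
  induction l with
  | nil => intros; trivial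
  | cons j l ih =>
    intro s hn hs
    refine ⟨?_, ?_⟩
    · intro f hf
      rw [mem_ideal_span_X_image] at hf ⊢
      intro m hm
      obtain ⟨i, hi, hmi⟩ := hf (Finsupp.single j 1 + m) (by
        rw [mem_support_iff, coeff_X_mul]; exact mem_support_iff.1 hm)
      refine ⟨i, hi, ?_⟩
      have : j ≠ i := fun h => hs j (by simp) (h ▸ hi)
      simpa [Finsupp.single_apply, this] using hmi
    · have := ih (insert j s) (List.nodup_cons.1 hn).2 (by
        intro k hk h
        rcases h with rfl | h
        · exact (List.nodup_cons.1 hn).1 hk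
        · exact hs k (by simp [hk]) h)
      rw [Set.image_insert_eq, Ideal.span_insert, sup_comm] at this
      exact this
end reg

section hom
variable {n : ℕ} {L : Type*} [Field L]

def Hg (Q : Ideal (MvPolynomial (Fin n) L)) : Prop := ∀ f ∈ Q, ∀ d, homogeneousComponent d f ∈ Q

lemma comp_mul {k : ℕ} {y : MvPolynomial (Fin n) L} (hy : y ∈ homogeneousSubmodule (Fin n) L k)
    (h : MvPolynomial (Fin n) L) (d : ℕ) :
    homogeneousComponent (k + d) (y * h) = y * homogeneousComponent d h := by
  conv_lhs => rw [← sum_homogeneousComponent h, Finset.mul_sum, map_sum]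
  have h1 : ∀ i, homogeneousComponent (k + d) (y * homogeneousComponent i h) =
      if i = d then y * homogeneousComponent i h else 0 := by
    intro i
    rw [homogeneousComponent_of_mem (hom_mul hy (homogeneousComponent_mem i h))]
    simp [eq_comm]
  simp only [h1]
  rw [Finset.sum_ite_eq']
  split_ifs with h2
  · rfl
  · rw [homogeneousComponent_eq_zero, mul_zero]
    simpa using h2

lemma comp_mul_lt {k : ℕ} {y : MvPolynomial (Fin n) L} (hy : y ∈ homogeneousSubmodule (Fin n) L k)
    (h : MvPolynomial (Fin n) L) (d : ℕ) (hd : d < k) :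
    homogeneousComponent d (y * h) = 0 := by
  conv_lhs => rw [← sum_homogeneousComponent h, Finset.mul_sum, map_sum]
  apply Finset.sum_eq_zero
  intro i _
  rw [homogeneousComponent_of_mem (hom_mul hy (homogeneousComponent_mem i h)), if_neg (by omega)]

lemma comp_mem_span {k : ℕ} {y : MvPolynomial (Fin n) L} (hy : y ∈ homogeneousSubmodule (Fin n) L k)
    (f) (hf : f ∈ Ideal.span {y}) (d : ℕ) : homogeneousComponent d f ∈ Ideal.span {y} := by
  obtain ⟨h, rfl⟩ := Ideal.mem_span_singleton'.1 hf
  rw [mul_comm]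
  rcases lt_or_ge d k with h1 | h1
  · rw [comp_mul_lt hy h d h1]; exact zero_mem _
  · obtain ⟨e, rfl⟩ := Nat.exists_eq_add_of_le h1
    rw [comp_mul hy]
    exact Ideal.mul_mem_right _ _ (Ideal.mem_span_singleton_self y)

lemma Hg.iSup {ι : Sort*} {Q : ι → Ideal (MvPolynomial (Fin n) L)} (h : ∀ i, Hg (Q i)) : Hg (⨆ i, Q i) := by
  intro f hf d
  induction hf using Submodule.iSup_induction' with
  | mem i x hx => exact Ideal.mem_iSup_of_mem i (h i x hx d)
  | zero => simp
  | add x y _ _ hx hy => rw [map_add]; exact add_mem hx hy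

lemma Hg.sup {P Q : Ideal (MvPolynomial (Fin n) L)} (hP : Hg P) (hQ : Hg Q) : Hg (P ⊔ Q) := by
  intro f hf d
  obtain ⟨p, hp, q, hq, rfl⟩ := Submodule.mem_sup.1 hf
  rw [map_add]
  exact add_mem (Ideal.mem_sup_left (hP p hp d)) (Ideal.mem_sup_right (hQ q hq d))

lemma Hg.span {s : Set (MvPolynomial (Fin n) L)} (hs : ∀ y ∈ s, ∃ k, y ∈ homogeneousSubmodule (Fin n) L k) :
    Hg (Ideal.span s) := by
  rw [← Set.biUnion_of_singleton s, Ideal.span_iUnion]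
  apply Hg.iSup; intro y
  rw [Ideal.span_iUnion]
  apply Hg.iSup; intro hy
  obtain ⟨k, hk⟩ := hs y hy
  exact comp_mem_span hk

end hom
end CLi


namespace CLi
section bas
variable {n : ℕ} {L : Type*} [Field L]

def Bas {ι : Type*} (Q : Ideal (MvPolynomial (Fin n) L)) (N : ι → MvPolynomial (Fin n) L) : Prop :=
  (∀ k, ∃ d, N k ∈ homogeneousSubmodule (Fin n) L d) ∧
  (∀ c : ι →₀ L, Finsupp.linearCombination L N c ∈ Q → c = 0) ∧
  ∀ f, ∃ w ∈ Submodule.span L (Set.range N), f - w ∈ Q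

lemma Bas.reindex {ι κ : Type*} {Q : Ideal (MvPolynomial (Fin n) L)} {N : ι → MvPolynomial (Fin n) L}
    (h : Bas Q N) (e : κ ≃ ι) : Bas Q (N ∘ e) := by
  refine ⟨fun k => h.1 _, ?_, ?_⟩
  · intro c hc
    have := h.2.1 (Finsupp.equivMapDomain e c) (by
      rw [Finsupp.linearCombination_equivMapDomain]; exact hc)
    ext k
    have h2 := DFunLike.congr_fun this (e k)
    simpa using h2
  · rw [EquivLike.range_comp]; exact h.2.2

lemma span_comp {ι : Type*} {N : ι → MvPolynomial (Fin n) L}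
    (h : ∀ k, ∃ d, N k ∈ homogeneousSubmodule (Fin n) L d) {w} (hw : w ∈ Submodule.span L (Set.range N))
    (d : ℕ) : homogeneousComponent d w ∈ Submodule.span L (Set.range N) := by
  induction hw using Submodule.span_induction with
  | mem x hx =>
    obtain ⟨k, rfl⟩ := hx
    obtain ⟨e, he⟩ := h k
    rw [homogeneousComponent_of_mem he]
    split_ifs
    · exact Submodule.subset_span ⟨k, rfl⟩
    · exact zero_mem _
  | zero => simp
  | add x y _ _ hx hy => rw [map_add]; exact add_mem hx hy
  | smul a x _ hx => rw [map_smul]; exact Submodule.smul_mem _ _ hx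

lemma Bas.step {ι : Type*} {Q : Ideal (MvPolynomial (Fin n) L)} (hQ : Hg Q) {y : MvPolynomial (Fin n) L}
    (hy : y ∈ homogeneousSubmodule (Fin n) L 1) (hr : ∀ f, y * f ∈ Q → f ∈ Q)
    {N : ι → MvPolynomial (Fin n) L} (h : Bas (Q ⊔ Ideal.span {y}) N) :
    Bas Q (fun ik : ℕ × ι => y ^ ik.1 * N ik.2) := by
  classical
  refine ⟨?_, ?_, ?_⟩
  · rintro ⟨i, k⟩
    obtain ⟨d, hd⟩ := h.1 k
    refine ⟨i + d, ?_⟩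
    rw [mem_homogeneousSubmodule] at *
    have := (hy.pow i).mul hd
    simpa using this
  · have key : ∀ m (c : ℕ → ι →₀ L), ∑ i ∈ Finset.range m, y ^ i * Finsupp.linearCombination L N (c i) ∈ Q →
        ∀ i < m, c i = 0 := by
      intro m
      induction m with
      | zero => intro c _ i hi; omega
      | succ m ih =>
        intro c hc
        rw [Finset.sum_range_succ'] at hc
        have h1 : ∑ i ∈ Finset.range m, y ^ (i+1) * Finsupp.linearCombination L N (c (i+1)) =
            y * ∑ i ∈ Finset.range m, y ^ i * Finsupp.linearCombination L N (c (i+1)) := by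
          rw [Finset.mul_sum]; refine Finset.sum_congr rfl fun i _ => by ring
        rw [h1] at hc
        have h0 : c 0 = 0 := by
          apply h.2.1
          have h2 := sub_mem (Ideal.mem_sup_left (T := Ideal.span {y}) hc)
            (Ideal.mem_sup_right (Ideal.mul_mem_right (∑ i ∈ Finset.range m, y ^ i * Finsupp.linearCombination L N (c (i+1))) _ (Ideal.mem_span_singleton_self y)))
          simpa using h2
        rw [h0] at hc
        simp only [map_zero, mul_zero, add_zero] at hc
        have h3 := ih (fun i => c (i+1)) (hr _ hc)
        intro i hi
        rcases i with _ | i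
        · exact h0
        · exact h3 i (by omega)
    intro c hc
    obtain ⟨m, hm⟩ : ∃ m, ∀ i ∈ c.curry.support, i < m :=
      ⟨c.curry.support.sup id + 1, fun i hi => Nat.lt_succ_of_le (Finset.le_sup (f := id) hi)⟩
    have h1 : Finsupp.linearCombination L (fun ik : ℕ × ι => y ^ ik.1 * N ik.2) c =
        ∑ i ∈ Finset.range m, y ^ i * Finsupp.linearCombination L N (c.curry i) := by
      have h2 : Finsupp.linearCombination L (fun ik : ℕ × ι => y ^ ik.1 * N ik.2) c =
          c.curry.sum fun i f => y ^ i * Finsupp.linearCombination L N f := by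
        rw [Finsupp.linearCombination_apply]
        rw [← Finsupp.sum_curry_index c (fun i k a => a • (y ^ i * N k))]
        · refine Finsupp.sum_congr fun i _ => ?_
          rw [Finsupp.linearCombination_apply, Finsupp.mul_sum]
          refine Finsupp.sum_congr fun k _ => ?_
          rw [mul_smul_comm]
      rw [h2, Finsupp.sum_of_support_subset _ (s := Finset.range m)]
      · intro i hi; simpa using hm i hi
      · simp
    rw [h1] at hc
    have h2 := key m _ hc
    have h3 : ∀ i, c.curry i = 0 := by
      intro i
      by_contra h4
      exact h4 (h2 i (hm i (Finsupp.mem_support_iff.2 h4)))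
    ext ⟨i, k⟩
    have := DFunLike.congr_fun (h3 i) k
    simpa using this
  · set V := Submodule.span L (Set.range (fun ik : ℕ × ι => y ^ ik.1 * N ik.2)) with hV
    have hNV : Submodule.span L (Set.range N) ≤ V := by
      rw [Submodule.span_le]
      rintro _ ⟨k, rfl⟩
      exact Submodule.subset_span ⟨(0, k), by simp⟩
    have hyV : ∀ v ∈ V, y * v ∈ V := by
      intro v hv
      induction hv using Submodule.span_induction with
      | mem x hx =>
        obtain ⟨⟨i, k⟩, rfl⟩ := hx
        exact Submodule.subset_span ⟨(i+1, k), by simp; ring⟩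
      | zero => simp
      | add x y _ _ hx hy => rw [mul_add]; exact add_mem hx hy
      | smul a x _ hx => rw [mul_smul_comm]; exact Submodule.smul_mem _ _ hx
    have key : ∀ d f, f ∈ homogeneousSubmodule (Fin n) L d → ∃ w ∈ V, f - w ∈ Q := by
      intro d
      induction d with
      | zero =>
        intro f hf
        obtain ⟨w, hw, h1⟩ := h.2.2 f
        obtain ⟨q, hq, r, hr', h2⟩ := Submodule.mem_sup.1 h1
        obtain ⟨b, rfl⟩ := Ideal.mem_span_singleton'.1 hr'
        refine ⟨homogeneousComponent 0 w, hNV (span_comp h.1 hw 0), ?_⟩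
        have h3 := congrArg (homogeneousComponent 0) h2
        rw [map_add, map_sub, mul_comm b y, comp_mul_lt hy _ _ (by omega), add_zero,
          homogeneousComponent_of_mem hf, if_pos rfl] at h3
        rw [← h3]; exact hQ q hq 0
      | succ d ih =>
        intro f hf
        obtain ⟨w, hw, h1⟩ := h.2.2 f
        obtain ⟨q, hq, r, hr', h2⟩ := Submodule.mem_sup.1 h1
        obtain ⟨b, rfl⟩ := Ideal.mem_span_singleton'.1 hr'
        obtain ⟨v, hv, h4⟩ := ih (homogeneousComponent d b) (homogeneousComponent_mem d b)
        refine ⟨homogeneousComponent (d+1) w + y * v,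
          add_mem (hNV (span_comp h.1 hw _)) (hyV v hv), ?_⟩
        have h3 := congrArg (homogeneousComponent (1+d)) h2
        rw [map_add, map_sub, mul_comm b y, comp_mul hy, add_comm 1 d,
          homogeneousComponent_of_mem hf, if_pos rfl] at h3
        have h5 : f - (homogeneousComponent (d+1) w + y * v) =
          homogeneousComponent (d+1) q + y * (homogeneousComponent d b - v) := by
          linear_combination -h3
        rw [h5]; exact add_mem (hQ q hq _) (Ideal.mul_mem_left _ _ h4)
    intro f
    choose w hw h1 using fun d => key d _ (homogeneousComponent_mem d f)
    refine ⟨∑ i ∈ Finset.range (f.totalDegree + 1), w i, sum_mem fun i _ => hw i, ?_⟩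
    nth_rewrite 1 [← sum_homogeneousComponent f]
    rw [← Finset.sum_sub_distrib]
    exact sum_mem fun i _ => h1 i

lemma Bas.all {ι : Type*} {N : ι → MvPolynomial (Fin n) L} (s : ℕ) : ∀ (Q : Ideal (MvPolynomial (Fin n) L))
    (y : Fin s → MvPolynomial (Fin n) L),
    Hg Q → (∀ i, y i ∈ homogeneousSubmodule (Fin n) L 1) → RegL Q (List.ofFn y) →
    Bas (Q ⊔ Ideal.span (Set.range y)) N →
    Bas Q (fun ak : (Fin s →₀ ℕ) × ι => (∏ i, y i ^ ak.1 i) * N ak.2) := by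
  induction s with
  | zero =>
    intro Q y hQ hy hr h
    have h0 : Set.range y = ∅ := Set.range_eq_empty y
    rw [h0, Ideal.span_empty, sup_bot_eq] at h
    have := h.reindex (Equiv.uniqueProd ι (Fin 0 →₀ ℕ))
    convert this using 2
    simp
  | succ s ih =>
    intro Q y hQ hy hr h
    rw [List.ofFn_succ] at hr
    have h1 := ih (Q ⊔ Ideal.span {y 0}) (fun i => y i.succ)
      (hQ.sup (Hg.span (by rintro z rfl; exact ⟨1, hy 0⟩))) (fun i => hy _) hr.2 (by
        rw [sup_assoc, ← Ideal.span_union]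
        convert h using 3
        ext z
        simp [Fin.exists_fin_succ, eq_comm])
    have h2 := Bas.step hQ (hy 0) hr.1 h1
    let e : (Fin (s+1) →₀ ℕ) × ι ≃ ℕ × ((Fin s →₀ ℕ) × ι) :=
      { toFun := fun ak => (ak.1 0, (ak.1.tail, ak.2))
        invFun := fun x => (Finsupp.cons x.1 x.2.1, x.2.2)
        left_inv := fun x => by simp
        right_inv := fun x => by simp }
    convert h2.reindex e using 2 with x
    simp only [e, Fin.prod_univ_succ, mul_assoc, Function.comp, Equiv.coe_fn_mk, Finsupp.tail_apply]

lemma exists_bas (Q : Ideal (MvPolynomial (Fin n) L)) :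
    ∃ (ι : Type) (N : ι → MvPolynomial (Fin n) L), Bas Q N := by
  let v : (Fin n →₀ ℕ) → (MvPolynomial (Fin n) L ⧸ Q) := fun m => Ideal.Quotient.mkₐ L Q (monomial m 1)
  obtain ⟨κ, a, _, hsp, hli⟩ := exists_linearIndependent' L v
  have hva : v ∘ a = (Ideal.Quotient.mkₐ L Q).toLinearMap ∘ (fun k => monomial (a k) (1 : L)) := rfl
  refine ⟨κ, fun k => monomial (a k) 1, ?_, ?_, ?_⟩
  · exact fun k => ⟨_, isHomogeneous_monomial 1 rfl⟩
  · intro c hc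
    rw [linearIndependent_iff] at hli
    apply hli
    rw [hva, ← Finsupp.apply_linearCombination]
    exact Ideal.Quotient.eq_zero_iff_mem.2 hc
  · intro f
    have h1 : (Ideal.Quotient.mkₐ L Q).toLinearMap f ∈ Submodule.span L (Set.range v) := by
      have h2 : Set.range v = (Ideal.Quotient.mkₐ L Q).toLinearMap '' Set.range (fun m => monomial m (1 : L)) := by
        rw [← Set.range_comp]; rfl
      rw [h2, ← Submodule.map_span]
      refine Submodule.mem_map_of_mem ?_
      have := (basisMonomials (Fin n) L).span_eq
      rw [coe_basisMonomials] at this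
      rw [this]; trivial
    rw [← hsp, hva, Set.range_comp, ← Submodule.map_span] at h1
    obtain ⟨w, hw, h3⟩ := h1
    refine ⟨w, hw, ?_⟩
    rw [← Ideal.Quotient.eq]
    exact h3.symm
end bas
end CLi


namespace CLi
universe u
section cut
variable {n : ℕ} {L : Type u} [Field L]

lemma reg_li (s : ℕ) : ∀ (Q : Ideal (MvPolynomial (Fin n) L)) (y : Fin s → MvPolynomial (Fin n) L),
    RegL Q (List.ofFn y) → (1 : MvPolynomial (Fin n) L) ∉ Q ⊔ Ideal.span (Set.range y) →
    ∀ c : Fin s → L, ∑ i, c i • y i ∈ Q → ∀ i, c i = 0 := by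
  induction s with
  | zero => intro _ _ _ _ _ _ i; exact i.elim0
  | succ s ih =>
    intro Q y hr h1 c hc
    rw [List.ofFn_succ] at hr
    have hE : Q ⊔ Ideal.span {y 0} ⊔ Ideal.span (Set.range fun i : Fin s => y i.succ) =
        Q ⊔ Ideal.span (Set.range y) := by
      rw [sup_assoc, ← Ideal.span_union]
      congr 2
      ext z
      simp [Fin.exists_fin_succ, eq_comm]
    rw [Fin.sum_univ_succ] at hc
    have h2 := ih (Q ⊔ Ideal.span {y 0}) (fun i => y i.succ) hr.2 (by rwa [hE]) (fun i => c i.succ) (by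
      have h3 : c 0 • y 0 ∈ Ideal.span {y 0} := Submodule.smul_of_tower_mem _ _ (Ideal.mem_span_singleton_self _)
      have := sub_mem (Ideal.mem_sup_left (T := Ideal.span {y 0}) hc) (Ideal.mem_sup_right h3)
      simpa using this)
    have h4 : c 0 • y 0 ∈ Q := by simpa [h2] using hc
    have h0 : c 0 = 0 := by
      by_contra h5
      have h6 : y 0 ∈ Q := by
        have := Submodule.smul_of_tower_mem Q (c 0)⁻¹ h4
        rwa [inv_smul_smul₀ h5] at this
      exact h1 (Ideal.mem_sup_left (hr.1 1 (by rwa [mul_one])))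
    exact fun i => Fin.cases h0 h2 i

lemma finrank_one : Module.finrank L (homogeneousSubmodule (Fin n) L 1) = n := by
  rw [homogeneousSubmodule_one_eq_span_X, finrank_span_eq_card, Fintype.card_fin]
  exact linearIndependent_X _ _

lemma exists_coord {p s : ℕ} (hps : p + s = n) (y : Fin s → MvPolynomial (Fin n) L)
    (hy : ∀ i, y i ∈ homogeneousSubmodule (Fin n) L 1) (hli : LinearIndependent L y) :
    ∃ z : Fin p → MvPolynomial (Fin n) L, (∀ i, z i ∈ homogeneousSubmodule (Fin n) L 1) ∧
    ∃ e : MvPolynomial (Fin p ⊕ Fin s) L ≃ₐ[L] MvPolynomial (Fin n) L,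
      (∀ i, e (X (Sum.inl i)) = z i) ∧ (∀ i, e (X (Sum.inr i)) = y i) := by
  let V := homogeneousSubmodule (Fin n) L 1
  let y' : Fin s → V := fun i => ⟨y i, hy i⟩
  have hli' : LinearIndependent L y' := by
    have : LinearIndependent L (V.subtype ∘ y') := hli
    exact this.of_comp
  obtain ⟨W, hW⟩ := Submodule.exists_isCompl (Submodule.span L (Set.range y'))
  have hWr : Module.finrank L W = p := by
    have h1 := Submodule.finrank_add_eq_of_isCompl hW
    rw [finrank_span_eq_card hli', finrank_one, Fintype.card_fin] at h1
    omega
  have : Module.Free L W := Module.Free.of_divisionRing L W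
  let z' := Module.finBasisOfFinrankEq L W hWr
  let w : Fin p ⊕ Fin s → V := Sum.elim (fun i => (z' i : V)) y'
  have hz : Submodule.span L (Set.range (fun i => (z' i : V))) = W := by
    have := congrArg (Submodule.map W.subtype) z'.span_eq
    rw [Submodule.map_span, ← Set.range_comp, Submodule.map_top, Submodule.range_subtype] at this
    exact this
  have hsp : ⊤ ≤ Submodule.span L (Set.range w) := by
    rw [Set.Sum.elim_range, Submodule.span_union, hz, sup_comm, hW.sup_eq_top]
  let b := basisOfTopLeSpanOfCardEqFinrank w hsp (by
    rw [finrank_one]; simpa using hps)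
  have hb : ∀ i, b i = w i := fun i => by simp [b]
  let x : Fin n → V := fun i => ⟨X i, X_mem i⟩
  have hx : ⊤ ≤ Submodule.span L (Set.range x) := by
    rw [← Submodule.map_le_map_iff_of_injective V.injective_subtype, Submodule.map_span, ← Set.range_comp,
      Submodule.map_top, Submodule.range_subtype]
    have : V = Submodule.span L (Set.range (X : Fin n → MvPolynomial (Fin n) L)) :=
      homogeneousSubmodule_one_eq_span_X
    exact this.le
  let b0 := basisOfTopLeSpanOfCardEqFinrank x hx (by rw [finrank_one]; simp)
  let e0 := SymmetricAlgebra.equivMvPolynomial b0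
  have he0 : e0.toAlgHom.toLinearMap ∘ₗ SymmetricAlgebra.ι L V = V.subtype := by
    apply b0.ext
    intro i
    have := SymmetricAlgebra.equivMvPolynomial_ι_apply b0 i
    simp only [LinearMap.comp_apply]
    refine this.trans ?_
    simp [b0, x]
  have he1 : ∀ v : V, e0 (SymmetricAlgebra.ι L V v) = v := fun v => LinearMap.congr_fun he0 v
  let e := (SymmetricAlgebra.equivMvPolynomial b).symm.trans e0
  have he : ∀ i, e (X i) = w i := by
    intro i
    have h1 := SymmetricAlgebra.equivMvPolynomial_symm_X b i
    change e0 ((SymmetricAlgebra.equivMvPolynomial b).symm (X i)) = _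
    rw [h1, he1, hb]
  exact ⟨fun i => (z' i : V), fun i => (z' i : V).2, e, fun i => he _, fun i => he _⟩

lemma free_A {s : ℕ} (Q : Ideal (MvPolynomial (Fin n) L)) (hQ : Hg Q) (y : Fin s → MvPolynomial (Fin n) L)
    (hy : ∀ i, y i ∈ homogeneousSubmodule (Fin n) L 1) (hr : RegL Q (List.ofFn y))
    {M : Type u} [AddCommGroup M] [Module L M] [Module (MvPolynomial (Fin s) L) M]
    [IsScalarTower L (MvPolynomial (Fin s) L) M] (π : MvPolynomial (Fin n) L →ₗ[L] M)
    (hπ : Function.Surjective π) (hker : ∀ f, π f = 0 ↔ f ∈ Q)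
    (hmod : ∀ (a : MvPolynomial (Fin s) L) f, a • π f = π (aeval y a * f)) :
    Module.Projective (MvPolynomial (Fin s) L) M := by
  obtain ⟨ι, N, hN⟩ := exists_bas (Q ⊔ Ideal.span (Set.range y))
  have hB := Bas.all s Q y hQ hy hr hN
  let v : (Fin s →₀ ℕ) × ι → M := fun ak => π ((∏ i, y i ^ ak.1 i) * N ak.2)
  have hli : LinearIndependent L v := by
    rw [linearIndependent_iff]
    intro c hc
    apply hB.2.1 c
    rw [← hker]
    have := Finsupp.apply_linearCombination L π (fun ak : (Fin s →₀ ℕ) × ι => (∏ i, y i ^ ak.1 i) * N ak.2) c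
    exact this.trans hc
  have hsp : ⊤ ≤ Submodule.span L (Set.range v) := by
    intro m _
    obtain ⟨f, rfl⟩ := hπ m
    obtain ⟨w, hw, h1⟩ := hB.2.2 f
    have h2 : π f = π w := by rw [← sub_eq_zero, ← map_sub, hker]; exact h1
    rw [h2]
    have : Set.range v = π '' Set.range (fun ak : (Fin s →₀ ℕ) × ι => (∏ i, y i ^ ak.1 i) * N ak.2) := by
      rw [← Set.range_comp]; rfl
    rw [this, ← Submodule.map_span]
    exact Submodule.mem_map_of_mem hw
  let b2 := Module.Basis.mk hli hsp
  let b1 := (basisMonomials (Fin s) L).smulTower (Finsupp.basisSingleOne (R := MvPolynomial (Fin s) L) (ι := ι))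
  let Φ : (ι →₀ MvPolynomial (Fin s) L) →ₗ[MvPolynomial (Fin s) L] M :=
    Finsupp.linearCombination _ (fun k => π (N k))
  have hΦ : (Φ.restrictScalars L) = (b1.equiv b2 (Equiv.refl _)).toLinearMap := by
    apply b1.ext
    rintro ⟨a, k⟩
    have h1 : (b1.equiv b2 (Equiv.refl _)) (b1 (a, k)) = v (a, k) := by
      rw [Module.Basis.equiv_apply]; simp [b2]
    rw [LinearEquiv.coe_coe, h1]
    have h2 : b1 (a, k) = (monomial a 1 : MvPolynomial (Fin s) L) • Finsupp.single k 1 := by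
      rw [Module.Basis.smulTower_apply]; simp
    rw [h2, LinearMap.restrictScalars_apply, map_smul]
    simp only [Φ, Finsupp.linearCombination_single, one_smul]
    rw [hmod, aeval_monomial]
    simp [v, Finsupp.prod_fintype]
  have hbij : Function.Bijective Φ := by
    have := (b1.equiv b2 (Equiv.refl _)).bijective
    have h3 : (Φ : (ι →₀ MvPolynomial (Fin s) L) → _) = (b1.equiv b2 (Equiv.refl _)) := by
      funext x; exact LinearMap.congr_fun hΦ x
    rwa [h3]
  exact Module.Projective.of_equiv (LinearEquiv.ofBijective Φ hbij)

lemma pd_upper {p s : ℕ} (Q : Ideal (MvPolynomial (Fin n) L)) (hQ : Hg Q) (y : Fin s → MvPolynomial (Fin n) L)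
    (hy : ∀ i, y i ∈ homogeneousSubmodule (Fin n) L 1) (hr : RegL Q (List.ofFn y))
    (e : MvPolynomial (Fin p ⊕ Fin s) L ≃ₐ[L] MvPolynomial (Fin n) L)
    (he2 : ∀ i, e (X (Sum.inr i)) = y i)
    {M : Type u} [AddCommGroup M] [Module L M] [Module (MvPolynomial (Fin n) L) M]
    [IsScalarTower L (MvPolynomial (Fin n) L) M] (π : MvPolynomial (Fin n) L →ₗ[L] M)
    (hπ : Function.Surjective π) (hker : ∀ f, π f = 0 ↔ f ∈ Q)
    (hmod : ∀ (a : MvPolynomial (Fin n) L) f, a • π f = π (a * f)) :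
    PD (MvPolynomial (Fin n) L) M p := by
  let e' : MvPolynomial (Fin p) (MvPolynomial (Fin s) L) ≃ₐ[L] MvPolynomial (Fin n) L :=
    (sumAlgEquiv L (Fin p) (Fin s)).symm.trans e
  let m1 : Module (MvPolynomial (Fin p) (MvPolynomial (Fin s) L)) M := Module.compHom M e'.toRingEquiv.toRingHom
  let m2 : Module (MvPolynomial (Fin s) L) M := Module.compHom M ((aeval y).toRingHom : MvPolynomial (Fin s) L →+* _)
  have ht : ∀ a : MvPolynomial (Fin s) L, e' (C a) = aeval y a := by
    intro a
    have h5 : (e'.toAlgHom.comp (IsScalarTower.toAlgHom L (MvPolynomial (Fin s) L)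
      (MvPolynomial (Fin p) (MvPolynomial (Fin s) L)))) = aeval y := by
      ext i
      simp [e', he2, MvPolynomial.algebraMap_eq]
    exact DFunLike.congr_fun h5 a
  have : IsScalarTower (MvPolynomial (Fin s) L) (MvPolynomial (Fin p) (MvPolynomial (Fin s) L)) M := by
    refine ⟨fun a b m => ?_⟩
    change e' (a • b) • m = aeval y a • (e' b • m)
    rw [← ht, ← mul_smul, ← map_mul, C_mul']
  have : Module.Projective (MvPolynomial (Fin s) L) M := by
    have : IsScalarTower L (MvPolynomial (Fin s) L) M := by
      refine ⟨fun l a m => ?_⟩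
      change aeval y (l • a) • m = l • (aeval y a • m)
      rw [map_smul, smul_assoc]
    exact free_A Q hQ y hy hr π hπ hker (fun a f => hmod _ _)
  exact pd_transfer e'.toRingEquiv M (fun r m => rfl) (pd_mv (MvPolynomial (Fin s) L) p M)

theorem pd_cut {p s : ℕ} (hps : p + s = n) (Q : Ideal (MvPolynomial (Fin n) L)) (hQ : Hg Q)
    (y : Fin s → MvPolynomial (Fin n) L)
    (hy : ∀ i, y i ∈ homogeneousSubmodule (Fin n) L 1) (hr : RegL Q (List.ofFn y))
    (f : MvPolynomial (Fin n) L) (hf : f ∉ Q ⊔ Ideal.span (Set.range y))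
    (hx : ∀ i, X i * f ∈ Q ⊔ Ideal.span (Set.range y)) (k : ℕ) :
    PD (MvPolynomial (Fin n) L) (MvPolynomial (Fin n) L ⧸ Q) k ↔ p ≤ k := by
  have h1 : (1 : MvPolynomial (Fin n) L) ∉ Q ⊔ Ideal.span (Set.range y) := by
    intro h; rw [(Ideal.eq_top_iff_one _).2 h] at hf; exact hf trivial
  have hli : LinearIndependent L y := by
    rw [Fintype.linearIndependent_iff]
    intro c hc
    exact reg_li s Q y hr h1 c (by rw [hc]; exact zero_mem _)
  obtain ⟨z, hz, e, he1, he2⟩ := exists_coord hps y hy hli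
  constructor
  · intro hk
    have hS : RegL (⊥ : Ideal (MvPolynomial (Fin n) L)) (List.ofFn y ++ List.ofFn z) := by
      have := RegL.map e.toRingEquiv (RegL_X (L := L)
        (List.ofFn (fun i : Fin s => (Sum.inr i : Fin p ⊕ Fin s)) ++ List.ofFn (fun i : Fin p => (Sum.inl i : Fin p ⊕ Fin s))) ∅ (by
          rw [List.nodup_append]
          refine ⟨List.nodup_ofFn.2 Sum.inr_injective, List.nodup_ofFn.2 Sum.inl_injective, ?_⟩
          intro a ha b hb
          rw [List.mem_ofFn] at ha hb
          obtain ⟨i, rfl⟩ := ha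
          obtain ⟨j, rfl⟩ := hb
          simp) (by simp))
      rw [Set.image_empty, Ideal.span_empty, Ideal.map_bot] at this
      convert this using 1
      simp only [List.map_append, List.map_ofFn]
      congr 2
      · funext i; exact (he2 i).symm
      · funext i; exact (he1 i).symm
    have hmem : ∀ g, (Ideal.Quotient.mk Q g : MvPolynomial (Fin n) L ⧸ Q) ∈
        (Ideal.ofList (List.ofFn y) • ⊤ : Submodule (MvPolynomial (Fin n) L) (MvPolynomial (Fin n) L ⧸ Q)) ↔
        g ∈ Q ⊔ Ideal.span (Set.range y) := by
      intro g
      rw [mk_mem_smul, Ideal.ofList]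
      have : {r | r ∈ List.ofFn y} = Set.range y := by ext r; simp [List.mem_ofFn]
      rw [this]
    have := low_bound k _ (List.ofFn y) (List.ofFn z) hk hS.wr_bot hr.wr (Ideal.Quotient.mk Q f)
      (by rwa [hmem]) (by
        intro w hw
        rw [List.mem_ofFn] at hw
        obtain ⟨i, rfl⟩ := hw
        have h2 : z i • (Ideal.Quotient.mk Q f : MvPolynomial (Fin n) L ⧸ Q) = Ideal.Quotient.mk Q (z i * f) := rfl
        rw [h2, hmem]
        have h3 := hz i
        generalize z i = w at h3
        rw [homogeneousSubmodule_one_eq_span_X] at h3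
        induction h3 using Submodule.span_induction with
        | mem w hw => obtain ⟨j, rfl⟩ := hw; exact hx j
        | zero => simp
        | add a b _ _ ha hb => rw [add_mul]; exact add_mem ha hb
        | smul c a _ ha => rw [smul_mul_assoc]; exact Submodule.smul_of_tower_mem _ _ ha)
    simpa using this
  · intro hk
    refine pd_mono hk ?_
    exact pd_upper Q hQ y hy hr e he2 (Ideal.Quotient.mkₐ L Q).toLinearMap
      (Ideal.Quotient.mkₐ_surjective L Q) (fun f => Ideal.Quotient.eq_zero_iff_mem) (fun a f => rfl)

end cut
end CLi


namespace CLi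
universe u
section fc
open TensorProduct

lemma pd_base {S B : Type u} [CommRing S] [CommRing B] [Algebra S B] [Module.Projective S B]
    (ρ : B →ₗ[S] S) (hρ : ρ 1 = 1) (M : Type u) [AddCommGroup M] [Module S M] (k : ℕ) :
    PD S M k ↔ PD B (B ⊗[S] M) k := by
  constructor
  · exact pd_tensor k M
  · intro h
    have h1 := pd_restrict (S := S) (B := B) k (B ⊗[S] M) h
    refine pd_retract ((TensorProduct.mk S B M) 1) ((TensorProduct.lid S M).toLinearMap ∘ₗ ρ.rTensor M) ?_ h1
    intro x
    simp [hρ]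

attribute [local instance] MvPolynomial.algebraMvPolynomial in
theorem pd_field {K L : Type u} [Field K] [Field L] [Algebra K L] {n : ℕ} (I : Ideal (MvPolynomial (Fin n) K))
    (k : ℕ) : PD (MvPolynomial (Fin n) K) (MvPolynomial (Fin n) K ⧸ I) k ↔
      PD (MvPolynomial (Fin n) L) (MvPolynomial (Fin n) L ⧸ I.map (MvPolynomial.map (algebraMap K L))) k := by
  have hbc : IsBaseChange (MvPolynomial (Fin n) K) (IsScalarTower.toAlgHom K L (MvPolynomial (Fin n) L)).toLinearMap :=
    (inferInstance : Algebra.IsPushout K (MvPolynomial (Fin n) K) L (MvPolynomial (Fin n) L)).out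
  have : Module.Free (MvPolynomial (Fin n) K) (MvPolynomial (Fin n) L) := hbc.free
  obtain ⟨ρ0, h0⟩ := (Algebra.linearMap K L).exists_leftInverse_of_injective
    (LinearMap.ker_eq_bot.2 (algebraMap K L).injective)
  let ρ : (MvPolynomial (Fin n) L) →ₗ[(MvPolynomial (Fin n) K)] (MvPolynomial (Fin n) K) := hbc.lift ((Algebra.linearMap K (MvPolynomial (Fin n) K)) ∘ₗ ρ0)
  have hρ : ρ 1 = 1 := by
    have h1 := hbc.lift_eq ((Algebra.linearMap K (MvPolynomial (Fin n) K)) ∘ₗ ρ0) 1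
    have h2 : ρ0 1 = 1 := by simpa using LinearMap.congr_fun h0 1
    simpa [h2] using h1
  rw [pd_base ρ hρ]
  have e := (Algebra.TensorProduct.quotIdealMapEquivTensorQuot (MvPolynomial (Fin n) L) I).toLinearEquiv
  exact ⟨fun h => pd_equiv e.symm h, fun h => pd_equiv e h⟩

end fc
end CLi


namespace CLi
section hfs
variable {n : ℕ} {L : Type*} [Field L]

noncomputable def GI.of (Q : Ideal (MvPolynomial (Fin n) L)) : GI n L where
  U d := Q.restrictScalars L ⊓ homogeneousSubmodule (Fin n) L d
  le d := inf_le_right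
  mul d k f g hf hg := by
    refine ⟨Ideal.mul_mem_left Q g hf.1, ?_⟩
    rw [add_comm]; exact hom_mul hg hf.2

lemma mem_of {Q : Ideal (MvPolynomial (Fin n) L)} {d f} :
    f ∈ (GI.of Q).U d ↔ f ∈ Q ∧ f ∈ homogeneousSubmodule (Fin n) L d := Iff.rfl

lemma add_of {Q : Ideal (MvPolynomial (Fin n) L)} (hQ : Hg Q) {y : MvPolynomial (Fin n) L}
    (hy : y ∈ homogeneousSubmodule (Fin n) L 1) (d : ℕ) :
    ((GI.of Q).add y hy).U d = (GI.of (Q ⊔ Ideal.span {y})).U d := by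
  apply le_antisymm
  · refine sup_le ?_ ?_
    · rintro f ⟨h1, h2⟩
      exact ⟨Ideal.mem_sup_left h1, h2⟩
    · rcases d with _ | d
      · exact bot_le
      · rintro _ ⟨f, hf, rfl⟩
        refine ⟨Ideal.mem_sup_right (Ideal.mul_mem_right _ _ (Ideal.mem_span_singleton_self y)), ?_⟩
        rw [add_comm]; exact hom_mul hy hf
  · rintro f ⟨h1, h2⟩
    obtain ⟨q, hq, r, hr, rfl⟩ := Submodule.mem_sup.1 h1
    obtain ⟨b, rfl⟩ := Ideal.mem_span_singleton'.1 hr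
    have h3 := homogeneousComponent_of_mem h2 (m := d)
    rw [if_pos rfl, map_add] at h3
    rw [← h3]
    refine Submodule.add_mem_sup ⟨hQ q hq d, homogeneousComponent_mem d q⟩ ?_
    rw [mul_comm]
    rcases d with _ | d
    · rw [comp_mul_lt hy _ _ (by omega)]; exact zero_mem _
    · have h := comp_mul hy b d
      rw [add_comm 1 d] at h
      rw [h]
      exact ⟨_, homogeneousComponent_mem d b, rfl⟩

lemma hf_congr {U V : GI n L} {d : ℕ} (h : U.U d = V.U d) : U.hf d = V.hf d := by
  simp only [GI.hf]; rw [h]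

lemma hf_reg {Q : Ideal (MvPolynomial (Fin n) L)} (hQ : Hg Q) {y : MvPolynomial (Fin n) L}
    (hy : y ∈ homogeneousSubmodule (Fin n) L 1) (h1 : 1 ∉ Q) (hr : ∀ f, y * f ∈ Q → f ∈ Q) (d : ℕ) :
    (GI.of Q).hf (d+1) = (GI.of (Q ⊔ Ideal.span {y})).hf (d+1) + (GI.of Q).hf d := by
  have h0 : y ≠ 0 := by
    rintro rfl
    exact h1 (hr 1 (by simp))
  rw [GI.hf_split _ y hy h0, hf_congr (add_of hQ hy _)]
  congr 1
  apply hf_congr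
  ext f
  constructor
  · rintro ⟨h2, h3⟩
    exact ⟨hr _ h3.1, h2⟩
  · rintro ⟨h2, h3⟩
    refine ⟨h3, Ideal.mul_mem_left _ _ h2, ?_⟩
    rw [add_comm]; exact hom_mul hy h3

lemma hf_reg_zero {Q : Ideal (MvPolynomial (Fin n) L)} (hQ : Hg Q) {y : MvPolynomial (Fin n) L}
    (hy : y ∈ homogeneousSubmodule (Fin n) L 1) :
    (GI.of (Q ⊔ Ideal.span {y})).hf 0 = (GI.of Q).hf 0 := by
  rw [← hf_congr (add_of hQ hy 0), GI.hf_add_zero]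

lemma hf_det {L' : Type*} [Field L'] (s : ℕ) : ∀ (Q : Ideal (MvPolynomial (Fin n) L))
    (Q' : Ideal (MvPolynomial (Fin n) L')) (y : Fin s → MvPolynomial (Fin n) L)
    (y' : Fin s → MvPolynomial (Fin n) L'), Hg Q → Hg Q' →
    (∀ i, y i ∈ homogeneousSubmodule (Fin n) L 1) → (∀ i, y' i ∈ homogeneousSubmodule (Fin n) L' 1) →
    RegL Q (List.ofFn y) → RegL Q' (List.ofFn y') → 1 ∉ Q ⊔ Ideal.span (Set.range y) →
    1 ∉ Q' ⊔ Ideal.span (Set.range y') →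
    (∀ d, (GI.of (Q ⊔ Ideal.span (Set.range y))).hf d = (GI.of (Q' ⊔ Ideal.span (Set.range y'))).hf d) →
    ∀ d, (GI.of Q).hf d = (GI.of Q').hf d := by
  induction s with
  | zero =>
    intro Q Q' y y' _ _ _ _ _ _ _ _ h
    simpa [Set.range_eq_empty] using h
  | succ s ih =>
    intro Q Q' y y' hQ hQ' hy hy' hr hr' h1 h1' h
    rw [List.ofFn_succ] at hr hr'
    have hE : ∀ {F : Type _} [Field F] (P : Ideal (MvPolynomial (Fin n) F)) (y : Fin (s+1) → MvPolynomial (Fin n) F),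
        P ⊔ Ideal.span {y 0} ⊔ Ideal.span (Set.range fun i : Fin s => y i.succ) =
        P ⊔ Ideal.span (Set.range y) := by
      intro F _ P y
      rw [sup_assoc, ← Ideal.span_union]
      congr 2
      ext z
      simp [Fin.exists_fin_succ, eq_comm]
    have hE' : ∀ {F : Type _} [Field F] (P : Ideal (MvPolynomial (Fin n) F)) (y : Fin (s+1) → MvPolynomial (Fin n) F),
        P ⊔ Ideal.span {y 0} ⊔ Ideal.span (Set.range fun i : Fin s => y i.succ) =
        P ⊔ Ideal.span (Set.range y) := by
      intro F _ P y
      rw [sup_assoc, ← Ideal.span_union]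
      congr 2
      ext z
      simp [Fin.exists_fin_succ, eq_comm]
    have key := ih (Q ⊔ Ideal.span {y 0}) (Q' ⊔ Ideal.span {y' 0}) (fun i => y i.succ) (fun i => y' i.succ)
      (hQ.sup (Hg.span (by rintro z rfl; exact ⟨1, hy 0⟩))) (hQ'.sup (Hg.span (by rintro z rfl; exact ⟨1, hy' 0⟩)))
      (fun i => hy _) (fun i => hy' _) hr.2 hr'.2 (by rwa [hE]) (by rwa [hE']) (by rw [hE, hE']; exact h)
    have k1 : 1 ∉ Q := fun h => h1 (Ideal.mem_sup_left h)
    have k1' : 1 ∉ Q' := fun h => h1' (Ideal.mem_sup_left h)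
    intro d
    induction d with
    | zero => rw [← hf_reg_zero hQ (hy 0), ← hf_reg_zero hQ' (hy' 0), key]
    | succ d ihd =>
      rw [hf_reg hQ (hy 0) k1 hr.1, hf_reg hQ' (hy' 0) k1' hr'.1, key, ihd]

lemma hf_eq {L : Type*} [Field L] (Q : Ideal (MvPolynomial (Fin n) L)) (d : ℕ) :
    hilbertFunction L Q d = (GI.of Q).hf d := by
  have h1 := LinearMap.finrank_range_add_finrank_ker (((Ideal.Quotient.mkₐ L Q).toLinearMap).domRestrict (homogeneousSubmodule (Fin n) L d))
  have h2 : LinearMap.range (((Ideal.Quotient.mkₐ L Q).toLinearMap).domRestrict (homogeneousSubmodule (Fin n) L d)) = (homogeneousSubmodule (Fin n) L d).map ((Ideal.Quotient.mkₐ L Q).toLinearMap) := by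
    rw [LinearMap.range_domRestrict]
  have h3 : (LinearMap.ker (((Ideal.Quotient.mkₐ L Q).toLinearMap).domRestrict (homogeneousSubmodule (Fin n) L d))).map (homogeneousSubmodule (Fin n) L d).subtype = (GI.of Q).U d := by
    ext f
    constructor
    · rintro ⟨⟨f, hf⟩, h, rfl⟩
      exact ⟨Ideal.Quotient.eq_zero_iff_mem.1 h, hf⟩
    · rintro ⟨h, hf⟩
      exact ⟨⟨f, hf⟩, Ideal.Quotient.eq_zero_iff_mem.2 h, rfl⟩
  have h4 := finrank_map_inj (homogeneousSubmodule (Fin n) L d).subtype (homogeneousSubmodule (Fin n) L d).injective_subtype (LinearMap.ker (((Ideal.Quotient.mkₐ L Q).toLinearMap).domRestrict (homogeneousSubmodule (Fin n) L d)))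
  rw [h3] at h4
  rw [h2, ← h4] at h1
  have h5 : hilbertFunction L Q d + Module.finrank L ((GI.of Q).U d) = Module.finrank L (homogeneousSubmodule (Fin n) L d) := h1
  rw [GI.hf, ← h5, Nat.add_sub_cancel]

noncomputable def monI (L : Type*) [Field L] (M : Set (Fin n →₀ ℕ)) : Ideal (MvPolynomial (Fin n) L) :=
  Ideal.span ((fun m => monomial m (1 : L)) '' M)

lemma mem_monI {M : Set (Fin n →₀ ℕ)} {f : MvPolynomial (Fin n) L} :
    f ∈ monI L M ↔ ∀ m ∈ f.support, ∃ m' ∈ M, m' ≤ m := mem_ideal_span_monomial_image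

lemma monI_hf (M : Set (Fin n →₀ ℕ)) (d : ℕ) :
    (GI.of (monI L M)).hf d = Nat.card {m : Fin n →₀ ℕ | m.degree = d ∧ ∀ m' ∈ M, ¬ m' ≤ m} := by
  have hfin : Set.Finite {m : Fin n →₀ ℕ | m.degree = d} := Finsupp.finite_of_degree_le d |>.subset fun m hm => le_of_eq hm
  have hS : ∀ s : Set (Fin n →₀ ℕ), Module.finrank L (restrictSupport L s) = Nat.card s := fun s => by
    rw [Module.finrank_eq_nat_card_basis (basisRestrictSupport L s)]
  have h1 : homogeneousSubmodule (Fin n) L d = restrictSupport L {m | m.degree = d} :=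
    homogeneousSubmodule_eq_finsupp_supported _ _ _
  have h2 : (GI.of (monI L M)).U d = restrictSupport L {m | m.degree = d ∧ ∃ m' ∈ M, m' ≤ m} := by
    ext f
    rw [mem_of, mem_monI, h1, mem_restrictSupport_iff, mem_restrictSupport_iff]
    constructor
    · rintro ⟨h3, h4⟩ m hm
      exact ⟨h4 hm, h3 m hm⟩
    · intro h
      exact ⟨fun m hm => (h hm).2, fun m hm => (h hm).1⟩
  rw [GI.hf, h2, h1, hS, hS]
  rw [Nat.card_coe_set_eq, Nat.card_coe_set_eq, Nat.card_coe_set_eq, ← Set.ncard_sdiff ?_ (hfin.subset fun m hm => hm.1)]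
  · congr 1
    ext m
    simp
    tauto
  · intro m hm; exact hm.1

end hfs
end CLi


namespace CLi
section cut

lemma ass_help {R : Type*} [CommRing R] [IsNoetherianRing R] (Q : Ideal R) (h1 : 1 ∉ Q) :
    ∃ A : Set (Ideal R), A.Finite ∧ A.Nonempty ∧
      (∀ P ∈ A, P.IsPrime ∧ Q ≤ P ∧ ∃ f ∉ Q, ∀ r ∈ P, r * f ∈ Q) ∧
      ∀ r, (∀ P ∈ A, r ∉ P) → ∀ f, r * f ∈ Q → f ∈ Q := by
  have hQ : Q ≠ ⊤ := fun h => h1 (h ▸ Submodule.mem_top)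
  haveI : Nontrivial (R ⧸ Q) := Ideal.Quotient.nontrivial_iff.2 hQ
  refine ⟨associatedPrimes R (R ⧸ Q), associatedPrimes.finite R _, associatedPrimes.nonempty R _, ?_, ?_⟩
  · intro P hP
    have hP' : IsAssociatedPrime P (R ⧸ Q) := hP
    rw [isAssociatedPrime_iff] at hP'
    obtain ⟨hp, x, hx⟩ := hP'
    obtain ⟨f, rfl⟩ := Ideal.Quotient.mk_surjective x
    have hm : ∀ r, r ∈ P ↔ r * f ∈ Q := by
      intro r
      rw [hx, Submodule.mem_colon_singleton, Submodule.mem_bot, ← Ideal.Quotient.eq_zero_iff_mem,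
        map_mul]
      rfl
    refine ⟨hp, fun r hr => (hm r).2 (Ideal.mul_mem_right _ _ hr), f, fun hf => ?_, fun r hr => (hm r).1 hr⟩
    exact hp.ne_top ((Ideal.eq_top_iff_one _).2 ((hm 1).2 (by simpa using hf)))
  · intro r hr f hf
    by_contra hc
    have := biUnion_associatedPrimes_eq_zero_divisors R (R ⧸ Q)
    have h2 : r ∈ {r : R | ∃ x : R ⧸ Q, x ≠ 0 ∧ r • x = 0} := by
      refine ⟨Ideal.Quotient.mk Q f, fun h => hc (Ideal.Quotient.eq_zero_iff_mem.1 h), ?_⟩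
      have := Ideal.Quotient.eq_zero_iff_mem.2 hf
      rw [map_mul] at this
      exact this
    rw [← this] at h2
    simp only [Set.mem_iUnion] at h2
    obtain ⟨P, hP, h3⟩ := h2
    exact hr P hP h3

lemma avoid {L V : Type*} [Field L] [Infinite L] [AddCommGroup V] [Module L V]
    (T : Set (Submodule L V)) (hT : T.Finite) (h : ⊤ ∉ T) : ∃ v, ∀ W ∈ T, v ∉ W := by
  have h2 := Subspace.biUnion_ne_univ_of_top_notMem (k := L) (E := V) (s := hT.toFinset) (by simpa using h)
  rw [Set.ne_univ_iff_exists_notMem] at h2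
  obtain ⟨v, hv⟩ := h2
  refine ⟨v, fun W hW hvW => hv ?_⟩
  simp only [Set.mem_iUnion]
  exact ⟨W, by simpa using hW, hvW⟩

variable {n : ℕ} {L : Type*} [Field L]

lemma one_notMem {Q : Ideal (MvPolynomial (Fin n) L)} (hQ : Hg Q) (h1 : 1 ∉ Q)
    {y : MvPolynomial (Fin n) L} (hy : y ∈ homogeneousSubmodule (Fin n) L 1) :
    1 ∉ Q ⊔ Ideal.span {y} := by
  intro h
  obtain ⟨q, hq, r, hr, h2⟩ := Submodule.mem_sup.1 h
  obtain ⟨b, rfl⟩ := Ideal.mem_span_singleton'.1 hr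
  have h3 := congrArg (homogeneousComponent 0) h2
  rw [map_add, mul_comm, comp_mul_lt hy _ _ (by omega), add_zero] at h3
  have h4 : homogeneousComponent 0 (1 : MvPolynomial (Fin n) L) = 1 := by
    rw [homogeneousComponent_zero]; simp
  rw [h4] at h3
  exact h1 (h3 ▸ hQ q hq 0)

lemma cut_loop [Infinite L] (E : Set (Fin n × Fin n)) (g : ℕ) : ∀ (p s : ℕ), p + s = n →
    ∀ (Q : Ideal (MvPolynomial (Fin n) L)), Hg Q → 1 ∉ Q → (∀ e ∈ E, X e.1 * X e.2 ∈ Q) →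
    ∀ (Y : Submodule L (MvPolynomial (Fin n) L)), Y ≤ Q.restrictScalars L →
    Y ≤ homogeneousSubmodule (Fin n) L 1 → Module.finrank L Y = s →
    (∀ C : Set (Fin n), (∀ e ∈ E, e.1 ∈ C ∨ e.2 ∈ C) →
      g + s ≤ Module.finrank L (Y ⊔ Submodule.span L (X '' C) : Submodule L (MvPolynomial (Fin n) L))) →
    ∃ t p', p' + t = p ∧ ∃ y : Fin t → MvPolynomial (Fin n) L,
      (∀ i, y i ∈ homogeneousSubmodule (Fin n) L 1) ∧ RegL Q (List.ofFn y) ∧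
      (∃ f, f ∉ Q ⊔ Ideal.span (Set.range y) ∧ ∀ i, X i * f ∈ Q ⊔ Ideal.span (Set.range y)) ∧
      1 ∉ Q ⊔ Ideal.span (Set.range y) ∧
      Module.finrank L (Y ⊔ Submodule.span L (Set.range y) : Submodule L (MvPolynomial (Fin n) L)) = s + t ∧
      (∀ C : Set (Fin n), (∀ e ∈ E, e.1 ∈ C ∨ e.2 ∈ C) → g + (s + t) ≤
        Module.finrank L (Y ⊔ Submodule.span L (Set.range y) ⊔ Submodule.span L (X '' C) :
          Submodule L (MvPolynomial (Fin n) L))) := by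
  have e0 : ∀ Y : Submodule L (MvPolynomial (Fin n) L), Y ⊔ Submodule.span L
      (Set.range (Fin.elim0 : Fin 0 → MvPolynomial (Fin n) L)) = Y := fun Y => by
    rw [Set.range_eq_empty, Submodule.span_empty, sup_bot_eq]
  intro p
  induction p with
  | zero =>
    intro s hs Q hQ h1 hE Y hYQ hY1 hYs hC
    haveI := fin_hom (n := n) (L := L) 1
    have hYe : Y = homogeneousSubmodule (Fin n) L 1 := by
      apply Submodule.eq_of_le_of_finrank_eq hY1
      rw [finrank_one, hYs]; omega
    refine ⟨0, 0, rfl, Fin.elim0, fun i => i.elim0, by simp [RegL], ⟨1, ?_, ?_⟩, ?_, ?_, ?_⟩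
    · simpa [Set.range_eq_empty] using h1
    · intro i
      apply Ideal.mem_sup_left
      rw [mul_one]
      exact hYQ (hYe ▸ X_mem i)
    · simpa [Set.range_eq_empty] using h1
    · rw [e0]; exact hYs
    · rw [e0]; exact hC
  | succ p ih =>
    intro s hs Q hQ h1 hE Y hYQ hY1 hYs hC
    by_cases hsoc : ∃ f, f ∉ Q ∧ ∀ i, X i * f ∈ Q
    · refine ⟨0, p+1, rfl, Fin.elim0, fun i => i.elim0, by simp [RegL], ?_, ?_, ?_, ?_⟩
      · simpa [Set.range_eq_empty] using hsoc
      · simpa [Set.range_eq_empty] using h1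
      · rw [e0]; exact hYs
      · rw [e0]; exact hC
    · push Not at hsoc
      haveI := fin_hom (n := n) (L := L) 1
      obtain ⟨A, hAf, hAn, hA, hAz⟩ := ass_help Q h1
      have hnP : ∀ P ∈ A, ∃ i, (X i : MvPolynomial (Fin n) L) ∉ P := by
        intro P hP
        obtain ⟨_, _, f, hf, hf2⟩ := hA P hP
        obtain ⟨i, hi⟩ := hsoc f hf
        exact ⟨i, fun h => hi (hf2 _ h)⟩
      have hXC : ∀ C : Set (Fin n), Submodule.span L (X '' C) ≤ homogeneousSubmodule (Fin n) L 1 := by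
        intro C
        rw [Submodule.span_le]
        rintro _ ⟨i, _, rfl⟩
        exact X_mem i
      have hgs : g + s < n := by
        obtain ⟨P, hP⟩ := hAn
        obtain ⟨hp, hQP, -⟩ := hA P hP
        obtain ⟨i, hi⟩ := hnP P hP
        have h2 := hC {i | (X i : MvPolynomial (Fin n) L) ∈ P} (fun e he => hp.mem_or_mem (hQP (hE e he)))
        have h3 : (Y ⊔ Submodule.span L (X '' {i | (X i : MvPolynomial (Fin n) L) ∈ P})) <
            homogeneousSubmodule (Fin n) L 1 := by
          refine lt_of_le_of_ne (sup_le hY1 (hXC _)) fun h => hi ?_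
          have h4 : (Y ⊔ Submodule.span L (X '' {i | (X i : MvPolynomial (Fin n) L) ∈ P})) ≤
              P.restrictScalars L := by
            refine sup_le (fun z hz => hQP (hYQ hz)) ?_
            rw [Submodule.span_le]
            rintro _ ⟨i, hi, rfl⟩
            exact hi
          exact h4 (h ▸ X_mem i)
        have h4 := Submodule.finrank_lt_finrank_of_lt h3
        rw [finrank_one] at h4
        omega
      let H := homogeneousSubmodule (Fin n) L 1
      let F1 : Set (Submodule L H) := (fun P : Ideal (MvPolynomial (Fin n) L) =>
        (P.restrictScalars L).comap H.subtype) '' A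
      let F2 : Set (Submodule L H) := (Set.range fun C : Set (Fin n) =>
        (Y ⊔ Submodule.span L (X '' C)).comap H.subtype) \ {⊤}
      obtain ⟨⟨y, hy⟩, hyA⟩ := avoid (F1 ∪ F2) ((hAf.image _).union ((Set.finite_range _).subset Set.sdiff_subset)) (by
        rintro (⟨P, hP, h⟩ | h)
        · obtain ⟨i, hi⟩ := hnP P hP
          have : (⟨X i, X_mem i⟩ : H) ∈ (⊤ : Submodule L H) := trivial
          rw [← h] at this
          exact hi this
        · exact h.2 rfl)
      have hyr : ∀ f, y * f ∈ Q → f ∈ Q := hAz y fun P hP h => hyA _ (Or.inl ⟨P, hP, rfl⟩) h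
      have hyC : ∀ C : Set (Fin n), Y ⊔ Submodule.span L (X '' C) = H ∨ y ∉ Y ⊔ Submodule.span L (X '' C) := by
        intro C
        by_cases h : (Y ⊔ Submodule.span L (X '' C)).comap H.subtype = ⊤
        · left
          refine le_antisymm (sup_le hY1 (hXC _)) fun z hz => ?_
          have : (⟨z, hz⟩ : H) ∈ (⊤ : Submodule L H) := trivial
          rw [← h] at this
          exact this
        · right
          intro hc
          exact hyA _ (Or.inr ⟨⟨C, rfl⟩, h⟩) hc
      have hyY : y ∉ Y := by
        intro h
        exact h1 (hyr 1 (by rw [mul_one]; exact hYQ h))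
      haveI : FiniteDimensional L Y := Submodule.finiteDimensional_of_le hY1
      have hyH : Submodule.span L {y} ≤ H := by
        rw [Submodule.span_le]; simpa using hy
      have hspan : Submodule.span L {y} ≤ (Ideal.span {y}).restrictScalars L := by
        rw [Submodule.span_le]; simpa using Ideal.mem_span_singleton_self y
      obtain ⟨t, p', htp, y', hy', hr', ⟨f, hf1, hf2⟩, h1', hfr, hC'⟩ := ih (s+1) (by omega) (Q ⊔ Ideal.span {y})
        (hQ.sup (Hg.span (by rintro z rfl; exact ⟨1, hy⟩))) (one_notMem hQ h1 hy)
        (fun e he => Ideal.mem_sup_left (hE e he)) (Y ⊔ Submodule.span L {y})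
        (sup_le (fun z hz => Ideal.mem_sup_left (hYQ hz)) (fun z hz => Ideal.mem_sup_right (hspan hz)))
        (sup_le hY1 hyH) (by rw [finrank_W_add Y y hyY, hYs]) (by
          intro C hCE
          rw [sup_right_comm]
          rcases hyC C with h | h
          · rw [h, sup_eq_left.2 hyH, finrank_one]; omega
          · haveI : FiniteDimensional L (Y ⊔ Submodule.span L (X '' C) : Submodule L (MvPolynomial (Fin n) L)) :=
              Submodule.finiteDimensional_of_le (sup_le hY1 (hXC C))
            rw [finrank_W_add _ y h]
            have := hC C hCE
            omega)
      have e1 : Q ⊔ Ideal.span (Set.range (Fin.cons y y' : Fin (t+1) → MvPolynomial (Fin n) L)) =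
          Q ⊔ Ideal.span {y} ⊔ Ideal.span (Set.range y') := by
        rw [Fin.range_cons, Ideal.span_insert, sup_assoc]
      have e2 : Y ⊔ Submodule.span L (Set.range (Fin.cons y y' : Fin (t+1) → MvPolynomial (Fin n) L)) =
          Y ⊔ Submodule.span L {y} ⊔ Submodule.span L (Set.range y') := by
        rw [Fin.range_cons, Submodule.span_insert, sup_assoc]
      refine ⟨t+1, p', by omega, Fin.cons y y', ?_, ?_, ⟨f, ?_, ?_⟩, ?_, ?_, ?_⟩
      · intro i
        refine Fin.cases ?_ (fun j => ?_) i
        · exact hy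
        · exact hy' j
      · rw [List.ofFn_cons]
        exact ⟨hyr, hr'⟩
      · rw [e1]; exact hf1
      · rw [e1]; exact hf2
      · rw [e1]; exact h1'
      · rw [e2, hfr]; omega
      · intro C hCE
        rw [e2]
        have := hC' C hCE
        omega

end cut
end CLi


namespace CLi
section mons

lemma T_caps {p g d D D' : ℕ} (h : d ≤ D) (h' : d ≤ D') : T (caps p g D) d = T (caps p g D') d := by
  have key : ∀ D D', d ≤ D → d ≤ D' → T (caps p g D) d ⊆ T (caps p g D') d := by
    intro D D' h h' u hu
    rw [mem_T] at hu ⊢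
    refine ⟨fun i => ?_, hu.2⟩
    have h1 : u i ≤ caps p g D i := hu.1 i
    show u i ≤ caps p g D' i
    have h2 : u i ≤ ∑ i, u i := Finset.single_le_sum (fun _ _ => Nat.zero_le _) (Finset.mem_univ i)
    rw [hu.2] at h2
    simp only [caps] at h1 ⊢
    split_ifs at h1 ⊢ <;> omega
  exact (key _ _ h h').antisymm (key _ _ h' h)

lemma Low_caps {p g d D D' : ℕ} (h : d ≤ D) (h' : d ≤ D') {X : Finset (Fin p → ℕ)}
    (hX : Low (caps p g D) d X) : Low (caps p g D') d X := by
  unfold Low at *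
  rwa [T_caps h' h]

lemma exists_B {p g : ℕ} (h : ℕ → ℕ)
    (hA : ∀ d D, d + 1 ≤ D → Adm (caps p g D) d (h d) (h (d+1))) :
    ∃ B : ℕ → Finset (Fin p → ℕ), (∀ d, Low (caps p g (d+1)) d (B d) ∧ (B d).card = h d) ∧
      (∀ d, ∀ v ∈ B (d+1), ∀ u, ∑ i, u i = d → u ≤ v → u ∈ B d) := by
  have h1 : ∀ d, ∃ X, Low (caps p g (d+1)) d X ∧ X.card = h d := fun d =>
    exists_low _ _ _ (hA d (d+1) le_rfl).le.1
  choose B hB using h1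
  refine ⟨B, hB, fun d v hv u hu huv => ?_⟩
  have hl : Low (caps p g (d+1)) (d+1) (B (d+1)) := Low_caps (by omega) le_rfl (hB (d+1)).1
  refine adm_low (caps_mono p g (d+1) (by omega)) (caps_or p g (d+1) d le_rfl) (hA d (d+1) le_rfl) (hB d).1
    hl (hB d).2 (hB (d+1)).2 v hv u ?_ huv
  rw [mem_T]
  exact ⟨huv.trans (mem_T.1 (hl.1 hv)).1, hu⟩

lemma B_down {p : ℕ} {B : ℕ → Finset (Fin p → ℕ)} 
    (hB : ∀ d, ∀ v ∈ B (d+1), ∀ u, ∑ i, u i = d → u ≤ v → u ∈ B d) :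
    ∀ k (u v : Fin p → ℕ), u ≤ v → ∑ i, v i = ∑ i, u i + k → v ∈ B (∑ i, v i) → u ∈ B (∑ i, u i) := by
  intro k
  induction k with
  | zero =>
    intro u v huv hs hv
    have : u = v := by
      funext i
      by_contra hne
      have := Finset.sum_lt_sum (fun i _ => huv i) ⟨i, Finset.mem_univ i, lt_of_le_of_ne (huv i) hne⟩
      omega
    rwa [this]
  | succ k ih =>
    intro u v huv hs hv
    have : ∃ i, u i < v i := by
      by_contra hc
      push Not at hc
      have := Finset.sum_le_sum (fun i (_ : i ∈ Finset.univ) => hc i)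
      omega
    obtain ⟨i, hi⟩ := this
    have h1 : ∑ j, (u + Pi.single i 1 : Fin p → ℕ) j = ∑ j, u j + 1 := by
      simp [Finset.sum_add_distrib]
    have h2 := ih (u + Pi.single i 1) v (fun j => by
      by_cases hj : j = i
      · subst hj; simpa using hi
      · simpa [hj] using huv j) (by omega) hv
    rw [h1] at h2
    exact hB _ _ h2 u rfl (fun j => by simp)

lemma exists_Bu {p g : ℕ} (h : ℕ → ℕ) (e : ℕ) (he : 1 ≤ h e)
    (hA : ∀ d D, d + 1 ≤ D → Adm (caps p g D) d (h d) (h (d+1)))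
    (hA2 : ∀ d D, d + 1 ≤ D → Adm (caps p g D) d (Function.update h e (h e - 1) d)
      (Function.update h e (h e - 1) (d+1))) :
    ∃ B : ℕ → Finset (Fin p → ℕ), (∀ d, B d ⊆ T (caps p g (d+1)) d) ∧ (∀ d, (B d).card = h d) ∧
      (∀ u v : Fin p → ℕ, u ≤ v → v ∈ B (∑ i, v i) → u ∈ B (∑ i, u i)) ∧
      ∃ u ∈ B e, ∀ i, u + Pi.single i 1 ∉ B (e+1) := by
  obtain ⟨B, hB, hBd⟩ := exists_B h hA
  obtain ⟨B2, hB2, hBd2⟩ := exists_B _ hA2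
  refine ⟨B, fun d => (hB d).1.1, fun d => (hB d).2, fun u v huv hv => ?_, ?_⟩
  · have := Finset.sum_le_sum (fun i (_ : i ∈ Finset.univ) => huv i)
    exact B_down hBd (∑ i, v i - ∑ i, u i) u v huv (by omega) hv
  · have h1 : ∃ u ∈ B e, u ∉ B2 e := by
      by_contra hc
      push Not at hc
      have h2 := Finset.card_le_card (show B e ⊆ B2 e from hc)
      rw [(hB e).2, (hB2 e).2, Function.update_self] at h2
      omega
    obtain ⟨u, hu, hu2⟩ := h1
    refine ⟨u, hu, fun i hi => hu2 ?_⟩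
    have h3 : B (e+1) ⊆ B2 (e+1) := by
      apply Low.subset (hB _).1 (hB2 _).1
      rw [(hB _).2, (hB2 _).2, Function.update_of_ne (by omega)]
    exact hBd2 e _ (h3 hi) u (mem_T.1 ((hB e).1.1 hu)).2 (fun j => by simp)

variable {p s : ℕ}

noncomputable def ext0 (s : ℕ) (u : Fin p → ℕ) : Fin (p+s) →₀ ℕ := Finsupp.equivFunOnFinite.symm (Fin.append u 0)

def rst (m : Fin (p+s) →₀ ℕ) : Fin p → ℕ := fun i => m (Fin.castAdd s i)

lemma ext0_l (u : Fin p → ℕ) (i) : ext0 s u (Fin.castAdd s i) = u i := by simp [ext0]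
lemma ext0_r (u : Fin p → ℕ) (i) : ext0 s u (Fin.natAdd p i) = 0 := by simp [ext0]
lemma rst_ext0 (u : Fin p → ℕ) : rst (ext0 s u) = u := funext fun i => ext0_l u i
lemma ext0_rst (m : Fin (p+s) →₀ ℕ) (h : ∀ i, m (Fin.natAdd p i) = 0) : ext0 s (rst m) = m := by
  ext i
  refine Fin.addCases (fun i => ?_) (fun i => ?_) i
  · rw [ext0_l]; rfl
  · rw [ext0_r, h]
lemma deg_ext0 (u : Fin p → ℕ) : (ext0 s u).degree = ∑ i, u i := by
  rw [Finsupp.degree_eq_sum, Fin.sum_univ_add]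
  simp [ext0_l, ext0_r]

lemma RegL_mon {n : ℕ} {L : Type*} [Field L] (l : List (Fin n)) (hl : l.Nodup) :
    ∀ (M : Set (Fin n →₀ ℕ)), (∀ j ∈ l, ∀ m ∈ M, m j = 0) → RegL (monI L M) (l.map X) := by
  induction l with
  | nil => intro M _; simp [RegL]
  | cons j l ih =>
    intro M hM
    rw [List.nodup_cons] at hl
    refine ⟨fun f hf => ?_, ?_⟩
    · rw [mem_monI] at hf ⊢
      intro m hm
      obtain ⟨m', hm', hle⟩ := hf (m + Finsupp.single j 1) (by
        rw [mul_comm, mem_support_iff, coeff_mul_X]; exact mem_support_iff.1 hm)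
      refine ⟨m', hm', fun i => ?_⟩
      have h0 := hM j (by simp) m' hm'
      have h1 := hle i
      by_cases hi : i = j
      · subst hi; omega
      · simpa [Finsupp.single_apply, Ne.symm hi] using h1
    · have : monI L M ⊔ Ideal.span {(X j : MvPolynomial (Fin n) L)} = monI L (M ∪ {Finsupp.single j 1}) := by
        unfold monI
        rw [Set.image_union, Ideal.span_union, Set.image_singleton]
        rfl
      change RegL (monI L M ⊔ Ideal.span {(X j : MvPolynomial (Fin n) L)}) (l.map X)
      rw [this]
      refine ih hl.2 _ fun i hi m hm => ?_
      rcases hm with hm | hm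
      · exact hM i (by simp [hi]) m hm
      · rw [Set.mem_singleton_iff] at hm
        subst hm
        have : j ≠ i := by rintro rfl; exact hl.1 hi
        simp [Finsupp.single_apply, this]

lemma mon_side {K : Type*} [Field K] {g : ℕ} (hg : g ≤ p) (h : ℕ → ℕ) (e : ℕ) (he : 1 ≤ h e)
    (hA : ∀ d D, d + 1 ≤ D → Adm (caps p g D) d (h d) (h (d+1)))
    (hA2 : ∀ d D, d + 1 ≤ D → Adm (caps p g D) d (Function.update h e (h e - 1) d)
      (Function.update h e (h e - 1) (d+1))) :
    ∃ M : Set (Fin (p+s) →₀ ℕ), (∀ i : Fin (p+s), (i : ℕ) < g → X i ^ 2 ∈ monI K M) ∧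
      RegL (monI K M) (List.ofFn fun i : Fin s => X (Fin.natAdd p i)) ∧
      (∃ f, f ∉ monI K M ⊔ Ideal.span (Set.range fun i : Fin s => X (Fin.natAdd p i)) ∧
        ∀ i, X i * f ∈ monI K M ⊔ Ideal.span (Set.range fun i : Fin s => X (Fin.natAdd p i))) ∧
      ∀ d, (GI.of (monI K M ⊔ Ideal.span (Set.range fun i : Fin s => X (Fin.natAdd p i)))).hf d = h d := by
  obtain ⟨B, hBT, hBc, hBd, u, hu, hu2⟩ := exists_Bu h e he hA hA2
  let M : Set (Fin (p+s) →₀ ℕ) := ext0 s '' {u | u ∉ B (∑ i, u i)}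
  let M' : Set (Fin (p+s) →₀ ℕ) := M ∪ Set.range fun i : Fin s => Finsupp.single (Fin.natAdd p i) 1
  have hsup : monI K M ⊔ Ideal.span (Set.range fun i : Fin s => X (Fin.natAdd p i)) = monI K M' := by
    unfold monI
    rw [Set.image_union, Ideal.span_union, ← Set.range_comp]
    rfl
  have hN : ∀ m : Fin (p+s) →₀ ℕ, (∀ m' ∈ M', ¬ m' ≤ m) ↔
      (∀ i, m (Fin.natAdd p i) = 0) ∧ rst m ∈ B (∑ i, rst m i) := by
    intro m
    constructor
    · intro h1
      have h2 : ∀ i, m (Fin.natAdd p i) = 0 := by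
        intro i
        by_contra hc
        refine h1 _ (Or.inr ⟨i, rfl⟩) ?_
        rw [Finsupp.single_le_iff]; omega
      refine ⟨h2, ?_⟩
      by_contra hc
      exact h1 _ (Or.inl ⟨rst m, hc, rfl⟩) (ext0_rst m h2).le
    · rintro ⟨h1, h2⟩ m' (⟨v, hv, rfl⟩ | ⟨i, rfl⟩) hle
      · refine hv (hBd v (rst m) (fun i => ?_) h2)
        have := hle (Fin.castAdd s i)
        rwa [ext0_l] at this
      · rw [Finsupp.single_le_iff, h1 i] at hle
        omega
  have hmon : ∀ m : Fin (p+s) →₀ ℕ, monomial m (1:K) ∈ monI K M' ↔ ∃ m' ∈ M', m' ≤ m := by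
    intro m
    classical
    rw [mem_monI, support_monomial, if_neg one_ne_zero]
    simp
  have hue : ∑ i, u i = e := (mem_T.1 (hBT e hu)).2
  refine ⟨M, ?_, ?_, ?_, ?_⟩
  · intro i hi
    obtain ⟨j, rfl⟩ : ∃ j : Fin p, i = Fin.castAdd s j := ⟨⟨i, by omega⟩, rfl⟩
    rw [X_pow_eq_monomial]
    apply Ideal.subset_span
    refine ⟨_, ⟨Pi.single j 2, ?_, rfl⟩, ?_⟩
    · intro hc
      have h1 := (mem_T.1 (hBT _ hc)).1 j
      have h2 : (j : ℕ) < g := hi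
      simp [caps, h2] at h1
    · congr 1
      congr 1
      ext k
      refine Fin.addCases (fun k => ?_) (fun k => ?_) k
      · rw [ext0_l]
        simp [Finsupp.single_apply, Pi.single_apply, eq_comm]
      · rw [ext0_r]
        rw [Finsupp.single_apply, if_neg]
        intro hc
        have := congrArg Fin.val hc
        simp at this
        omega
  · have := RegL_mon (L := K) (List.ofFn fun i : Fin s => Fin.natAdd p i)
      (List.nodup_ofFn.2 (Fin.natAdd_injective s p)) M (by
        intro j hj m hm
        obtain ⟨i, rfl⟩ := (List.mem_ofFn' _ _).1 hj
        obtain ⟨v, _, rfl⟩ := hm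
        exact ext0_r v i)
    rwa [List.map_ofFn] at this
  · rw [hsup]
    refine ⟨monomial (ext0 s u) 1, ?_, ?_⟩
    · rw [hmon]
      push Not
      rw [hN, rst_ext0, hue]
      exact ⟨ext0_r u, hu⟩
    · intro i
      have : X i * monomial (ext0 s u) (1 : K) = monomial (ext0 s u + Finsupp.single i 1) 1 := by
        rw [mul_comm, X, monomial_mul, one_mul]
      rw [this, hmon]
      by_contra hc
      push Not at hc
      obtain ⟨h1, h2⟩ := (hN _).1 hc
      induction i using Fin.addCases with
      | left j =>
        have h3 : rst (ext0 s u + Finsupp.single (Fin.castAdd s j) 1) = u + Pi.single j 1 := by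
          funext k
          simp [rst, ext0_l, Finsupp.single_apply, Pi.single_apply, eq_comm]
        rw [h3] at h2
        have h4 : ∑ k, (u + Pi.single j 1 : Fin p → ℕ) k = e + 1 := by
          simp [Finset.sum_add_distrib, hue]
        rw [h4] at h2
        exact hu2 j h2
      | right j =>
        have := h1 j
        simp at this
  · intro d
    rw [hsup, monI_hf]
    have : {m : Fin (p+s) →₀ ℕ | m.degree = d ∧ ∀ m' ∈ M', ¬ m' ≤ m} = ext0 s '' (B d : Set (Fin p → ℕ)) := by
      ext m
      constructor
      · rintro ⟨h1, h2⟩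
        obtain ⟨h3, h4⟩ := (hN m).1 h2
        have h5 := ext0_rst m h3
        rw [← h5, deg_ext0] at h1
        rw [h1] at h4
        exact ⟨_, h4, h5⟩
      · rintro ⟨v, hv, rfl⟩
        have hs : ∑ i, v i = d := (mem_T.1 (hBT d hv)).2
        refine ⟨by rw [deg_ext0, hs], (hN _).2 ⟨ext0_r v, ?_⟩⟩
        rw [rst_ext0, hs]
        exact hv
    rw [this, Nat.card_coe_set_eq, Set.ncard_image_of_injective, Set.ncard_coe_finset, hBc]
    intro a b hab
    rw [← rst_ext0 (s := s) a, hab, rst_ext0]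

end mons
end CLi


namespace CLi
section fin

lemma cover_card {K : Type*} [Field K] {n g : ℕ} (E : Set (Fin n × Fin n))
    (hht : idealHeight (Ideal.span ((fun e => (X e.1 * X e.2 : MvPolynomial (Fin n) K)) '' E)) = (g : ℕ∞))
    (C : Set (Fin n)) (hC : ∀ e ∈ E, e.1 ∈ C ∨ e.2 ∈ C) : g ≤ C.ncard := by
  have hne : Ideal.span ((X : Fin n → MvPolynomial (Fin n) K) '' C) ≠ ⊤ := by
    intro h
    have h1 : (1 : MvPolynomial (Fin n) K) ∈ Ideal.span (X '' C) := h ▸ Submodule.mem_top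
    rw [mem_ideal_span_X_image] at h1
    obtain ⟨i, _, hi⟩ := h1 0 (by simp)
    simp at hi
  obtain ⟨P, hP⟩ := Ideal.nonempty_minimalPrimes hne
  have h1 := Ideal.height_le_card_of_mem_minimalPrimes_span (C.toFinite.image _) hP
  have hle : Ideal.span ((fun e => (X e.1 * X e.2 : MvPolynomial (Fin n) K)) '' E) ≤ P := by
    rw [Ideal.span_le]
    rintro _ ⟨e, he, rfl⟩
    have hs : ∀ i ∈ C, (X i : MvPolynomial (Fin n) K) ∈ P := fun i hi =>
      hP.1.2 (Ideal.subset_span ⟨i, hi, rfl⟩)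
    rcases hC e he with h | h
    · exact Ideal.mul_mem_right _ _ (hs _ h)
    · exact Ideal.mul_mem_left _ _ (hs _ h)
  have h2 := PrimeSpectrum.height_eq_orderHeight ⟨P, hP.1.1⟩
  have h3 : idealHeight (Ideal.span ((fun e => (X e.1 * X e.2 : MvPolynomial (Fin n) K)) '' E)) ≤
    Order.height (⟨P, hP.1.1⟩ : PrimeSpectrum (MvPolynomial (Fin n) K)) :=
    iInf_le _ (⟨⟨P, hP.1.1⟩, hle⟩ : {Q : PrimeSpectrum (MvPolynomial (Fin n) K) // _ ≤ Q.asIdeal})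
  rw [hht, ← h2] at h3
  have h4 := h3.trans h1
  have h5 : g ≤ ((X : Fin n → MvPolynomial (Fin n) K) '' C).ncard := by exact_mod_cast h4
  exact h5.trans (Set.ncard_image_le C.toFinite)

variable {n : ℕ} {L : Type*} [Field L]

lemma finrank_XC (C : Set (Fin n)) :
    Module.finrank L (Submodule.span L ((X : Fin n → MvPolynomial (Fin n) L) '' C)) = C.ncard := by
  classical
  have h := (linearIndependent_X (Fin n) L)
  have h2 := finrank_span_eq_card (h.comp (Subtype.val : C → Fin n) Subtype.val_injective)
  rw [Set.range_comp, Subtype.range_val] at h2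
  rw [h2, Set.ncard_eq_toFinset_card', Set.toFinset_card]

lemma soc_hom {Q : Ideal (MvPolynomial (Fin n) L)} (hQ : Hg Q)
    (h : ∃ f, f ∉ Q ∧ ∀ i, X i * f ∈ Q) :
    ∃ e f, f ∈ homogeneousSubmodule (Fin n) L e ∧ f ∉ Q ∧ ∀ i, X i * f ∈ Q := by
  obtain ⟨f, hf, hX⟩ := h
  have : ∃ e, homogeneousComponent e f ∉ Q := by
    by_contra hc
    push Not at hc
    apply hf
    rw [← sum_homogeneousComponent f]
    exact Ideal.sum_mem _ fun i _ => hc i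
  obtain ⟨e, he⟩ := this
  refine ⟨e, _, homogeneousComponent_mem e f, he, fun i => ?_⟩
  rw [← comp_mul (X_mem i)]
  exact hQ _ (hX i) _

lemma soc_hf {Q : Ideal (MvPolynomial (Fin n) L)} (hQ : Hg Q) {e f}
    (hf : f ∈ homogeneousSubmodule (Fin n) L e) (hfQ : f ∉ Q) (hX : ∀ i, X i * f ∈ Q) :
    1 ≤ (GI.of Q).hf e ∧ ∀ d, (GI.of (Q ⊔ Ideal.span {f})).hf d =
      Function.update (GI.of Q).hf e ((GI.of Q).hf e - 1) d := by
  have hc : ∀ b : MvPolynomial (Fin n) L, ∃ c : L, b * f - C c * f ∈ Q := by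
    intro b
    induction b using MvPolynomial.induction_on with
    | C a => exact ⟨a, by simp⟩
    | add p q hp hq =>
      obtain ⟨c, hc⟩ := hp
      obtain ⟨c', hc'⟩ := hq
      refine ⟨c + c', ?_⟩
      have := add_mem hc hc'
      rw [C_add]
      convert this using 1
      ring
    | mul_X p i _ =>
      refine ⟨0, ?_⟩
      rw [C_0, zero_mul, sub_zero, mul_assoc]
      exact Ideal.mul_mem_left _ _ (hX i)
  have hU : ∀ d z, z ∈ (GI.of (Q ⊔ Ideal.span {f})).U d → ∃ q ∈ (GI.of Q).U d, ∃ c : L,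
      z = q + c • homogeneousComponent d f := by
    rintro d z ⟨hz, hzd⟩
    obtain ⟨q, hq, r, hr, rfl⟩ := Submodule.mem_sup.1 hz
    obtain ⟨b, rfl⟩ := Ideal.mem_span_singleton'.1 hr
    obtain ⟨c, hcb⟩ := hc b
    refine ⟨homogeneousComponent d (q + (b * f - C c * f)), ⟨hQ _ (add_mem hq hcb) _, homogeneousComponent_mem _ _⟩, c, ?_⟩
    have h3 := homogeneousComponent_of_mem hzd (m := d)
    rw [if_pos rfl] at h3
    rw [← map_smul, ← map_add, smul_eq_C_mul]
    conv_lhs => rw [← h3]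
    congr 1
    ring
  have hle : ∀ d, (GI.of Q).U d ≤ (GI.of (Q ⊔ Ideal.span {f})).U d := fun d z hz =>
    ⟨Ideal.mem_sup_left hz.1, hz.2⟩
  have hne : ∀ d, d ≠ e → (GI.of (Q ⊔ Ideal.span {f})).U d = (GI.of Q).U d := by
    intro d hd
    refine le_antisymm (fun z hz => ?_) (hle d)
    obtain ⟨q, hq, c, rfl⟩ := hU d z hz
    rw [homogeneousComponent_of_mem hf, if_neg hd, smul_zero, add_zero]
    exact hq
  have hee : (GI.of (Q ⊔ Ideal.span {f})).U e = (GI.of Q).U e ⊔ Submodule.span L {f} := by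
    refine le_antisymm (fun z hz => ?_) (sup_le (hle e) ?_)
    · obtain ⟨q, hq, c, rfl⟩ := hU e z hz
      rw [homogeneousComponent_of_mem hf, if_pos rfl]
      exact Submodule.add_mem_sup hq (Submodule.smul_mem _ _ (Submodule.mem_span_singleton_self f))
    · rw [Submodule.span_le, Set.singleton_subset_iff]
      exact ⟨Ideal.mem_sup_right (Ideal.mem_span_singleton_self f), hf⟩
  have := (GI.of Q).fin e
  have hfr := finrank_W_add ((GI.of Q).U e) f (fun h => hfQ h.1)
  rw [← hee] at hfr
  have h1 := (GI.of (Q ⊔ Ideal.span {f})).finrank_le e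
  refine ⟨by unfold GI.hf; omega, fun d => ?_⟩
  by_cases hd : d = e
  · subst hd
    rw [Function.update_self]
    unfold GI.hf
    omega
  · rw [Function.update_of_ne hd, hf_congr (hne d hd)]

universe u

lemma main_aux {K : Type u} [Field K] {n g : ℕ} (E : Set (Fin n × Fin n))
    (hht : idealHeight (Ideal.span ((fun e => (X e.1 * X e.2 : MvPolynomial (Fin n) K)) '' E)) = (g : ℕ∞)) :
    ∃ J : Ideal (MvPolynomial (Fin n) K), IsMonomialIdeal J ∧
      (∀ i : Fin n, (i : ℕ) < g → X i ^ 2 ∈ J) ∧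
      (∀ d : ℕ, hilbertFunction K (Ideal.span ((fun e => (X e.1 * X e.2 : MvPolynomial (Fin n) K)) '' E)) d
        = hilbertFunction K J d) ∧
      projDim (ModuleCat.of (MvPolynomial (Fin n) K) (MvPolynomial (Fin n) K ⧸ J)) =
        projDim (ModuleCat.of (MvPolynomial (Fin n) K) (MvPolynomial (Fin n) K ⧸
          Ideal.span ((fun e => (X e.1 * X e.2 : MvPolynomial (Fin n) K)) '' E))) := by
  let ME : Set (Fin n →₀ ℕ) := (fun e => Finsupp.single e.1 1 + Finsupp.single e.2 1) '' E
  have hme : ∀ (F : Type u) [Field F],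
      Ideal.span ((fun e => (X e.1 * X e.2 : MvPolynomial (Fin n) F)) '' E) = monI F ME := by
    intro F _
    unfold monI
    rw [Set.image_image]
    congr 2
    funext e
    rw [X, X, monomial_mul, one_mul]
  rw [hme]
  have hcov := cover_card E hht
  let L := AlgebraicClosure K
  have hmap : (monI K ME).map (MvPolynomial.map (algebraMap K L)) = monI L ME := by
    rw [← hme, ← hme, Ideal.map_span, Set.image_image]
    simp
  have hQ : Hg (monI L ME) := by
    refine Hg.span ?_
    rintro _ ⟨m, _, rfl⟩
    exact ⟨m.degree, isHomogeneous_monomial _ rfl⟩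
  have h1 : 1 ∉ monI L ME := by
    rw [mem_monI]
    intro h
    obtain ⟨m', ⟨e, _, rfl⟩, hle⟩ := h 0 (by simp)
    have := hle e.1
    simp at this
  have hE : ∀ e ∈ E, X e.1 * X e.2 ∈ monI L ME := by
    intro e he
    rw [← hme]
    exact Ideal.subset_span ⟨e, he, rfl⟩
  have hinf : Infinite L := inferInstance
  obtain ⟨s, p, hps, y, hy, hr, hsoc, h1', hfr, hC⟩ := cut_loop E g n 0 rfl (monI L ME) hQ h1 hE ⊥ bot_le bot_le
    (by simp) (by
      intro C hC
      rw [bot_sup_eq, finrank_XC, add_zero]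
      exact hcov C hC)
  rw [bot_sup_eq, zero_add] at hfr
  rw [bot_sup_eq, zero_add] at hC
  have hgp : g ≤ p := by
    have h2 := hC Set.univ (by simp)
    have := fin_hom (n := n) (L := L) 1
    have h3 : Submodule.span L (Set.range y) ⊔ Submodule.span L (X '' (Set.univ : Set (Fin n))) ≤
        homogeneousSubmodule (Fin n) L 1 := by
      refine sup_le ?_ ?_
      · rw [Submodule.span_le]; rintro _ ⟨i, rfl⟩; exact hy i
      · rw [Submodule.span_le]; rintro _ ⟨i, _, rfl⟩; exact X_mem i
    have h4 := Submodule.finrank_mono h3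
    rw [finrank_one] at h4
    omega
  have hQs : Hg (monI L ME ⊔ Ideal.span (Set.range y)) :=
    hQ.sup (Hg.span (by rintro _ ⟨i, rfl⟩; exact ⟨1, hy i⟩))
  obtain ⟨e, f, hf, hfQ, hX⟩ := soc_hom hQs hsoc
  obtain ⟨he, hupd⟩ := soc_hf hQs hf hfQ hX
  have hW : ∀ Q' : Ideal (MvPolynomial (Fin n) L), monI L ME ⊔ Ideal.span (Set.range y) ≤ Q' →
      ∀ d D, d + 1 ≤ D → Adm (caps p g D) d ((GI.of Q').hf d) ((GI.of Q').hf (d+1)) := by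
    intro Q' hQ'
    refine thmA E p g (GI.of Q') (Submodule.span L (Set.range y)) ?_ (by omega) ?_ ?_
    · rw [Submodule.span_le]
      rintro _ ⟨i, rfl⟩
      exact ⟨hQ' (Ideal.mem_sup_right (Ideal.subset_span ⟨i, rfl⟩)), hy i⟩
    · intro e he
      exact ⟨hQ' (Ideal.mem_sup_left (hE e he)), hom_mul (X_mem _) (X_mem _)⟩
    · intro C hCE
      rw [hfr]
      exact hC C hCE
  have hA := hW _ le_rfl
  have hA2 := hW _ (le_sup_left : _ ≤ monI L ME ⊔ Ideal.span (Set.range y) ⊔ Ideal.span {f})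
  simp only [hupd] at hA2
  subst hps
  obtain ⟨M, hM1, hM2, hM3, hM4⟩ := mon_side (K := K) (s := s) hgp _ e he hA hA2
  have hJ : Hg (monI K M) := by
    refine Hg.span ?_
    rintro _ ⟨m, _, rfl⟩
    exact ⟨m.degree, isHomogeneous_monomial _ rfl⟩
  refine ⟨monI K M, ⟨M, rfl⟩, hM1, fun d => ?_, ?_⟩
  · rw [hf_eq, hf_eq]
    have h2 : (GI.of (monI K ME)).hf d = (GI.of (monI L ME)).hf d := by rw [monI_hf, monI_hf]
    rw [h2]
    refine hf_det s (monI L ME) (monI K M) y (fun i => X (Fin.natAdd p i)) hQ hJ hy (fun i => X_mem _) hr hM2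
      h1' ?_ (fun d => (hM4 d).symm) d
    intro h
    obtain ⟨f, hf, _⟩ := hM3
    exact hf ((Ideal.eq_top_iff_one _).2 h ▸ Submodule.mem_top)
  · rw [projDim_eq _ p, projDim_eq _ p]
    · intro k
      rw [pd_field (L := L), hmap]
      exact pd_cut rfl _ hQ y hy hr f hfQ hX k
    · obtain ⟨f, hf, hX⟩ := hM3
      exact pd_cut rfl _ hJ _ (fun i => X_mem _) hM2 f hf hX

end fin
end CLi

theorem stmt1 {K : Type*} [Field K] {n g : ℕ} (I : Ideal (MvPolynomial (Fin n) K))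
    (hmon : IsQuadraticMonomialIdeal I) (hht : idealHeight I = (g : ℕ∞)) :
    ∃ J : Ideal (MvPolynomial (Fin n) K), IsMonomialIdeal J ∧
      (∀ i : Fin n, (i : ℕ) < g → X i ^ 2 ∈ J) ∧
      (∀ d : ℕ, hilbertFunction K I d = hilbertFunction K J d) ∧
      projDim (ModuleCat.of (MvPolynomial (Fin n) K) (MvPolynomial (Fin n) K ⧸ J)) =
        projDim (ModuleCat.of (MvPolynomial (Fin n) K) (MvPolynomial (Fin n) K ⧸ I)) := by
  obtain ⟨E, rfl⟩ := hmon
  exact CLi.main_aux E hht
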